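/- Let F be a totally real number field and K/F a CM extension such that h(F) is even and the relative class number h(K)/h(F) is odd. Let f_⋄ be the product of all dyadic prime ideals of O_F that are unramified in K. Then an O_F-order B ⊆ O_K has odd relative class number h(B)/h(F) if and only if B contains the O_F-order B_⋄ := O_F + f_⋄·O_K. Moreover, B_⋄ = O_K if and only if F has a single dyadic prime and that prime is ramified in K/F. -/

import Mathlib

/-!
STATEMENT 19: Let `F` be a totally real number field and `K/F` a CM extension such that
`h(F)` is even and the relative class number `h(K)/h(F)` is odd.  Let `f_⋄` be the product
of all dyadic prime ideals of `O_F` that are unramified in `K`.  Then an `O_F`-order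
`B ⊆ O_K` has odd relative class number `h(B)/h(F)` if and only if `B` contains the
`O_F`-order `B_⋄ := O_F + f_⋄·O_K`.  Moreover, `B_⋄ = O_K` if and only if `F` has a single
dyadic prime and that prime is ramified in `K/F`.

Conventions: `h(·)` is the cardinality of the Picard group (invertible = locally principal
fractional ideals modulo principal ones); a dyadic prime is a nonzero prime ideal of `O_F`
containing `2`; `P` is ramified in `K` iff `P·O_K ≤ Q²` for some nonzero prime `Q` of
`O_K`; `B_⋄` is described by its carrier `{f + y : f ∈ O_F, y ∈ f_⋄·O_K}`.
-/

noncomputable section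
set_option synthInstance.maxHeartbeats 1000000
set_option maxHeartbeats 1000000

/-- `F` is totally real: every complex embedding of `F` is real. -/
def TotReal (F : Type*) [Field F] [NumberField F] : Prop :=
  ∀ φ : F →+* ℂ, NumberField.ComplexEmbedding.IsReal φ

/-- A `ℤ`-order in a `ℚ`-algebra `V`: a subring, finitely generated as a `ℤ`-module,
containing a `ℚ`-basis of `V` (i.e. spanning `V` over `ℚ`). -/
def IsZOrder {V : Type*} [Ring V] [Algebra ℚ V] (O : Subalgebra ℤ V) : Prop :=
  (Subalgebra.toSubmodule O).FG ∧ Submodule.span ℚ (O : Set V) = ⊤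
section PicardConstruction

open scoped Pointwise

variable {L : Type*} [CommRing L]

instance unitsCommGroup (A : Subalgebra ℤ L) : CommGroup (Submodule ↥A L)ˣ :=
  Units.instCommGroupUnits (α := Submodule ↥A L)

/-- The subgroup of principal invertible fractional ideals (those generated by a single
invertible element of `L`). -/
def principalSub (A : Subalgebra ℤ L) : Subgroup (Submodule ↥A L)ˣ where
  carrier := {u | ∃ x : L, IsUnit x ∧ (u : Submodule ↥A L) = Submodule.span ↥A {x}}
  one_mem' := ⟨1, isUnit_one, by simp [Submodule.one_eq_span]⟩
  mul_mem' := by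
    rintro u v ⟨x, hx, hux⟩ ⟨y, hy, hvy⟩
    exact ⟨x * y, hx.mul hy, by
      push_cast [hux, hvy]
      rw [Submodule.span_mul_span, Set.singleton_mul_singleton]⟩
  inv_mem' := by
    rintro u ⟨x, hx, hux⟩
    refine ⟨(hx.unit⁻¹ : Lˣ), Units.isUnit _, ?_⟩
    have h1 : (u : Submodule ↥A L) * Submodule.span ↥A {((hx.unit⁻¹ : Lˣ) : L)} = 1 := by
      rw [hux, Submodule.span_mul_span, Set.singleton_mul_singleton]
      simp [Submodule.one_eq_span]
    calc ((u⁻¹ : (Submodule ↥A L)ˣ) : Submodule ↥A L)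
        = (u⁻¹ : (Submodule ↥A L)ˣ) * ((u : Submodule ↥A L) *
            Submodule.span ↥A {((hx.unit⁻¹ : Lˣ) : L)}) := by
            rw [h1]; exact (mul_one ((u⁻¹ : (Submodule ↥A L)ˣ) : Submodule ↥A L)).symm
      _ = Submodule.span ↥A {((hx.unit⁻¹ : Lˣ) : L)} := by
            rw [← mul_assoc, ← Units.val_mul, inv_mul_cancel, Units.val_one]
            exact one_mul (Submodule.span ↥A {((hx.unit⁻¹ : Lˣ) : L)})

/-- The Picard group of a `ℤ`-order `A` realized inside `L`: invertible (equivalently,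
locally principal) fractional `A`-ideals modulo principal fractional `A`-ideals. -/
def Picard (A : Subalgebra ℤ L) : Type _ := (Submodule ↥A L)ˣ ⧸ principalSub A

noncomputable instance (A : Subalgebra ℤ L) : CommGroup (Picard A) :=
  QuotientGroup.Quotient.commGroup (principalSub A)

/-- The ideal class of an invertible fractional ideal in the Picard group. -/
def picCls (A : Subalgebra ℤ L) (u : (Submodule ↥A L)ˣ) : Picard A := QuotientGroup.mk u

/-- The class number `h(A) = |Pic(A)|` of a `ℤ`-order `A` realized in `L`. -/
noncomputable def hPic (A : Subalgebra ℤ L) : ℕ := Nat.card (Picard A)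

end PicardConstruction

section Setup

variable {F : Type*} [Field F] [NumberField F]
variable {K : Type*} [Field K] [NumberField K] [Algebra F K]

/-- The canonical ring homomorphism `O_F → O_K`. -/
noncomputable def jKF (F : Type*) [Field F] [NumberField F]
    (K : Type*) [Field K] [NumberField K] [Algebra F K] :
    ↥(integralClosure ℤ F) →+* ↥(integralClosure ℤ K) :=
  RingHom.codRestrict ((algebraMap F K).comp (SubringClass.subtype (integralClosure ℤ F)))
    (Subalgebra.toSubring (integralClosure ℤ K))
    (fun x => x.2.map (IsScalarTower.toAlgHom ℤ F K))

/-- `P` is a dyadic prime of `O_F`: a nonzero prime ideal containing `2`. -/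
def IsDyadic (P : Ideal ↥(integralClosure ℤ F)) : Prop :=
  P.IsPrime ∧ P ≠ ⊥ ∧ (2 : ↥(integralClosure ℤ F)) ∈ P

/-- `P` is ramified in `K`: `P·O_K ≤ Q²` for some nonzero prime `Q` of `O_K`. -/
def IsRamifiedIn (K : Type*) [Field K] [NumberField K] [Algebra F K]
    (P : Ideal ↥(integralClosure ℤ F)) : Prop :=
  ∃ Q : Ideal ↥(integralClosure ℤ K), Q.IsPrime ∧ Q ≠ ⊥ ∧ Ideal.map (jKF F K) P ≤ Q ^ 2

/-- `f_⋄`: the product of all dyadic primes of `O_F` that are unramified in `K`. -/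
noncomputable def fDiamond (F : Type*) [Field F] [NumberField F]
    (K : Type*) [Field K] [NumberField K] [Algebra F K] :
    Ideal ↥(integralClosure ℤ F) :=
  ∏ᶠ (P : Ideal ↥(integralClosure ℤ F)) (_ : IsDyadic P ∧ ¬ IsRamifiedIn K P), P

/-- The carrier of the order `B_⋄ = O_F + f_⋄·O_K`. -/
noncomputable def BDiamond (F : Type*) [Field F] [NumberField F]
    (K : Type*) [Field K] [NumberField K] [Algebra F K] : Set K :=
  {x : K | ∃ f : ↥(integralClosure ℤ F), ∃ y : ↥(integralClosure ℤ K),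
    y ∈ Ideal.map (jKF F K) (fDiamond F K) ∧ x = algebraMap F K (f : F) + (y : K)}

end Setup

/-- The tent function `max 0 (1 - |x|)`, whose integer translates form a partition of unity. -/
noncomputable def tent (x : ℝ) : ℝ := max 0 (1 - |x|)

lemma tent_nonneg (x : ℝ) : 0 ≤ tent x := le_max_left _ _

lemma tent_le_one (x : ℝ) : tent x ≤ 1 := max_le zero_le_one (by linarith [abs_nonneg x])

lemma tent_eq_zero {x : ℝ} (h : 1 ≤ |x|) : tent x = 0 := max_eq_left (by linarith)

lemma abs_tent_sub_le (x y : ℝ) : |tent x - tent y| ≤ |x - y| := by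
  refine (abs_max_sub_max_le_max _ _ _ _).trans ?_
  rw [sub_self, abs_zero]
  refine max_le (abs_nonneg _) ?_
  rw [show 1 - |x| - (1 - |y|) = |y| - |x| by ring, abs_sub_comm x y]
  exact abs_abs_sub_abs_le y x

/-- The integer translates of the tent function sum to one. -/
lemma sum_tent_add (c : ℝ) : ∑ k ∈ ({-⌊c⌋, -⌊c⌋ - 1} : Finset ℤ), tent (c + k) = 1 := by
  rw [Finset.sum_pair (by omega)]
  have h0 := Int.fract_nonneg c
  have h1 := (Int.fract_lt_one c).le
  have e1 : c + ((-⌊c⌋ : ℤ) : ℝ) = Int.fract c := by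
    push_cast; rw [← sub_eq_add_neg, Int.self_sub_floor]
  have e2 : c + ((-⌊c⌋ - 1 : ℤ) : ℝ) = Int.fract c - 1 := by
    rw [← e1]; push_cast; ring
  rw [e1, e2, tent, tent, abs_of_nonneg h0, abs_of_nonpos (by linarith)]
  rw [max_eq_right (by linarith), max_eq_right (by linarith)]
  ring

lemma tent_add_eq_zero {c : ℝ} {k : ℤ} (hk : k ∉ ({-⌊c⌋, -⌊c⌋ - 1} : Finset ℤ)) :
    tent (c + k) = 0 := by
  apply tent_eq_zero
  simp only [Finset.mem_insert, Finset.mem_singleton, not_or] at hk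
  have h0 := Int.floor_le c
  have h1 := Int.lt_floor_add_one c
  rcases lt_or_ge k (-⌊c⌋ - 1) with h | h
  · have : (k : ℝ) ≤ -⌊c⌋ - 2 := by exact_mod_cast (by omega : k ≤ -⌊c⌋ - 2)
    rw [abs_of_nonpos] <;> linarith
  · have : (-⌊c⌋ + 1 : ℝ) ≤ k := by exact_mod_cast (by omega : -⌊c⌋ + 1 ≤ k)
    rw [abs_of_nonneg] <;> linarith

lemma hasSum_prod_tent {J : Type*} [Fintype J] (c : J → ℝ) :
    HasSum (fun k : J → ℤ => ∏ j, tent (c j + k j)) 1 := by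
  classical
  have h : HasSum (fun k : J → ℤ => ∏ j, tent (c j + k j))
      (∑ k ∈ Fintype.piFinset fun j => ({-⌊c j⌋, -⌊c j⌋ - 1} : Finset ℤ),
        ∏ j, tent (c j + k j)) :=
    hasSum_sum_of_ne_finset_zero (by
      intro k hk
      rw [Fintype.mem_piFinset, not_forall] at hk
      obtain ⟨j, hj⟩ := hk
      exact Finset.prod_eq_zero (Finset.mem_univ j) (tent_add_eq_zero hj))
  have e := Finset.prod_univ_sum (fun j => ({-⌊c j⌋, -⌊c j⌋ - 1} : Finset ℤ))
    (fun j (k : ℤ) => tent (c j + k))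
  rw [← e, Finset.prod_congr rfl fun j _ => sum_tent_add (c j), Finset.prod_const_one] at h
  exact h

lemma abs_prod_tent_sub_le {J : Type*} (s : Finset J) (x y : J → ℝ) :
    |∏ j ∈ s, tent (x j) - ∏ j ∈ s, tent (y j)| ≤ ∑ j ∈ s, |x j - y j| := by
  classical
  induction s using Finset.induction_on with
  | empty => simp
  | insert a s ha ih =>
    rw [Finset.prod_insert ha, Finset.prod_insert ha, Finset.sum_insert ha]
    have hx1 : |∏ j ∈ s, tent (x j)| ≤ 1 := by
      rw [Finset.abs_prod]
      exact Finset.prod_le_one (fun _ _ => abs_nonneg _)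
        fun _ _ => by rw [abs_of_nonneg (tent_nonneg _)]; exact tent_le_one _
    have hy1 : |tent (y a)| ≤ 1 := by rw [abs_of_nonneg (tent_nonneg _)]; exact tent_le_one _
    calc |tent (x a) * ∏ j ∈ s, tent (x j) - tent (y a) * ∏ j ∈ s, tent (y j)|
        = |(tent (x a) - tent (y a)) * ∏ j ∈ s, tent (x j)
          + tent (y a) * (∏ j ∈ s, tent (x j) - ∏ j ∈ s, tent (y j))| := by ring_nf
      _ ≤ |tent (x a) - tent (y a)| * |∏ j ∈ s, tent (x j)|
          + |tent (y a)| * |∏ j ∈ s, tent (x j) - ∏ j ∈ s, tent (y j)| := by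
          rw [← abs_mul, ← abs_mul]; exact abs_add_le _ _
      _ ≤ |x a - y a| * 1 + 1 * ∑ j ∈ s, |x j - y j| := by
          exact add_le_add (mul_le_mul (abs_tent_sub_le _ _) hx1 (abs_nonneg _) (abs_nonneg _))
            (mul_le_mul hy1 ih (abs_nonneg _) zero_le_one)
      _ = _ := by ring

lemma abs_exp_sub_exp_le {x y t : ℝ} (hx : x ≤ t) (hy : y ≤ t) :
    |Real.exp x - Real.exp y| ≤ |x - y| * Real.exp t := by
  wlog h : y ≤ x generalizing x y
  · rw [abs_sub_comm, abs_sub_comm x]; exact this hy hx (le_of_not_ge h)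
  rw [abs_of_nonneg (sub_nonneg.2 (Real.exp_le_exp.2 h)), abs_of_nonneg (sub_nonneg.2 h)]
  have h1 : Real.exp y = Real.exp x * Real.exp (y - x) := by rw [← Real.exp_add]; ring_nf
  have h2 := Real.add_one_le_exp (y - x)
  have h3 := Real.exp_pos x
  have h4 : Real.exp x ≤ Real.exp t := Real.exp_le_exp.2 hx
  nlinarith

lemma abs_log_sub_log_le {a b m R : ℝ} (hm : 0 < m) (ha : m ≤ a) (hb : m ≤ b)
    (h : |a - b| ≤ R) : |Real.log a - Real.log b| ≤ R / m := by
  wlog hab : b ≤ a generalizing a b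
  · rw [abs_sub_comm]; exact this hb ha (by rwa [abs_sub_comm]) (le_of_not_ge hab)
  have hb0 : 0 < b := hm.trans_le hb
  have ha0 : 0 < a := hm.trans_le ha
  rw [abs_of_nonneg (sub_nonneg.2 (Real.log_le_log hb0 hab)), ← Real.log_div ha0.ne' hb0.ne']
  have := Real.log_le_sub_one_of_pos (div_pos ha0 hb0)
  refine this.trans ?_
  rw [abs_of_nonneg (sub_nonneg.2 hab)] at h
  rw [div_sub_one hb0.ne']
  have hR : 0 ≤ R := (sub_nonneg.2 hab).trans h
  gcongr

section Weight

variable {P J : Type*} [Fintype P] [Fintype J]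

/-- The weight attached to logarithmic coordinates `y`: a product of tents in the linear forms
`l j` times a power of the norm. -/
noncomputable def tentWeight (l : J → (P → ℝ) →ₗ[ℝ] ℝ) (m : P → ℕ) (s : ℝ) (y : P → ℝ) : ℝ :=
  (∏ j, tent (l j y)) * Real.exp (-(s * ∑ v, m v * y v))

lemma abs_linear_le (l : (P → ℝ) →ₗ[ℝ] ℝ) :
    ∃ C : ℝ, 0 ≤ C ∧ ∀ (y : P → ℝ) (δ : ℝ), (∀ v, |y v| ≤ δ) → |l y| ≤ C * δ := by
  classical
  refine ⟨∑ v, |l (Pi.single v 1)|, Finset.sum_nonneg fun _ _ => abs_nonneg _, ?_⟩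
  intro y δ h
  have e : l y = ∑ v, y v * l (Pi.single v 1) := by
    conv_lhs => rw [← LinearMap.sum_single_apply (fun _ => ℝ) y]
    rw [map_sum]
    refine Finset.sum_congr rfl fun v _ => ?_
    rw [← smul_eq_mul, ← map_smul]
    congr 1
    ext w; by_cases hw : w = v
    · subst hw; simp
    · simp [hw]
  rw [e, Finset.sum_mul]
  refine (Finset.abs_sum_le_sum_abs _ _).trans (Finset.sum_le_sum fun v _ => ?_)
  rw [abs_mul, mul_comm]
  exact mul_le_mul_of_nonneg_left (h v) (abs_nonneg _)

/-- Lipschitz decay of `tentWeight` under bounded perturbations of the (non-logarithmic)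
coordinates. -/
theorem tentWeight_sub_le (l : J → (P → ℝ) →ₗ[ℝ] ℝ) (m : P → ℕ) (κ : ℝ)
    (hκ : ∀ y, (∀ j, |l j y| ≤ 1) → ∀ v w, y v ≤ y w + κ) (R : ℝ) (hR : 0 ≤ R) :
    ∃ C A₀ : ℝ, 0 ≤ C ∧ R < A₀ ∧ ∀ (a b : P → ℝ) (A : ℝ), (∀ v, 0 < a v) → (∀ v, 0 < b v) →
      (∀ v, |a v - b v| ≤ R) → A₀ ≤ A → (∀ v, a v ≤ A) → (∃ v, a v = A) →
      ∀ s, 1 < s → s ≤ 2 →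
      (((∀ j, |l j fun v => Real.log (a v)| ≤ 1) ∨ (∀ j, |l j fun v => Real.log (b v)| ≤ 1)) →
        ∀ v, R < a v) ∧
      |tentWeight l m s (fun v => Real.log (a v)) - tentWeight l m s (fun v => Real.log (b v))|
        ≤ C * (A ^ (∑ v, m v + 1))⁻¹ := by
  classical
  choose D hD0 hD using fun j => abs_linear_le (l j)
  set c : ℝ := Real.exp (-κ) / 4 with hc
  have hκ0 : P → 0 ≤ κ := fun v => by
    have := hκ 0 (by simp) v v
    simpa using this
  have hc0 : 0 < c := by positivity
  set n : ℕ := ∑ v, m v with hn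
  set C : ℝ := (∑ j, D j) * (R / c) * (c ^ n)⁻¹ + 2 * n * (R / c) * (c ^ n)⁻¹ with hCdef
  have hDs : 0 ≤ ∑ j, D j := Finset.sum_nonneg fun j _ => hD0 j
  have hC0 : 0 ≤ C := by positivity
  refine ⟨C, (R + 1) / c + R + 1, hC0, ?_, ?_⟩
  · have : 0 < (R + 1) / c := by positivity
    linarith
  intro a b A ha hb hab hA haA hv s hs1 hs2
  obtain ⟨v₀, hv₀⟩ := hv
  have hApos : 0 < A := hv₀ ▸ ha v₀
  have hRc : R + 1 ≤ c * A := by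
    have : (R + 1) / c ≤ A := by linarith
    rwa [div_le_iff₀' hc0] at this
  have hexp : Real.exp (-κ) = 4 * c := by rw [hc]; ring
  have hexp1 : Real.exp (-κ) ≤ 1 := Real.exp_le_one_iff.2 (by linarith [hκ0 v₀])
  have hpos : 0 < c * A := by positivity
  have key : ∀ x : P → ℝ, (∀ v, 0 < x v) → (∀ j, |l j fun v => Real.log (x v)| ≤ 1) →
      ∀ v w, 4 * c * x w ≤ x v := by
    intro x hx h v w
    have := hκ _ h w v
    rw [← hexp]
    calc Real.exp (-κ) * x w = Real.exp (-κ + Real.log (x w)) := by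
          rw [Real.exp_add, Real.exp_log (hx w)]
      _ ≤ Real.exp (Real.log (x v)) := Real.exp_le_exp.2 (by linarith)
      _ = x v := Real.exp_log (hx v)
  have hboth : ((∀ j, |l j fun v => Real.log (a v)| ≤ 1) ∨
      (∀ j, |l j fun v => Real.log (b v)| ≤ 1)) → ∀ v, c * A ≤ a v ∧ c * A ≤ b v := by
    rintro (h | h) v
    · have h1 := key a ha h v v₀
      rw [hv₀] at h1
      have h2 := abs_le.1 (hab v)
      constructor <;> nlinarith
    · have h1 := key b hb h v v₀
      have h2 := abs_le.1 (hab v)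
      have h3 := abs_le.1 (hab v₀)
      rw [hv₀] at h3
      have h4 : A - R ≤ b v₀ := by linarith
      have h5 : 4 * c * (A - R) ≤ b v := by nlinarith
      have h6 : 4 * c * R ≤ R := by nlinarith
      constructor <;> nlinarith
  refine ⟨fun h v => by linarith [(hboth h v).1], ?_⟩
  by_cases hcase : (∀ j, |l j fun v => Real.log (a v)| ≤ 1) ∨
      (∀ j, |l j fun v => Real.log (b v)| ≤ 1)
  swap
  · have hz : ∀ x : P → ℝ, ¬ (∀ j, |l j x| ≤ 1) → tentWeight l m s x = 0 := by
      intro x hx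
      push Not at hx
      obtain ⟨j, hj⟩ := hx
      rw [tentWeight, Finset.prod_eq_zero (Finset.mem_univ j) (tent_eq_zero hj.le), zero_mul]
    rw [not_or] at hcase
    rw [hz _ hcase.1, hz _ hcase.2, sub_zero, abs_zero]
    positivity
  have hlow := hboth hcase
  have hlog : ∀ v, |Real.log (a v) - Real.log (b v)| ≤ R / (c * A) := fun v =>
    abs_log_sub_log_le hpos (hlow v).1 (hlow v).2 (hab v)
  have hsumlow : ∀ x : P → ℝ, (∀ v, c * A ≤ x v) →
      -(s * ∑ v, m v * Real.log (x v)) ≤ -(n * Real.log (c * A)) := by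
    intro x hx
    have hlog0 : 0 ≤ Real.log (c * A) := Real.log_nonneg (by linarith)
    have h1 : (n : ℝ) * Real.log (c * A) ≤ ∑ v, m v * Real.log (x v) := by
      rw [hn, Nat.cast_sum, Finset.sum_mul]
      exact Finset.sum_le_sum fun v _ => mul_le_mul_of_nonneg_left
        (Real.log_le_log hpos (hx v)) (Nat.cast_nonneg _)
    have h0 : 0 ≤ (n : ℝ) * Real.log (c * A) := by positivity
    nlinarith
  have hexpn : Real.exp (-(n * Real.log (c * A))) = ((c * A) ^ n)⁻¹ := by
    rw [Real.exp_neg, mul_comm, Real.exp_mul, Real.exp_log hpos, Real.rpow_natCast]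
  have hE := abs_exp_sub_exp_le (hsumlow a fun v => (hlow v).1) (hsumlow b fun v => (hlow v).2)
  rw [hexpn] at hE
  have hEa : Real.exp (-(s * ∑ v, m v * Real.log (a v))) ≤ ((c * A) ^ n)⁻¹ := by
    rw [← hexpn]; exact Real.exp_le_exp.2 (hsumlow a fun v => (hlow v).1)
  have hPdiff : |∏ j, tent (l j fun v => Real.log (a v)) -
      ∏ j, tent (l j fun v => Real.log (b v))| ≤ (∑ j, D j) * (R / (c * A)) := by
    refine (abs_prod_tent_sub_le _ _ _).trans ?_
    rw [Finset.sum_mul]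
    refine Finset.sum_le_sum fun j _ => ?_
    rw [← map_sub]
    exact hD j _ _ hlog
  have hPb : |∏ j, tent (l j fun v => Real.log (b v))| ≤ 1 := by
    rw [Finset.abs_prod]
    exact Finset.prod_le_one (fun _ _ => abs_nonneg _)
      fun _ _ => by rw [abs_of_nonneg (tent_nonneg _)]; exact tent_le_one _
  have hSdiff : |-(s * ∑ v, m v * Real.log (a v)) - -(s * ∑ v, m v * Real.log (b v))|
      ≤ 2 * n * (R / (c * A)) := by
    rw [show -(s * ∑ v, m v * Real.log (a v)) - -(s * ∑ v, m v * Real.log (b v))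
      = -(s * ∑ v, m v * (Real.log (a v) - Real.log (b v))) by
        simp only [mul_sub, Finset.sum_sub_distrib]; ring]
    rw [abs_neg, abs_mul, abs_of_pos (by linarith : 0 < s)]
    have h1 : |∑ v, (m v : ℝ) * (Real.log (a v) - Real.log (b v))| ≤ n * (R / (c * A)) := by
      rw [hn, Nat.cast_sum, Finset.sum_mul]
      refine (Finset.abs_sum_le_sum_abs _ _).trans (Finset.sum_le_sum fun v _ => ?_)
      rw [abs_mul, Nat.abs_cast]
      exact mul_le_mul_of_nonneg_left (hlog v) (Nat.cast_nonneg _)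
    rw [mul_assoc]
    exact mul_le_mul hs2 h1 (abs_nonneg _) zero_le_two
  rw [tentWeight, tentWeight]
  set Pa := ∏ j, tent (l j fun v => Real.log (a v))
  set Pb := ∏ j, tent (l j fun v => Real.log (b v))
  set Ea := Real.exp (-(s * ∑ v, m v * Real.log (a v)))
  set Eb := Real.exp (-(s * ∑ v, m v * Real.log (b v)))
  have hEa0 : 0 < Ea := Real.exp_pos _
  calc |Pa * Ea - Pb * Eb| = |(Pa - Pb) * Ea + Pb * (Ea - Eb)| := by ring_nf
    _ ≤ |Pa - Pb| * Ea + |Pb| * |Ea - Eb| := by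
        refine (abs_add_le _ _).trans ?_
        rw [abs_mul, abs_mul, abs_of_pos hEa0]
    _ ≤ ((∑ j, D j) * (R / (c * A))) * ((c * A) ^ n)⁻¹
          + 1 * ((2 * n * (R / (c * A))) * ((c * A) ^ n)⁻¹) := by
        gcongr
        refine hE.trans ?_
        gcongr
    _ = C * (A ^ (n + 1))⁻¹ := by
        rw [hCdef, mul_pow, pow_succ]
        field_simp

end Weight

section NumberFieldWeight

open NumberField NumberField.InfinitePlace NumberField.Units
open NumberField.Units.dirichletUnitTheorem

variable (N : Type*) [Field N] [NumberField N]

/-- The logarithms of the infinite absolute values of `x`. -/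
noncomputable def placeLog (x : N) : InfinitePlace N → ℝ := fun v => Real.log (v x)

/-- The projection of a family of real numbers indexed by infinite places to the logarithmic
space, killing the constant families. -/
noncomputable def toLogSpace : (InfinitePlace N → ℝ) →ₗ[ℝ] logSpace N where
  toFun y w := mult w.1 * (y w.1 - (∑ v, mult v * y v) / Module.finrank ℚ N)
  map_add' x y := by
    ext w
    simp only [Pi.add_apply, mul_add, Finset.sum_add_distrib]
    ring
  map_smul' c y := by
    ext w
    simp only [Pi.smul_apply, smul_eq_mul, RingHom.id_apply]
    rw [show ∑ v, (mult v : ℝ) * (c * y v) = c * ∑ v, mult v * y v by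
      rw [Finset.mul_sum]; exact Finset.sum_congr rfl fun _ _ => by ring]
    ring

open scoped Classical in
/-- The real basis of the logarithmic space given by a fundamental system of units. -/
noncomputable def unitBasis : Module.Basis (Fin (rank N)) ℝ (logSpace N) :=
  (basisUnitLattice N).ofZLatticeBasis ℝ (unitLattice N)

/-- Coordinates of a family of real numbers with respect to the fundamental units. -/
noncomputable def unitCoord (j : Fin (rank N)) : (InfinitePlace N → ℝ) →ₗ[ℝ] ℝ :=
  (unitBasis N).coord j ∘ₗ toLogSpace N

variable {N}

omit [NumberField N] in
lemma placeLog_mul {x y : N} (hx : x ≠ 0) (hy : y ≠ 0) :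
    placeLog N (x * y) = placeLog N x + placeLog N y := by
  ext v
  simp only [placeLog, map_mul, Pi.add_apply]
  exact Real.log_mul ((map_ne_zero v).2 hx) ((map_ne_zero v).2 hy)

lemma toLogSpace_placeLog_unit (u : (𝓞 N)ˣ) :
    toLogSpace N (placeLog N (u : N)) = logEmbedding N (Additive.ofMul u) := by
  ext w
  have := sum_mult_mul_log u
  simp only [toLogSpace, LinearMap.coe_mk, AddHom.coe_mk, placeLog, this, zero_div, sub_zero,
    logEmbedding_component]

open scoped Classical in
lemma unitCoord_unit (ζ : torsion N) (e : Fin (rank N) → ℤ) (j : Fin (rank N)) :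
    unitCoord N j (placeLog N ((ζ * ∏ i, (fundSystem N i) ^ (e i) : (𝓞 N)ˣ) : N)) = e j := by
  rw [unitCoord, LinearMap.comp_apply, toLogSpace_placeLog_unit, ofMul_mul, map_add,
    logEmbedding_eq_zero_iff.2 ζ.2, zero_add, ofMul_prod, map_sum, map_sum]
  have h : ∀ i, (unitBasis N).coord j (logEmbedding N (Additive.ofMul (fundSystem N i ^ e i)))
      = if i = j then (e i : ℝ) else 0 := by
    intro i
    rw [ofMul_zpow, map_zsmul, logEmbedding_fundSystem, map_zsmul, Module.Basis.coord_apply,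
      unitBasis, Module.Basis.ofZLatticeBasis_repr_apply, Module.Basis.repr_self,
      Finsupp.single_apply]
    split_ifs <;> simp
  rw [Finset.sum_congr rfl fun i _ => h i, Finset.sum_ite_eq' Finset.univ j]
  simp

variable (N) in
lemma exists_unitCoord_bound : ∃ κ : ℝ, ∀ y : InfinitePlace N → ℝ,
    (∀ j, |unitCoord N j y| ≤ 1) → ∀ v w, y v ≤ y w + κ := by
  classical
  set D : ℝ := ∑ j, ‖unitBasis N j‖
  have hD0 : 0 ≤ D := Finset.sum_nonneg fun _ _ => norm_nonneg _
  set c : ℝ := (Fintype.card (InfinitePlace N) : ℝ) with hc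
  refine ⟨2 * (D + c * D), fun y hy => ?_⟩
  set A := (∑ v, mult v * y v) / Module.finrank ℚ N with hA
  have hnorm : ‖toLogSpace N y‖ ≤ D := by
    rw [← (unitBasis N).sum_repr (toLogSpace N y)]
    refine (norm_sum_le _ _).trans (Finset.sum_le_sum fun j _ => ?_)
    rw [norm_smul]
    exact mul_le_of_le_one_left (norm_nonneg _) (hy j)
  have hmult : ∀ v : InfinitePlace N, (1 : ℝ) ≤ mult v := fun v => by
    exact_mod_cast one_le_mult
  have h1 : ∀ v : InfinitePlace N, v ≠ w₀ → |mult v * (y v - A)| ≤ D := fun v hv =>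
    (norm_le_pi_norm (toLogSpace N y) ⟨v, hv⟩).trans hnorm
  have hsum : ∑ v, mult v * (y v - A) = 0 := by
    have hn : (Module.finrank ℚ N : ℝ) ≠ 0 := by
      exact_mod_cast Module.finrank_pos.ne'
    simp only [mul_sub, Finset.sum_sub_distrib]
    rw [← Finset.sum_mul, ← Nat.cast_sum, sum_mult_eq, hA, mul_div_cancel₀ _ hn, sub_self]
  have h2 : ∀ v : InfinitePlace N, |mult v * (y v - A)| ≤ D + c * D := by
    intro v
    by_cases hv : v = w₀
    · subst hv
      rw [← Finset.add_sum_erase _ _ (Finset.mem_univ w₀)] at hsum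
      rw [eq_neg_of_add_eq_zero_left hsum, abs_neg]
      refine (Finset.abs_sum_le_sum_abs _ _).trans ?_
      refine (Finset.sum_le_card_nsmul _ _ D fun v hv => h1 v (Finset.ne_of_mem_erase hv)).trans ?_
      rw [nsmul_eq_mul]
      have : (((Finset.univ : Finset (InfinitePlace N)).erase w₀).card : ℝ) ≤ c := by
        rw [hc]; exact_mod_cast Finset.card_le_univ _
      nlinarith
    · have := h1 v hv
      have : 0 ≤ c * D := by positivity
      linarith [h1 v hv]
  have h3 : ∀ v : InfinitePlace N, |y v - A| ≤ D + c * D := by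
    intro v
    refine le_trans ?_ (h2 v)
    rw [abs_mul, abs_of_pos (zero_lt_one.trans_le (hmult v))]
    exact le_mul_of_one_le_left (abs_nonneg _) (hmult v)
  intro v w
  linarith [(abs_le.1 (h3 v)).2, (abs_le.1 (h3 w)).1]

/-- A weight on `N` whose translates by units form a partition of a constant. -/
noncomputable def unitWeight (x : N) : ℝ := ∏ j, tent (unitCoord N j (placeLog N x))

lemma unitWeight_nonneg (x : N) : 0 ≤ unitWeight x := Finset.prod_nonneg fun _ _ => tent_nonneg _

lemma unitWeight_le_one (x : N) : unitWeight x ≤ 1 :=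
  Finset.prod_le_one (fun _ _ => tent_nonneg _) fun _ _ => tent_le_one _

variable (N) in
/-- Units are products of a root of unity and powers of the fundamental units. -/
lemma exists_units_equiv : ∃ e : torsion N × (Fin (rank N) → ℤ) ≃ (𝓞 N)ˣ,
    ∀ p j, unitCoord N j (placeLog N (e p : N)) = p.2 j := by
  refine ⟨Equiv.ofBijective (fun ζe => ζe.1 * ∏ i, (fundSystem N i) ^ (ζe.2 i)) ?_,
    fun p j => unitCoord_unit p.1 p.2 j⟩
  rw [Function.bijective_iff_existsUnique]
  intro u
  obtain ⟨p, hp, hu⟩ := exist_unique_eq_mul_prod N u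
  exact ⟨p, hp.symm, fun q hq => hu q hq.symm⟩

lemma hasSum_unitWeight {x : N} (hx : x ≠ 0) :
    HasSum (fun u : (𝓞 N)ˣ => unitWeight ((u : N) * x)) (Nat.card (torsion N) : ℝ) := by
  obtain ⟨e, he⟩ := exists_units_equiv N
  rw [← e.hasSum_iff]
  have h2 : HasSum (fun _ : torsion N => (1 : ℝ)) (Nat.card (torsion N) : ℝ) := by
    have := Fintype.ofFinite (torsion N)
    rw [Nat.card_eq_fintype_card]
    simpa using hasSum_fintype (fun _ : torsion N => (1 : ℝ))
  have h5 : HasSum (fun p : torsion N × (Fin (rank N) → ℤ) =>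
      (1 : ℝ) * ∏ j, tent (unitCoord N j (placeLog N x) + p.2 j)) (Nat.card (torsion N) : ℝ) := by
    have h3 := hasSum_prod_tent fun j => unitCoord N j (placeLog N x)
    have hs := h2.summable.mul_of_nonneg h3.summable (fun _ => zero_le_one)
      fun _ => Finset.prod_nonneg fun _ _ => tent_nonneg _
    have h4 := h2.mul h3 hs
    rwa [mul_one] at h4
  have hfun : (fun u : (𝓞 N)ˣ => unitWeight ((u : N) * x)) ∘ e =
      fun p : torsion N × (Fin (rank N) → ℤ) =>
        (1 : ℝ) * ∏ j, tent (unitCoord N j (placeLog N x) + p.2 j) := by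
    funext p
    rw [Function.comp_apply, unitWeight, placeLog_mul (coe_ne_zero _) hx, one_mul]
    refine Finset.prod_congr rfl fun j _ => ?_
    rw [map_add, he, add_comm]
  rwa [hfun]

/-- A term of the smoothed partial zeta function. -/
noncomputable def smoothTerm (s : ℝ) (x : 𝓞 N) : ℝ :=
  unitWeight (x : N) * (Ideal.absNorm (Ideal.span {x}) : ℝ) ^ (-s)

lemma smoothTerm_nonneg (s : ℝ) (x : 𝓞 N) : 0 ≤ smoothTerm s x :=
  mul_nonneg (unitWeight_nonneg _) (by positivity)

lemma natCast_rpow_neg_le_one (n : ℕ) {s : ℝ} (hs : 0 < s) : (n : ℝ) ^ (-s) ≤ 1 := by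
  rcases Nat.eq_zero_or_pos n with rfl | h
  · rw [Nat.cast_zero, Real.zero_rpow (by linarith)]; exact zero_le_one
  · exact Real.rpow_le_one_of_one_le_of_nonpos (by exact_mod_cast h) (by linarith)

lemma smoothTerm_le_one {s : ℝ} (hs : 0 < s) (x : 𝓞 N) : smoothTerm s x ≤ 1 :=
  mul_le_one₀ (unitWeight_le_one _) (by positivity) (natCast_rpow_neg_le_one _ hs)

lemma smoothTerm_eq {s : ℝ} {x : 𝓞 N} (hx : x ≠ 0) :
    smoothTerm s x = tentWeight (unitCoord N) (fun v => mult v) s (placeLog N (x : N)) := by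
  rw [smoothTerm, tentWeight, unitWeight]
  congr 1
  have hx' : (x : N) ≠ 0 := by simpa using hx
  have h0 : (0 : ℝ) < Ideal.absNorm (Ideal.span {x}) := by
    rw [Nat.cast_pos, Nat.pos_iff_ne_zero, Ne, Ideal.absNorm_eq_zero_iff,
      Ideal.span_singleton_eq_bot]
    exact hx
  have h1 : (Ideal.absNorm (Ideal.span {x}) : ℝ) = ∏ w : InfinitePlace N, w (x : N) ^ mult w := by
    rw [prod_eq_abs_norm, Ideal.absNorm_span_singleton]
    rw [← Algebra.coe_norm_int, Nat.cast_natAbs]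
    push_cast
    rfl
  rw [Real.rpow_def_of_pos h0]
  congr 1
  rw [h1, Real.log_prod (fun v _ => pow_ne_zero _ ((map_ne_zero v).2 hx'))]
  simp only [Real.log_pow, placeLog]
  ring

variable (N) in
open scoped Classical in
lemma summable_mixedEmbedding_norm : Summable fun x : 𝓞 N =>
    ‖mixedEmbedding N (x : N)‖⁻¹ ^ (Module.finrank ℚ N + 1) := by
  classical
  let f : 𝓞 N →ₗ[ℤ] mixedEmbedding.mixedSpace N :=
    ((mixedEmbedding N).comp (algebraMap (𝓞 N) N)).toIntAlgHom.toLinearMap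
  have hf : Function.Injective f :=
    (mixedEmbedding_injective N).comp RingOfIntegers.coe_injective
  let e := LinearEquiv.ofInjective f hf
  have hr : Module.finrank ℤ (mixedEmbedding.integerLattice N) = Module.finrank ℚ N := by
    rw [← RingOfIntegers.rank N]; exact e.symm.finrank_eq
  have := ZLattice.summable_norm_pow_inv (mixedEmbedding.integerLattice N)
    (Module.finrank ℚ N + 1) (by rw [hr]; omega)
  have h2 := e.toEquiv.summable_iff.2 this
  refine h2.congr fun x => ?_
  rfl

end NumberFieldWeight

section Variation

open NumberField NumberField.InfinitePlace

variable {N : Type*} [Field N] [NumberField N]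

open scoped Classical in
/-- Terms of the smoothed partial zeta function, twisted by a bounded function that is locally
constant away from sign changes, vary by a summable amount under translation, uniformly in `s`. -/
theorem exists_summable_smoothTerm_sub_le (r : 𝓞 N) :
    ∃ g : 𝓞 N → ℝ, Summable g ∧ ∀ ε : 𝓞 N → ℝ, (∀ x, |ε x| ≤ 1) →
      (∀ x, x ≠ 0 → x + r ≠ 0 → (∀ φ : N →+* ℝ, 0 < φ x ↔ 0 < φ (x + r : 𝓞 N)) →
        ε (x + r) = ε x) →
      ∀ s, 1 < s → s ≤ 2 → ∀ x,
        |ε (x + r) * smoothTerm s (x + r) - ε x * smoothTerm s x| ≤ g x := by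
  obtain ⟨κ, hκ⟩ := exists_unitCoord_bound N
  set n := Module.finrank ℚ N with hn
  set R : ℝ := ∑ v : InfinitePlace N, v (r : N) with hRdef
  have hRv : ∀ v : InfinitePlace N, v (r : N) ≤ R := fun v =>
    Finset.single_le_sum (f := fun v : InfinitePlace N => v (r : N))
      (fun v _ => apply_nonneg v _) (Finset.mem_univ v)
  have hR : 0 ≤ R := Finset.sum_nonneg fun v _ => apply_nonneg v _
  obtain ⟨C, A₀, hC, hRA, key⟩ :=
    tentWeight_sub_le (unitCoord N) (fun v => mult v) κ hκ R hR
  have hA₀ : 0 < A₀ := hR.trans_lt hRA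
  set q : 𝓞 N → ℝ := fun x => ‖mixedEmbedding N (x : N)‖⁻¹ ^ (n + 1)
  have hq : Summable q := summable_mixedEmbedding_norm N
  have hδ : Summable (fun x : 𝓞 N => if x = 0 then (2 : ℝ) else 0) :=
    (hasSum_ite_eq (0 : 𝓞 N) (2 : ℝ)).summable
  refine ⟨fun x => (if x = 0 then (2 : ℝ) else 0) + (2 * A₀ ^ (n + 1) + C) * q x,
    hδ.add (hq.mul_left _), ?_⟩
  intro ε hε hεr s hs1 hs2 x
  have hs0 : 0 < s := by linarith
  have hle : ∀ y, |ε y * smoothTerm s y| ≤ 1 := fun y => by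
    rw [abs_mul, abs_of_nonneg (smoothTerm_nonneg s y)]
    exact mul_le_one₀ (hε y) (smoothTerm_nonneg s y) (smoothTerm_le_one hs0 y)
  have htriv : |ε (x + r) * smoothTerm s (x + r) - ε x * smoothTerm s x| ≤ 2 := by
    refine (abs_sub _ _).trans ?_
    linarith [hle x, hle (x + r)]
  have hq0 : 0 ≤ q x := by positivity
  have hcoef : 0 ≤ 2 * A₀ ^ (n + 1) + C := by positivity
  by_cases hx : x = 0
  · simp only [hx, if_true] at htriv ⊢
    have : 0 ≤ (2 * A₀ ^ (n + 1) + C) * q 0 := hx ▸ mul_nonneg hcoef hq0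
    linarith
  simp only [hx, if_false, zero_add]
  set A := ‖mixedEmbedding N (x : N)‖ with hA
  have hx' : (x : N) ≠ 0 := by simpa using hx
  have hApos : 0 < A := norm_pos_iff.2 fun h => hx' ((map_eq_zero _).1 h)
  have hqx : q x = (A ^ (n + 1))⁻¹ := inv_pow A _
  rw [hqx]
  have hAn : 0 < A ^ (n + 1) := by positivity
  rcases lt_or_ge A A₀ with hsmall | hbig
  · refine htriv.trans ?_
    have h1 : A ^ (n + 1) ≤ A₀ ^ (n + 1) := by gcongr
    rw [← div_eq_mul_inv, le_div_iff₀ hAn]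
    nlinarith
  have hAsup : A = Finset.univ.sup' Finset.univ_nonempty fun v : InfinitePlace N => v (x : N) := by
    rw [hA, mixedEmbedding.norm_eq_sup'_normAtPlace]
    congr 1
    funext v
    exact mixedEmbedding.normAtPlace_apply v _
  have hle' : ∀ v : InfinitePlace N, v (x : N) ≤ A := fun v => by
    rw [hAsup]
    exact Finset.le_sup' (fun v : InfinitePlace N => v (x : N)) (Finset.mem_univ v)
  obtain ⟨v₀, -, hv₀⟩ := Finset.exists_mem_eq_sup' Finset.univ_nonempty
    fun v : InfinitePlace N => v (x : N)
  rw [← hAsup] at hv₀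
  have hxr : x + r ≠ 0 := by
    intro h
    have h1 : (x : N) = -(r : N) := by
      rw [← map_neg]; exact congrArg _ (eq_neg_of_add_eq_zero_left h)
    have h2 : v₀ (x : N) ≤ R := by
      rw [h1]
      refine le_trans (le_of_eq ?_) (hRv v₀)
      rw [← v₀.norm_embedding_eq, ← v₀.norm_embedding_eq, map_neg, norm_neg]
    linarith
  have hxr' : ((x + r : 𝓞 N) : N) ≠ 0 := by
    intro h; exact hxr (RingOfIntegers.ext (by simpa using h))
  have hco : ((x + r : 𝓞 N) : N) = (x : N) + (r : N) := map_add (algebraMap (𝓞 N) N) x r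
  have hdiff : ∀ v : InfinitePlace N, |v (x : N) - v ((x + r : 𝓞 N) : N)| ≤ R := by
    intro v
    refine le_trans ?_ (hRv v)
    rw [← v.norm_embedding_eq, ← v.norm_embedding_eq, ← v.norm_embedding_eq (r : N)]
    refine (abs_norm_sub_norm_le _ _).trans (le_of_eq ?_)
    rw [← map_sub, hco, sub_add_cancel_left, map_neg, norm_neg]
  obtain ⟨hor, hbound⟩ := key (fun v => v (x : N)) (fun v => v ((x + r : 𝓞 N) : N)) A
    (fun v => pos_iff.2 hx') (fun v => pos_iff.2 hxr') hdiff hbig hle' ⟨v₀, hv₀.symm⟩ s hs1 hs2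
  rw [sum_mult_eq] at hbound
  have hfin : C * (A ^ (n + 1))⁻¹ ≤ (2 * A₀ ^ (n + 1) + C) * (A ^ (n + 1))⁻¹ := by
    have : 0 ≤ A₀ ^ (n + 1) := by positivity
    gcongr
    linarith
  rw [smoothTerm_eq hx, smoothTerm_eq hxr]
  refine le_trans ?_ hfin
  by_cases hcase : (∀ j, |unitCoord N j fun v => Real.log (v (x : N))| ≤ 1) ∨
      (∀ j, |unitCoord N j fun v => Real.log (v ((x + r : 𝓞 N) : N))| ≤ 1)
  · have hsign : ε (x + r) = ε x := by
      refine hεr x hx hxr fun φ => ?_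
      set v := InfinitePlace.mk ((algebraMap ℝ ℂ).comp φ)
      have hv : ∀ y : N, v y = |φ y| := fun y => by
        change ‖((φ y : ℝ) : ℂ)‖ = _
        rw [Complex.norm_real, Real.norm_eq_abs]
      have h1 := hor hcase v
      have h2 : |φ (r : N)| ≤ R := (hv _).symm.le.trans (hRv v)
      rw [hv] at h1
      rw [hco, map_add]
      have h3 := abs_le.1 h2
      rcases le_or_gt 0 (φ (x : N)) with h | h
      · rw [abs_of_nonneg h] at h1
        constructor <;> intro <;> linarith
      · rw [abs_of_neg h] at h1
        constructor <;> intro <;> linarith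
    rw [hsign, ← mul_sub, abs_mul, abs_sub_comm]
    exact (mul_le_of_le_one_left (abs_nonneg _) (hε x)).trans hbound
  · have hz : ∀ y : InfinitePlace N → ℝ, ¬ (∀ j, |unitCoord N j y| ≤ 1) →
        tentWeight (unitCoord N) (fun v => mult v) s y = 0 := by
      intro y hy
      push Not at hy
      obtain ⟨j, hj⟩ := hy
      rw [tentWeight, Finset.prod_eq_zero (Finset.mem_univ j) (tent_eq_zero hj.le), zero_mul]
    rw [not_or] at hcase
    have z1 := hz _ hcase.1
    have z2 := hz _ hcase.2
    unfold placeLog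
    rw [z1, z2]
    simp only [mul_zero, sub_zero, abs_zero]
    positivity

end Variation

section IdealSeries

open NumberField Filter Topology IsDedekindDomain

/-- The real `s`-th power term of an ideal in a Dirichlet series. -/
noncomputable def normTerm {N : Type*} [Field N] [NumberField N] (s : ℝ) (a : Ideal (𝓞 N)) : ℝ :=
  (Ideal.absNorm a : ℝ) ^ (-s)

variable {N : Type*} [Field N] [NumberField N]

lemma normTerm_nonneg (s : ℝ) (a : Ideal (𝓞 N)) : 0 ≤ normTerm s a :=
  Real.rpow_nonneg (Nat.cast_nonneg _) _

lemma normTerm_mul (s : ℝ) (a b : Ideal (𝓞 N)) :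
    normTerm s (a * b) = normTerm s a * normTerm s b := by
  rw [normTerm, normTerm, normTerm, map_mul, Nat.cast_mul,
    Real.mul_rpow (Nat.cast_nonneg _) (Nat.cast_nonneg _)]

lemma normTerm_top (s : ℝ) : normTerm s (⊤ : Ideal (𝓞 N)) = 1 := by
  simp [normTerm]

lemma normTerm_bot {s : ℝ} (hs : 0 < s) : normTerm s (⊥ : Ideal (𝓞 N)) = 0 := by
  simp [normTerm, Real.zero_rpow (neg_ne_zero.2 hs.ne')]

open Finset in
lemma tendsto_sum_card_absNorm_div (N : Type*) [Field N] [NumberField N] : ∃ l : ℝ,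
    Tendsto (fun n : ℕ => (∑ k ∈ Icc 1 n,
      (Nat.card {I : Ideal (𝓞 N) // Ideal.absNorm I = k} : ℝ)) / n) atTop (𝓝 l) := by
  refine ⟨_, ((Ideal.tendsto_norm_le_div_atTop₀ N).comp tendsto_natCast_atTop_atTop).congr
    fun n ↦ ?_⟩
  simp only [Function.comp_apply, Nat.cast_le, ← Nat.cast_sum]
  congr
  rw [← add_left_inj 1, ← Ideal.card_norm_le_eq_card_norm_le_add_one,
    show Finset.Icc 1 n = Finset.Ioc 0 n from Finset.Icc_succ_left_eq_Ioc _ _,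
    show 1 = Nat.card {I : Ideal (𝓞 N) // Ideal.absNorm I = 0} by
      simp [Ideal.absNorm_eq_zero_iff],
    Finset.sum_Ioc_add_eq_sum_Icc (n.zero_le),
    ← Finset.card_preimage_eq_sum_card_image_eq
      (fun k _ ↦ Ideal.finite_setOfPred_absNorm_eq k)]
  simp [Set.coe_eq_subtype]

lemma summable_card_absNorm {s : ℝ} (hs : 1 < s) : Summable fun n : ℕ =>
    (Nat.card {I : Ideal (𝓞 N) // Ideal.absNorm I = n} : ℝ) * (n : ℝ) ^ (-s) := by
  obtain ⟨l, hl⟩ := tendsto_sum_card_absNorm_div N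
  have hO : (fun n : ℕ => ∑ k ∈ Finset.Icc 1 n,
      (Nat.card {I : Ideal (𝓞 N) // Ideal.absNorm I = k} : ℝ)) =O[atTop]
        fun n : ℕ => (n : ℝ) ^ (1 : ℝ) := by
    refine Asymptotics.isBigO_of_div_tendsto_nhds (Eventually.of_forall ?_) l ?_
    · intro n hn
      have : n = 0 := by simpa using hn
      simp [this]
    · refine hl.congr fun n => ?_
      simp
  have := LSeriesSummable_of_sum_norm_bigO_and_nonneg (s := (s : ℂ)) hO
    (fun _ => Nat.cast_nonneg _) zero_le_one (by simpa using hs)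
  have h2 := this.norm
  refine h2.congr fun n => ?_
  rw [LSeries.norm_term_eq]
  rcases eq_or_ne n 0 with rfl | hn
  · simp [Real.zero_rpow (by linarith : -s ≠ 0)]
  · rw [if_neg hn, Real.rpow_neg (Nat.cast_nonneg _), ← div_eq_mul_inv]
    simp

lemma hasSum_normTerm_aux {s : ℝ} (hs : 1 < s) :
    Summable (normTerm (N := N) s) ∧ ∑' a, normTerm (N := N) s a =
      ∑' n : ℕ, (Nat.card {I : Ideal (𝓞 N) // Ideal.absNorm I = n} : ℝ) * (n : ℝ) ^ (-s) := by
  set e := Equiv.sigmaFiberEquiv (Ideal.absNorm : Ideal (𝓞 N) → ℕ)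
  have hfin : ∀ n : ℕ, Finite {I : Ideal (𝓞 N) // Ideal.absNorm I = n} := fun n =>
    (Ideal.finite_setOfPred_absNorm_eq n).to_subtype
  have hterm : ∀ p, (normTerm s ∘ e) p = ((p.1 : ℕ) : ℝ) ^ (-s) := by
    rintro ⟨n, I, rfl⟩; rfl
  have hfun : normTerm s ∘ e = fun p => ((p.1 : ℕ) : ℝ) ^ (-s) := funext hterm
  have hf : ∀ n : ℕ, ∑' _ : {I : Ideal (𝓞 N) // Ideal.absNorm I = n}, (n : ℝ) ^ (-s) =
      (Nat.card {I : Ideal (𝓞 N) // Ideal.absNorm I = n} : ℝ) * (n : ℝ) ^ (-s) := fun n => by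
    have := Fintype.ofFinite {I : Ideal (𝓞 N) // Ideal.absNorm I = n}
    rw [tsum_fintype, Finset.sum_const, nsmul_eq_mul, Finset.card_univ, Nat.card_eq_fintype_card]
  have hsum : Summable (normTerm (N := N) s ∘ e) := by
    rw [hfun, summable_sigma_of_nonneg fun p => Real.rpow_nonneg (Nat.cast_nonneg _) _]
    refine ⟨fun n => ?_, ?_⟩
    · have := hfin n
      exact Summable.of_finite
    · simp only [hf]
      exact summable_card_absNorm hs
  refine ⟨e.summable_iff.1 hsum, ?_⟩
  rw [← e.tsum_eq (normTerm (N := N) s), ← tsum_congr hf]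
  have h3 : ∑' p, (normTerm (N := N) s ∘ e) p = _ := hsum.tsum_sigma' fun n => by
    have := hfin n
    exact Summable.of_finite
  refine h3.trans ?_
  exact tsum_congr fun n => tsum_congr fun I => hterm ⟨n, I⟩

lemma summable_normTerm {s : ℝ} (hs : 1 < s) : Summable (normTerm (N := N) s) :=
  (hasSum_normTerm_aux hs).1

/-- The Dedekind zeta function has a simple pole at `1`, in logarithmic form. -/
lemma exists_log_tsum_normTerm_bound (N : Type*) [Field N] [NumberField N] :
    ∃ C δ : ℝ, 0 < δ ∧ ∀ s, 1 < s → s < 1 + δ →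
      |Real.log (∑' a, normTerm (N := N) s a) - Real.log (1 / (s - 1))| ≤ C := by
  have h1 := tendsto_sub_one_mul_dedekindZeta_nhdsGT N
  have h2 : Tendsto (fun s : ℝ => (s - 1) * ∑' a, normTerm (N := N) s a) (𝓝[>] 1)
      (𝓝 (dedekindZeta_residue N)) := by
    have h3 := (Complex.continuous_re.tendsto _).comp h1
    simp only [Complex.ofReal_re] at h3
    refine h3.congr' ?_
    filter_upwards [self_mem_nhdsWithin] with s hs
    have hs1 : 1 < s := hs
    have h4 : dedekindZeta N s = ((∑' a, normTerm (N := N) s a : ℝ) : ℂ) := by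
      rw [(hasSum_normTerm_aux hs1).2, dedekindZeta, LSeries, Complex.ofReal_tsum]
      refine tsum_congr fun n => ?_
      rcases eq_or_ne n 0 with rfl | hn
      · simp [Real.zero_rpow (by linarith : -s ≠ 0)]
      · rw [LSeries.term_of_ne_zero hn, Complex.ofReal_mul, Complex.ofReal_cpow (Nat.cast_nonneg _),
          Complex.ofReal_neg, Complex.cpow_neg, div_eq_mul_inv]
        simp
    simp only [Function.comp_apply]
    rw [h4, show ((s : ℂ) - 1) = ((s - 1 : ℝ) : ℂ) by push_cast; rfl, ← Complex.ofReal_mul,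
      Complex.ofReal_re]
  have hρ := dedekindZeta_residue_pos N
  have h5 := h2.log hρ.ne'
  have h6 := (tendsto_order.1 h2).1 0 hρ
  have h7 := Metric.tendsto_nhds.1 h5 1 one_pos
  obtain ⟨δ, hδ, h8⟩ := Metric.mem_nhdsWithin_iff.1 (h6.and h7)
  refine ⟨|Real.log (dedekindZeta_residue N)| + 1, δ, hδ, fun s hs hs' => ?_⟩
  obtain ⟨h9, h10⟩ := h8 (show s ∈ Metric.ball 1 δ ∩ Set.Ioi 1 from
    ⟨by rw [Metric.mem_ball, Real.dist_eq, abs_lt]; constructor <;> linarith, hs⟩)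
  have hs0 : 0 < s - 1 := sub_pos.2 hs
  have h11 : ∑' a, normTerm (N := N) s a ≠ 0 := by
    rintro h; rw [h, mul_zero] at h9; exact lt_irrefl _ h9
  rw [Real.dist_eq, Real.log_mul hs0.ne' h11] at h10
  rw [one_div, Real.log_inv, sub_neg_eq_add, add_comm]
  have := abs_add_le (Real.log (s - 1) + Real.log (∑' a, normTerm (N := N) s a) -
    Real.log (dedekindZeta_residue N)) (Real.log (dedekindZeta_residue N))
  rw [sub_add_cancel] at this
  linarith

end IdealSeries

section EulerProduct

open NumberField Filter Topology IsDedekindDomain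

variable {N : Type*} [Field N] [NumberField N]

lemma two_le_absNorm (Q : HeightOneSpectrum (𝓞 N)) : 2 ≤ Ideal.absNorm Q.asIdeal := by
  have h0 : Ideal.absNorm Q.asIdeal ≠ 0 := by
    rw [Ne, Ideal.absNorm_eq_zero_iff]; exact Q.ne_bot
  have h1 : Ideal.absNorm Q.asIdeal ≠ 1 := by
    rw [Ne, Ideal.absNorm_eq_one_iff]; exact Q.isPrime.ne_top
  omega

lemma normTerm_prime_le_half {s : ℝ} (hs : 1 < s) (Q : HeightOneSpectrum (𝓞 N)) :
    normTerm s Q.asIdeal ≤ 1 / 2 := by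
  have h2 : (2 : ℝ) ≤ Ideal.absNorm Q.asIdeal := by exact_mod_cast two_le_absNorm Q
  rw [normTerm, Real.rpow_neg (by positivity), one_div]
  apply inv_anti₀ two_pos
  calc (2 : ℝ) ≤ Ideal.absNorm Q.asIdeal := h2
    _ = (Ideal.absNorm Q.asIdeal : ℝ) ^ (1 : ℝ) := (Real.rpow_one _).symm
    _ ≤ _ := Real.rpow_le_rpow_of_exponent_le (by linarith) hs.le

lemma summable_twist {f : Ideal (𝓞 N) →*₀ ℝ} (hf : ∀ a, |f a| ≤ 1) {s : ℝ} (hs : 1 < s) :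
    Summable fun a => f a * normTerm s a := by
  refine Summable.of_norm_bounded (summable_normTerm hs) fun a => ?_
  rw [Real.norm_eq_abs, abs_mul, abs_of_nonneg (normTerm_nonneg s a)]
  exact mul_le_of_le_one_left (normTerm_nonneg s a) (hf a)

omit [NumberField N] in
lemma asIdeal_injective : Function.Injective
    (fun Q : HeightOneSpectrum (𝓞 N) => Q.asIdeal) :=
  fun _ _ h => HeightOneSpectrum.ext h

lemma summable_normTerm_prime {s : ℝ} (hs : 1 < s) :
    Summable fun Q : HeightOneSpectrum (𝓞 N) => normTerm s Q.asIdeal :=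
  (summable_normTerm hs).comp_injective asIdeal_injective

lemma summable_twist_prime {f : Ideal (𝓞 N) →*₀ ℝ} (hf : ∀ a, |f a| ≤ 1) {s : ℝ} (hs : 1 < s) :
    Summable fun Q : HeightOneSpectrum (𝓞 N) => f Q.asIdeal * normTerm s Q.asIdeal :=
  (summable_twist hf hs).comp_injective asIdeal_injective

open scoped Classical in
/-- Removing finitely many Euler factors. -/
lemma prod_one_sub_mul_tsum {x : Ideal (𝓞 N) → ℝ} (hx : Summable x)
    (hmul : ∀ a b, x (a * b) = x a * x b) (T : Finset (HeightOneSpectrum (𝓞 N))) :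
    (∏ Q ∈ T, (1 - x Q.asIdeal)) * ∑' a, x a =
      ∑' a, if ∀ Q ∈ T, ¬ Q.asIdeal ∣ a then x a else 0 := by
  induction T using Finset.induction_on with
  | empty => simp
  | insert P T hP ih =>
    rw [Finset.prod_insert hP, mul_assoc, ih]
    set A : Set (Ideal (𝓞 N)) := {a | ∀ Q ∈ T, ¬ Q.asIdeal ∣ a} with hA
    have hind : ∀ B : Set (Ideal (𝓞 N)), Summable (B.indicator x) := fun B => hx.indicator B
    have e1 : (fun a => if ∀ Q ∈ T, ¬ Q.asIdeal ∣ a then x a else 0) = A.indicator x := by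
      funext a; simp [Set.indicator, hA]
    have e2 : (fun a => if ∀ Q ∈ insert P T, ¬ Q.asIdeal ∣ a then x a else 0) =
        (fun a => A.indicator x a - ({a | P.asIdeal ∣ a} ∩ A).indicator x a) := by
      funext a
      by_cases h1 : a ∈ A <;> by_cases h2 : P.asIdeal ∣ a <;>
        simp_all [Set.indicator]
    rw [e1, e2, (hind A).tsum_sub (hind _), sub_mul, one_mul]
    congr 1
    rw [← tsum_mul_left]
    have hinj : Function.Injective fun a : Ideal (𝓞 N) => P.asIdeal * a := fun a b h =>
      mul_left_cancel₀ P.ne_bot h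
    have hs : Function.support (({a | P.asIdeal ∣ a} ∩ A).indicator x) ⊆
        Set.range fun a : Ideal (𝓞 N) => P.asIdeal * a := by
      intro a ha
      have := Set.mem_of_indicator_ne_zero ha
      obtain ⟨b, hb⟩ := this.1
      exact ⟨b, hb.symm⟩
    rw [← hinj.tsum_eq hs]
    refine tsum_congr fun b => ?_
    have hiff : P.asIdeal * b ∈ {a | P.asIdeal ∣ a} ∩ A ↔ b ∈ A := by
      constructor
      · intro h Q hQ hd
        exact h.2 Q hQ (hd.mul_left _)
      · intro h
        refine ⟨dvd_mul_right _ _, fun Q hQ hd => ?_⟩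
        rcases Q.prime.dvd_or_dvd hd with h1 | h1
        · have h2 : P.asIdeal = Q.asIdeal :=
            P.isMaximal.eq_of_le Q.isPrime.ne_top (Ideal.dvd_iff_le.1 h1)
          exact hP (HeightOneSpectrum.ext h2 ▸ hQ)
        · exact h Q hQ h1
    by_cases hb : b ∈ A
    · rw [Set.indicator_of_mem hb, Set.indicator_of_mem (hiff.2 hb), hmul]
    · rw [Set.indicator_of_notMem hb, Set.indicator_of_notMem (fun h => hb (hiff.1 h)), mul_zero]

open scoped Classical in
lemma tendsto_prod_mul_tsum {f : Ideal (𝓞 N) →*₀ ℝ} (hf : ∀ a, |f a| ≤ 1) {s : ℝ} (hs : 1 < s) :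
    Tendsto (fun T : Finset (HeightOneSpectrum (𝓞 N)) =>
      (∏ Q ∈ T, (1 - f Q.asIdeal * normTerm s Q.asIdeal)) * ∑' a, f a * normTerm s a)
      atTop (𝓝 1) := by
  have hx := summable_twist hf hs
  simp only [fun T => prod_one_sub_mul_tsum hx (fun a b => by
    rw [map_mul, normTerm_mul]; ring) T]
  have h1 : ∑' a : Ideal (𝓞 N), (if a = ⊤ then (1 : ℝ) else 0) = 1 := tsum_ite_eq _ _
  rw [← h1]
  refine tendsto_tsum_of_dominated_convergence (summable_normTerm (N := N) hs) ?_ ?_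
  · intro a
    by_cases ha : a = ⊤
    · refine tendsto_const_nhds.congr' (Eventually.of_forall fun T => ?_)
      subst ha
      beta_reduce
      rw [if_pos rfl, if_pos, normTerm_top, mul_one, ← Ideal.one_eq_top, map_one]
      intro Q _ hd
      exact Q.isPrime.ne_top (top_le_iff.1 (Ideal.dvd_iff_le.1 hd))
    · rw [if_neg ha]
      by_cases h0 : a = ⊥
      · refine tendsto_const_nhds.congr' (Eventually.of_forall fun T => ?_)
        subst h0
        rw [normTerm_bot (by linarith)]; simp
      obtain ⟨P, hP, haP⟩ := Ideal.exists_le_maximal a ha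
      have hPb : P ≠ ⊥ := fun h => h0 (le_bot_iff.1 (h ▸ haP))
      refine tendsto_const_nhds.congr' ?_
      filter_upwards [eventually_ge_atTop {(⟨P, hP.isPrime, hPb⟩ : HeightOneSpectrum (𝓞 N))}]
        with T hT
      rw [if_neg]
      intro h
      exact h ⟨P, hP.isPrime, hPb⟩ (hT (Finset.mem_singleton_self _)) (Ideal.dvd_iff_le.2 haP)
  · refine Eventually.of_forall fun T a => ?_
    split_ifs
    · rw [Real.norm_eq_abs, abs_mul, abs_of_nonneg (normTerm_nonneg s a)]
      exact mul_le_of_le_one_left (normTerm_nonneg s a) (hf a)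
    · rw [norm_zero]; exact normTerm_nonneg s a

lemma abs_log_one_sub_add_le {x : ℝ} (hx : |x| ≤ 1 / 2) : |Real.log (1 - x) + x| ≤ 2 * |x| ^ 2 := by
  have h := Real.abs_log_sub_add_sum_range_le (x := x) (by linarith) 1
  simp only [Finset.sum_range_one, zero_add, pow_one, Nat.cast_zero, div_one] at h
  rw [add_comm]
  refine h.trans ?_
  rw [div_le_iff₀ (by linarith)]
  norm_num
  nlinarith [sq_nonneg x, sq_abs x]

/-- The logarithm of a twisted Dedekind zeta function agrees with its sum over primes up to a
bounded error, uniformly. -/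
theorem log_tsum_twist (N : Type*) [Field N] [NumberField N] :
    ∃ C : ℝ, ∀ s, 1 < s → ∀ f : Ideal (𝓞 N) →*₀ ℝ, (∀ a, |f a| ≤ 1) →
      0 < ∑' a, f a * normTerm s a ∧
      |Real.log (∑' a, f a * normTerm s a) -
        ∑' Q : HeightOneSpectrum (𝓞 N), f Q.asIdeal * normTerm s Q.asIdeal| ≤ C := by
  refine ⟨2 * ∑' Q : HeightOneSpectrum (𝓞 N), normTerm 2 Q.asIdeal, fun s hs f hf => ?_⟩
  set L := ∑' a, f a * normTerm s a with hL
  set x : HeightOneSpectrum (𝓞 N) → ℝ := fun Q => f Q.asIdeal * normTerm s Q.asIdeal with hx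
  have hxle : ∀ Q, |x Q| ≤ normTerm s Q.asIdeal := fun Q => by
    rw [hx, abs_mul, abs_of_nonneg (normTerm_nonneg s _)]
    exact mul_le_of_le_one_left (normTerm_nonneg s _) (hf _)
  have hxhalf : ∀ Q, |x Q| ≤ 1 / 2 := fun Q => (hxle Q).trans (normTerm_prime_le_half hs Q)
  have hpos : ∀ Q, 0 < 1 - x Q := fun Q => by
    have := abs_le.1 (hxhalf Q); linarith
  have hlim := tendsto_prod_mul_tsum hf hs
  have hLpos : 0 < L := by
    obtain ⟨T, hT⟩ := ((tendsto_order.1 hlim).1 0 one_pos).exists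
    exact pos_of_mul_pos_right hT (Finset.prod_nonneg fun Q _ => (hpos Q).le)
  refine ⟨hLpos, ?_⟩
  have hlog : Tendsto (fun T : Finset (HeightOneSpectrum (𝓞 N)) =>
      ∑ Q ∈ T, Real.log (1 - x Q) + Real.log L) atTop (𝓝 0) := by
    have := hlim.log one_ne_zero
    rw [Real.log_one] at this
    refine this.congr fun T => ?_
    rw [Real.log_mul (Finset.prod_pos fun Q _ => hpos Q).ne' hLpos.ne',
      Real.log_prod fun Q _ => (hpos Q).ne']
  have hsum : Tendsto (fun T : Finset (HeightOneSpectrum (𝓞 N)) => ∑ Q ∈ T, x Q) atTop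
      (𝓝 (∑' Q, x Q)) := (summable_twist_prime hf hs).hasSum
  have hdiff := ((tendsto_const_nhds (x := Real.log L)).sub hsum).sub hlog
  rw [sub_zero] at hdiff
  refine le_of_tendsto hdiff.abs (Eventually.of_forall fun T => ?_)
  have e : Real.log L - ∑ Q ∈ T, x Q - (∑ Q ∈ T, Real.log (1 - x Q) + Real.log L) =
      -∑ Q ∈ T, (Real.log (1 - x Q) + x Q) := by
    rw [Finset.sum_add_distrib]; ring
  rw [e, abs_neg]
  refine (Finset.abs_sum_le_sum_abs _ _).trans ?_
  have hsq : ∀ Q, |Real.log (1 - x Q) + x Q| ≤ 2 * normTerm 2 Q.asIdeal := fun Q => by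
    refine (abs_log_one_sub_add_le (hxhalf Q)).trans ?_
    have h2 : (1 : ℝ) ≤ Ideal.absNorm Q.asIdeal := by
      exact_mod_cast one_le_two.trans (two_le_absNorm Q)
    have h1 : |x Q| ^ 2 ≤ normTerm s Q.asIdeal ^ 2 :=
      pow_le_pow_left₀ (abs_nonneg _) (hxle Q) 2
    have h3 : normTerm s Q.asIdeal ^ 2 ≤ normTerm 2 Q.asIdeal := by
      rw [normTerm, normTerm, ← Real.rpow_natCast, ← Real.rpow_mul (by positivity)]
      refine Real.rpow_le_rpow_of_exponent_le h2 ?_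
      push_cast; linarith
    linarith
  refine (Finset.sum_le_sum fun Q _ => hsq Q).trans ?_
  rw [← Finset.mul_sum]
  exact mul_le_mul_of_nonneg_left ((summable_normTerm_prime one_lt_two).sum_le_tsum T
    fun Q _ => normTerm_nonneg _ _) two_pos.le

end EulerProduct

section PartialZeta

open NumberField NumberField.Units Filter Topology nonZeroDivisors

variable {N : Type*} [Field N] [NumberField N]

lemma smoothTerm_eq_normTerm (s : ℝ) (x : 𝓞 N) :
    smoothTerm s x = unitWeight (x : N) * normTerm s (Ideal.span {x}) := rfl

omit [NumberField N] in
/-- The generators of a nonzero principal ideal form a torsor under the units. -/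
lemma exists_equiv_generators {x₀ : 𝓞 N} (hx₀ : x₀ ≠ 0) :
    ∃ e : (𝓞 N)ˣ ≃ {x : 𝓞 N // Ideal.span {x} = Ideal.span {x₀}},
      ∀ u, ((e u : 𝓞 N)) = u * x₀ := by
  have hmem : ∀ u : (𝓞 N)ˣ, Ideal.span {(u : 𝓞 N) * x₀} = Ideal.span {x₀} := fun u =>
    Ideal.span_singleton_eq_span_singleton.2 ⟨u⁻¹, by
      rw [mul_comm, ← mul_assoc, Units.inv_mul, one_mul]⟩
  refine ⟨Equiv.ofBijective (fun u => ⟨u * x₀, hmem u⟩) ⟨?_, ?_⟩, fun u => rfl⟩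
  · intro u v h
    exact Units.ext (mul_right_cancel₀ hx₀ (Subtype.ext_iff.1 h))
  · rintro ⟨x, hx⟩
    obtain ⟨u, hu⟩ := Ideal.span_singleton_eq_span_singleton.1 hx.symm
    exact ⟨u, Subtype.ext ((mul_comm _ _).trans hu)⟩

open scoped Classical in
lemma hasSum_smoothTerm_fiber {s : ℝ} (hs : 1 < s) (I : Ideal (𝓞 N)) :
    HasSum (fun p : {x : 𝓞 N // Ideal.span {x} = I} => smoothTerm s (p : 𝓞 N))
      (if I.IsPrincipal then (Nat.card (torsion N) : ℝ) * normTerm s I else 0) := by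
  have hfun : (fun p : {x : 𝓞 N // Ideal.span {x} = I} => smoothTerm s (p : 𝓞 N)) =
      fun p : {x : 𝓞 N // Ideal.span {x} = I} => unitWeight ((p : 𝓞 N) : N) * normTerm s I := by
    funext p; rw [smoothTerm_eq_normTerm, p.2]
  rw [hfun]
  by_cases hI : I.IsPrincipal
  · rw [if_pos hI]
    by_cases h0 : I = ⊥
    · have : normTerm s I = 0 := by rw [h0, normTerm_bot (by linarith)]
      simp only [this, mul_zero]
      exact hasSum_zero
    refine HasSum.mul_right _ ?_
    obtain ⟨x₀, hx₀⟩ := hI.principal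
    change I = Ideal.span {x₀} at hx₀
    subst hx₀
    have hx : x₀ ≠ 0 := fun h => h0 (by rw [h]; simp)
    obtain ⟨e, he⟩ := exists_equiv_generators hx
    have hx' : (x₀ : N) ≠ 0 := by simpa using hx
    have h1 := hasSum_unitWeight hx'
    rw [← e.hasSum_iff]
    have h2 : ((fun p : {x : 𝓞 N // Ideal.span {x} = Ideal.span {x₀}} =>
        unitWeight ((p : 𝓞 N) : N)) ∘ e) = fun u : (𝓞 N)ˣ => unitWeight ((u : N) * x₀) := by
      funext u
      simp only [Function.comp_apply, he]
      exact congrArg unitWeight (map_mul (algebraMap (𝓞 N) N) _ _)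
    rw [h2]
    exact h1
  · rw [if_neg hI]
    have : IsEmpty {x : 𝓞 N // Ideal.span {x} = I} :=
      ⟨fun p => hI ⟨(p : 𝓞 N), p.2.symm⟩⟩
    exact hasSum_empty

lemma summable_smoothTerm {s : ℝ} (hs : 1 < s) : Summable (smoothTerm (N := N) s) := by
  classical
  set e := Equiv.sigmaFiberEquiv fun x : 𝓞 N => Ideal.span {x}
  rw [← e.summable_iff, summable_sigma_of_nonneg (f := smoothTerm s ∘ e) fun p =>
    smoothTerm_nonneg s _]
  refine ⟨fun I => (hasSum_smoothTerm_fiber hs I).summable, ?_⟩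
  have : (fun I => ∑' p : {x : 𝓞 N // Ideal.span {x} = I}, (smoothTerm s ∘ e) ⟨I, p⟩) =
      fun I => if I.IsPrincipal then (Nat.card (torsion N) : ℝ) * normTerm s I else 0 :=
    funext fun I => (hasSum_smoothTerm_fiber hs I).tsum_eq
  rw [this]
  refine Summable.of_nonneg_of_le (fun I => ?_) (fun I => ?_)
    ((summable_normTerm (N := N) hs).mul_left (Nat.card (torsion N) : ℝ))
  · split_ifs
    · exact mul_nonneg (Nat.cast_nonneg _) (normTerm_nonneg _ _)
    · exact le_rfl
  · split_ifs
    · exact le_rfl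
    · exact mul_nonneg (Nat.cast_nonneg _) (normTerm_nonneg _ _)

variable {f : Ideal (𝓞 N) →*₀ ℝ} (hf : ∀ a, |f a| ≤ 1)

include hf in
lemma summable_twist_smoothTerm {s : ℝ} (hs : 1 < s) :
    Summable fun x : 𝓞 N => f (Ideal.span {x}) * smoothTerm s x := by
  refine Summable.of_norm_bounded (summable_smoothTerm hs) fun x => ?_
  rw [Real.norm_eq_abs, abs_mul, abs_of_nonneg (smoothTerm_nonneg s x)]
  exact mul_le_of_le_one_left (smoothTerm_nonneg s x) (hf _)

open scoped Classical in
/-- The partial zeta function of the ideals `a` with `a * c` principal. -/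
noncomputable def partialZeta (f : Ideal (𝓞 N) →*₀ ℝ) (s : ℝ) (c : Ideal (𝓞 N)) : ℝ :=
  ∑' a, if (a * c).IsPrincipal then f a * normTerm s a else 0

include hf in
lemma tsum_smoothTerm_ideal {s : ℝ} (hs : 1 < s) {c : Ideal (𝓞 N)} (hc : c ≠ ⊥) :
    ∑' x : c, f (Ideal.span {(x : 𝓞 N)}) * smoothTerm s (x : 𝓞 N) =
      Nat.card (torsion N) * (f c * normTerm s c * partialZeta f s c) := by
  classical
  set G : 𝓞 N → ℝ := fun x => f (Ideal.span {x}) * smoothTerm s x with hG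
  have hGs : Summable G := summable_twist_smoothTerm hf hs
  set H : 𝓞 N → ℝ := (c : Set (𝓞 N)).indicator G with hH
  have hHs : Summable H := hGs.indicator _
  have h1 : ∑' x : c, f (Ideal.span {(x : 𝓞 N)}) * smoothTerm s (x : 𝓞 N) = ∑' x, H x :=
    tsum_subtype (c : Set (𝓞 N)) G
  rw [h1]
  set e := Equiv.sigmaFiberEquiv fun x : 𝓞 N => Ideal.span {x}
  have hHe : Summable (H ∘ e) := e.summable_iff.2 hHs
  have hfib : ∀ I : Ideal (𝓞 N), HasSum (fun p => (H ∘ e) ⟨I, p⟩)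
      (if I ≤ c ∧ I.IsPrincipal then Nat.card (torsion N) * (f I * normTerm s I) else 0) := by
    intro I
    have hval : (fun p => (H ∘ e) ⟨I, p⟩) = fun p : {x : 𝓞 N // Ideal.span {x} = I} =>
        (if I ≤ c then f I else 0) * smoothTerm s (p : 𝓞 N) := by
      funext ⟨x, hx⟩
      change H x = _ * smoothTerm s x
      subst hx
      rw [Ideal.span_singleton_le_iff_mem, hH]
      by_cases hxc : x ∈ c
      · rw [Set.indicator_of_mem hxc, if_pos hxc]
      · rw [Set.indicator_of_notMem hxc, if_neg hxc, zero_mul]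
    have hs' := (hasSum_smoothTerm_fiber hs I).mul_left (if I ≤ c then f I else 0)
    have heq : (if I ≤ c then f I else 0) *
        (if I.IsPrincipal then (Nat.card (torsion N) : ℝ) * normTerm s I else 0) =
        if I ≤ c ∧ I.IsPrincipal then Nat.card (torsion N) * (f I * normTerm s I) else 0 := by
      by_cases hc1 : I ≤ c
      · by_cases hc2 : I.IsPrincipal
        · rw [if_pos hc1, if_pos hc2, if_pos ⟨hc1, hc2⟩]; ring
        · rw [if_neg hc2, if_neg (show ¬(I ≤ c ∧ I.IsPrincipal) from fun h => hc2 h.2), mul_zero]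
      · rw [if_neg hc1, if_neg (show ¬(I ≤ c ∧ I.IsPrincipal) from fun h => hc1 h.1), zero_mul]
    rw [hval, ← heq]
    exact hs'
  rw [← e.tsum_eq H]
  refine (hHe.tsum_sigma' fun I => (hfib I).summable).trans ?_
  rw [tsum_congr fun I => (hfib I).tsum_eq]
  have hinj : Function.Injective fun a : Ideal (𝓞 N) => a * c := fun a b h =>
    mul_right_cancel₀ hc h
  rw [← hinj.tsum_eq]
  · rw [partialZeta, ← tsum_mul_left, ← tsum_mul_left]
    refine tsum_congr fun a => ?_
    by_cases hp : (a * c).IsPrincipal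
    · rw [if_pos ⟨Ideal.mul_le_right, hp⟩, if_pos hp, map_mul, normTerm_mul]; ring
    · rw [if_neg fun h => hp h.2, if_neg hp]; ring
  · intro I hI
    have : I ≤ c ∧ I.IsPrincipal := by
      by_contra h
      exact hI (if_neg h)
    obtain ⟨a, ha⟩ := Ideal.dvd_iff_le.2 this.1
    exact ⟨a, by rw [ha, mul_comm]⟩

/-- A sublattice of index `k` all of whose cosets have representatives in an auxiliary ideal. -/
lemma exists_coset_reps {b β m : Ideal (𝓞 N)} (hb : b ≠ ⊥) (hβ : β ≠ ⊥) (hβm : β ⊔ m = ⊤) :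
    ∃ r : Fin (Ideal.absNorm β) → 𝓞 N, (∀ i, r i ∈ m) ∧
      ∃ e : Fin (Ideal.absNorm β) × ↥(b * β) ≃ b, ∀ p, (e p : 𝓞 N) = (p.2 : 𝓞 N) + r p.1 := by
  set c := b * β with hcdef
  have hc : c ≤ b := Ideal.mul_le_left
  set q := (b.toAddSubgroup ⧸ c.toAddSubgroup.addSubgroupOf b.toAddSubgroup) with hq
  have hcard : Nat.card q = Ideal.absNorm β := by
    have h1 := AddSubgroup.relIndex_mul_index (H := c.toAddSubgroup) (K := b.toAddSubgroup) hc
    have h2 : ∀ I : Ideal (𝓞 N), I.toAddSubgroup.index = Ideal.absNorm I := fun I => by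
      rw [Ideal.absNorm_apply, Submodule.cardQuot_apply]; rfl
    rw [h2, h2, hcdef, map_mul, mul_comm] at h1
    have h3 : Ideal.absNorm b ≠ 0 := by rwa [Ne, Ideal.absNorm_eq_zero_iff]
    exact Nat.eq_of_mul_eq_mul_left (Nat.pos_of_ne_zero h3) h1
  have hk : Ideal.absNorm β ≠ 0 := by rwa [Ne, Ideal.absNorm_eq_zero_iff]
  have hfin : Finite q := Nat.finite_of_card_ne_zero (hcard ▸ hk)
  let eq : Fin (Ideal.absNorm β) ≃ q := (finCongr hcard.symm).trans (Finite.equivFin q).symm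
  obtain ⟨t, ht, u, hu, htu⟩ := Submodule.mem_sup.1
    (hβm ▸ Submodule.mem_top : (1 : 𝓞 N) ∈ β ⊔ m)
  have hrep : ∀ i, ∃ x : b.toAddSubgroup, (x : 𝓞 N) ∈ m ∧ (QuotientAddGroup.mk x : q) = eq i := by
    intro i
    obtain ⟨y, hy⟩ := QuotientAddGroup.mk_surjective (eq i)
    have hyb : (y : 𝓞 N) ∈ b := y.2
    refine ⟨⟨y * u, Ideal.mul_mem_right _ _ hyb⟩, Ideal.mul_mem_left _ _ hu, ?_⟩
    rw [← hy, QuotientAddGroup.eq]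
    change -((y : 𝓞 N) * u) + y ∈ c
    have : -((y : 𝓞 N) * u) + y = y * t := by
      linear_combination -(y : 𝓞 N) * htu
    rw [this]
    exact Ideal.mul_mem_mul hyb ht
  choose r hrm hrq using hrep
  refine ⟨fun i => r i, hrm, Equiv.ofBijective
    (fun p => ⟨(p.2 : 𝓞 N) + r p.1, b.add_mem (hc p.2.2) (r p.1).2⟩) ⟨?_, ?_⟩, fun p => rfl⟩
  · rintro ⟨i, x⟩ ⟨j, y⟩ h
    have h1 : (x : 𝓞 N) + r i = y + r j := Subtype.ext_iff.1 h
    have h2 : i = j := by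
      apply eq.injective
      rw [← hrq, ← hrq, QuotientAddGroup.eq]
      change -(r i : 𝓞 N) + r j ∈ c
      have : -(r i : 𝓞 N) + r j = x - y := by linear_combination -h1
      rw [this]
      exact c.sub_mem x.2 y.2
    subst h2
    rw [Prod.mk.injEq]
    exact ⟨rfl, Subtype.ext (add_right_cancel h1)⟩
  · rintro ⟨z, hz⟩
    obtain ⟨i, hi⟩ := eq.surjective (QuotientAddGroup.mk (⟨z, hz⟩ : b.toAddSubgroup))
    rw [← hrq, QuotientAddGroup.eq] at hi
    have hi' : -(r i : 𝓞 N) + z ∈ c := hi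
    refine ⟨(i, ⟨_, hi'⟩), Subtype.ext ?_⟩
    change -(r i : 𝓞 N) + z + r i = z
    ring

end PartialZeta

section ClassRepresentatives

open nonZeroDivisors

/-- Every ideal class has an integral representative coprime to a given ideal. -/
lemma exists_mk0_eq_sup_eq_top {A : Type*} [CommRing A] [IsDedekindDomain A] (C : ClassGroup A)
    {m : Ideal A} (hm : m ≠ ⊥) :
    ∃ b : (Ideal A)⁰, ClassGroup.mk0 b = C ∧ (b : Ideal A) ⊔ m = ⊤ := by
  obtain ⟨J, hJ⟩ := ClassGroup.mk0_surjective C⁻¹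
  have hJ0 : (J : Ideal A) ≠ ⊥ := nonZeroDivisors.ne_zero J.2
  by_cases hmt : m = ⊤
  · obtain ⟨b, hb⟩ := ClassGroup.mk0_surjective C
    exact ⟨b, hb, by rw [hmt]; exact sup_top_eq _⟩
  obtain ⟨a, ha⟩ := IsDedekindDomain.exists_sup_span_eq (I := (J : Ideal A) * m) (J := J)
    Ideal.mul_le_left (mul_ne_zero hJ0 hm)
  have haJ : Ideal.span {a} ≤ (J : Ideal A) := ha ▸ le_sup_right
  obtain ⟨b, hb⟩ := Ideal.dvd_iff_le.2 haJ
  have hcop : b ⊔ m = ⊤ := by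
    rw [hb, ← Ideal.mul_sup, sup_comm] at ha
    have : (J : Ideal A) * (b ⊔ m) = J * ⊤ := by rw [ha, Ideal.mul_top]
    exact mul_left_cancel₀ hJ0 this
  have hb0 : b ≠ ⊥ := fun h => hmt (by rwa [h, bot_sup_eq] at hcop)
  refine ⟨⟨b, mem_nonZeroDivisors_of_ne_zero hb0⟩, ?_, hcop⟩
  have h1 : ClassGroup.mk0 J * ClassGroup.mk0 ⟨b, mem_nonZeroDivisors_of_ne_zero hb0⟩ = 1 := by
    rw [← map_mul]
    refine (ClassGroup.mk0_eq_one_iff _).2 ⟨a, ?_⟩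
    exact hb.symm
  rw [hJ] at h1
  exact (inv_mul_eq_one.1 h1).symm

end ClassRepresentatives

section Boundedness

open NumberField NumberField.Units Filter Topology nonZeroDivisors

variable {N : Type*} [Field N] [NumberField N]
variable {f : Ideal (𝓞 N) →*₀ ℝ} (hf : ∀ a, |f a| ≤ 1)

include hf in
/-- Comparison of twisted sums over an ideal and a sublattice. -/
lemma exists_tsum_ideal_sub_le {m : Ideal (𝓞 N)}
    (hper : ∀ x y : 𝓞 N, x ≠ 0 → y ≠ 0 → x - y ∈ m → (∀ φ : N →+* ℝ, 0 < φ x ↔ 0 < φ y) →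
      f (Ideal.span {x}) = f (Ideal.span {y}))
    {b β : Ideal (𝓞 N)} (hb : b ≠ ⊥) (hβ : β ≠ ⊥) (hβm : β ⊔ m = ⊤) :
    ∃ C, ∀ s, 1 < s → s ≤ 2 →
      |∑' x : b, f (Ideal.span {(x : 𝓞 N)}) * smoothTerm s (x : 𝓞 N) -
        Ideal.absNorm β * ∑' x : ↥(b * β), f (Ideal.span {(x : 𝓞 N)}) * smoothTerm s (x : 𝓞 N)|
        ≤ C := by
  obtain ⟨r, hr, e, he⟩ := exists_coset_reps hb hβ hβm
  choose g hg hgle using fun i => exists_summable_smoothTerm_sub_le (r i)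
  refine ⟨∑ i, ∑' x : ↥(b * β), g i x, fun s hs hs2 => ?_⟩
  set G : 𝓞 N → ℝ := fun x => f (Ideal.span {x}) * smoothTerm s x with hG
  have hGs : Summable G := summable_twist_smoothTerm hf hs
  have hinj : Function.Injective (Subtype.val : ↥(b * β) → 𝓞 N) := Subtype.val_injective
  have h1 : ∑' x : b, G x = ∑ i, ∑' x : ↥(b * β), G (x + r i) := by
    rw [← e.tsum_eq]
    have hsum : Summable fun p => G (e p) :=
      hGs.comp_injective (Subtype.val_injective.comp e.injective)
    rw [hsum.tsum_prod, tsum_fintype]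
    exact Finset.sum_congr rfl fun i _ => tsum_congr fun x => by rw [he]
  have h2 : (Ideal.absNorm β : ℝ) * ∑' x : ↥(b * β), G x =
      ∑ i : Fin (Ideal.absNorm β), ∑' x : ↥(b * β), G x := by
    rw [Finset.sum_const, Finset.card_univ, Fintype.card_fin, nsmul_eq_mul]
  rw [h1, h2, ← Finset.sum_sub_distrib]
  refine (Finset.abs_sum_le_sum_abs _ _).trans (Finset.sum_le_sum fun i _ => ?_)
  have hsi : Summable fun x : ↥(b * β) => G (x + r i) :=
    hGs.comp_injective ((add_left_injective (r i)).comp hinj)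
  have hs0 : Summable fun x : ↥(b * β) => G x := hGs.comp_injective hinj
  rw [← hsi.tsum_sub hs0]
  rw [← Real.norm_eq_abs]
  refine tsum_of_norm_bounded ((hg i).comp_injective hinj).hasSum fun x => ?_
  refine hgle i (fun x => f (Ideal.span {x})) (fun x => hf _) (fun x hx hxr hsgn => ?_) s hs hs2 x
  exact hper _ _ hxr hx (by rw [add_sub_cancel_left]; exact hr i) fun φ => (hsgn φ).symm

include hf in
lemma sum_partialZeta {ι : Type*} [Fintype ι] {s : ℝ} (hs : 1 < s) (b : ι → Ideal (𝓞 N))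
    (hb : ∀ a : Ideal (𝓞 N), a ≠ ⊥ → ∃! i, (a * b i).IsPrincipal) :
    ∑ i, partialZeta f s (b i) = ∑' a, f a * normTerm s a := by
  classical
  simp only [partialZeta]
  rw [← Summable.tsum_finsetSum]
  · refine tsum_congr fun a => ?_
    by_cases ha : a = ⊥
    · have : f a = 0 := by rw [ha]; exact map_zero f
      simp [this]
    · obtain ⟨i, hi, huniq⟩ := hb a ha
      rw [Finset.sum_eq_single i, if_pos hi]
      · intro j _ hj
        exact if_neg fun h => hj (huniq j h)
      · intro h; exact absurd (Finset.mem_univ i) h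
  · intro i _
    have := (summable_twist hf hs).indicator {a | (a * b i).IsPrincipal}
    refine this.congr fun a => ?_
    simp [Set.indicator]

include hf in
/-- A twisted Dedekind zeta function stays bounded near `1` when the twist is periodic up to
signs and takes the value `-1` on some ideal coprime to the period. -/
theorem exists_bound_tsum_twist {m : Ideal (𝓞 N)} (hm : m ≠ ⊥)
    (hf1 : ∀ a, a ≠ ⊥ → a ⊔ m = ⊤ → |f a| = 1)
    (hper : ∀ x y : 𝓞 N, x ≠ 0 → y ≠ 0 → x - y ∈ m → (∀ φ : N →+* ℝ, 0 < φ x ↔ 0 < φ y) →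
      f (Ideal.span {x}) = f (Ideal.span {y}))
    {β : Ideal (𝓞 N)} (hβ : f β = -1) (hβm : β ⊔ m = ⊤) :
    ∃ C, ∀ s, 1 < s → s ≤ 2 → ∑' a, f a * normTerm s a ≤ C := by
  classical
  have hβ0 : β ≠ ⊥ := by
    rintro rfl
    have : f ⊥ = 0 := map_zero f
    rw [this] at hβ; norm_num at hβ
  choose B hBC hBm using fun C : ClassGroup (𝓞 N) => exists_mk0_eq_sup_eq_top C hm
  set b : ClassGroup (𝓞 N) → Ideal (𝓞 N) := fun C => (B C : Ideal (𝓞 N)) with hbdef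
  have hb0 : ∀ C, b C ≠ ⊥ := fun C => nonZeroDivisors.ne_zero (B C).2
  choose E hE using fun C => exists_tsum_ideal_sub_le hf hper (hb0 C) hβ0 hβm
  set τ : ℝ := ((Nat.card (torsion N) : ℕ) : ℝ) with hτ
  have hτ0 : 1 ≤ τ := by
    rw [hτ]; exact_mod_cast Nat.one_le_iff_ne_zero.2 Nat.card_pos.ne'
  have huniq1 : ∀ a : Ideal (𝓞 N), a ≠ ⊥ → ∃! C, (a * b C).IsPrincipal := by
    intro a ha
    have key : ∀ C, (a * b C).IsPrincipal ↔
        ClassGroup.mk0 ⟨a, mem_nonZeroDivisors_of_ne_zero ha⟩ * C = 1 := fun C => by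
      rw [← ClassGroup.mk0_eq_one_iff (mem_nonZeroDivisors_of_ne_zero (mul_ne_zero ha (hb0 C))),
        ← hBC C, ← map_mul, hBC C]
      rfl
    simp only [key]
    exact ⟨_, mul_inv_cancel _, fun C hC => (eq_inv_of_mul_eq_one_right hC)⟩
  have huniq2 : ∀ a : Ideal (𝓞 N), a ≠ ⊥ → ∃! C, (a * (b C * β)).IsPrincipal := by
    intro a ha
    obtain ⟨C, hC, hu⟩ := huniq1 (a * β) (mul_ne_zero ha hβ0)
    exact ⟨C, by beta_reduce; rwa [mul_comm (b C), ← mul_assoc],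
      fun D hD => hu D (by beta_reduce at hD ⊢; rwa [mul_assoc, mul_comm β])⟩
  refine ⟨∑ C, |E C| * (Ideal.absNorm (b C) : ℝ) ^ (2 : ℝ), fun s hs hs2 => ?_⟩
  set L := ∑' a, f a * normTerm s a with hL
  have hL1 : ∑ C, partialZeta f s (b C) = L := sum_partialZeta hf hs _ huniq1
  have hL2 : ∑ C, partialZeta f s (b C * β) = L := sum_partialZeta hf hs _ huniq2
  set k : ℝ := Ideal.absNorm β * normTerm s β with hk
  have hk0 : 0 ≤ k := mul_nonneg (Nat.cast_nonneg _) (normTerm_nonneg _ _)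
  have hmain : ∀ C, |partialZeta f s (b C) + k * partialZeta f s (b C * β)| ≤
      |E C| * (Ideal.absNorm (b C) : ℝ) ^ (2 : ℝ) := by
    intro C
    have h1 := hE C s hs hs2
    rw [tsum_smoothTerm_ideal hf hs (hb0 C),
      tsum_smoothTerm_ideal hf hs (mul_ne_zero (hb0 C) hβ0), map_mul, hβ, normTerm_mul] at h1
    have h2 : τ * (f (b C) * normTerm s (b C) * partialZeta f s (b C)) -
        Ideal.absNorm β * (τ * (f (b C) * -1 * (normTerm s (b C) * normTerm s β) *
          partialZeta f s (b C * β))) = f (b C) * (τ * normTerm s (b C) *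
          (partialZeta f s (b C) + k * partialZeta f s (b C * β))) := by rw [hk]; ring
    rw [h2, abs_mul, hf1 _ (hb0 C) (hBm C), one_mul, abs_mul, abs_of_nonneg
      (mul_nonneg (zero_le_one.trans hτ0) (normTerm_nonneg _ _))] at h1
    set X := |partialZeta f s (b C) + k * partialZeta f s (b C * β)|
    have hX : 0 ≤ X := abs_nonneg _
    have hN : (1 : ℝ) ≤ Ideal.absNorm (b C) := by
      exact_mod_cast Nat.one_le_iff_ne_zero.2 (by rw [Ne, Ideal.absNorm_eq_zero_iff]; exact hb0 C)
    set n : ℝ := ((Ideal.absNorm (b C) : ℕ) : ℝ)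
    have h3 : 1 ≤ normTerm s (b C) * n ^ (2 : ℝ) := by
      change 1 ≤ n ^ (-s) * n ^ (2 : ℝ)
      rw [← Real.rpow_add (by linarith)]
      exact Real.one_le_rpow hN (by linarith)
    have hn2 : 0 ≤ n ^ (2 : ℝ) := by positivity
    have h4 : normTerm s (b C) * X ≤ |E C| := by
      refine le_trans ?_ (h1.trans (le_abs_self _))
      rw [mul_assoc]
      exact le_mul_of_one_le_left (mul_nonneg (normTerm_nonneg _ _) hX) hτ0
    calc X ≤ (normTerm s (b C) * n ^ (2 : ℝ)) * X := le_mul_of_one_le_left hX h3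
      _ = (normTerm s (b C) * X) * n ^ (2 : ℝ) := by ring
      _ ≤ _ := mul_le_mul_of_nonneg_right h4 hn2
  have h5 : L * (1 + k) = ∑ C, (partialZeta f s (b C) + k * partialZeta f s (b C * β)) := by
    rw [Finset.sum_add_distrib, ← Finset.mul_sum, hL1, hL2]; ring
  have h6 : |L * (1 + k)| ≤ ∑ C, |E C| * (Ideal.absNorm (b C) : ℝ) ^ (2 : ℝ) := by
    rw [h5]
    exact (Finset.abs_sum_le_sum_abs _ _).trans (Finset.sum_le_sum fun C _ => hmain C)
  refine le_trans ?_ h6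
  rw [abs_mul, abs_of_nonneg (by linarith : 0 ≤ 1 + k)]
  exact (le_abs_self L).trans (le_mul_of_one_le_right (abs_nonneg _) (by linarith))

end Boundedness

section PrimeSums

open NumberField Filter Topology IsDedekindDomain

/-- A fibrewise comparison of sums of nonnegative terms. -/
lemma tsum_le_card_mul_tsum {P P' : Type*} [DecidableEq P'] (u : P → P') {n : ℕ}
    (hn : ∀ (p : P') (t : Finset P), (t.filter fun q => u q = p).card ≤ n)
    {h : P → ℝ} {g : P' → ℝ} (hg : Summable g) (hg0 : ∀ p, 0 ≤ g p)
    (hh0 : ∀ q, 0 ≤ h q) (hhg : ∀ q, h q ≤ g (u q)) :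
    ∑' q, h q ≤ n * ∑' p, g p := by
  have key : ∀ t : Finset P, ∑ q ∈ t, h q ≤ n * ∑' p, g p := by
    intro t
    calc ∑ q ∈ t, h q = ∑ p ∈ t.image u, ∑ q ∈ t with u q = p, h q :=
          (Finset.sum_fiberwise_of_maps_to (fun q hq => Finset.mem_image_of_mem u hq) _).symm
      _ ≤ ∑ p ∈ t.image u, n * g p := by
          refine Finset.sum_le_sum fun p _ => ?_
          calc ∑ q ∈ t with u q = p, h q ≤ ∑ q ∈ t with u q = p, g p := by
                refine Finset.sum_le_sum fun q hq => ?_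
                rw [← (Finset.mem_filter.1 hq).2]; exact hhg q
            _ = (t.filter fun q => u q = p).card * g p := by
                rw [Finset.sum_const, nsmul_eq_mul]
            _ ≤ n * g p := mul_le_mul_of_nonneg_right (by exact_mod_cast hn p t) (hg0 p)
      _ = n * ∑ p ∈ t.image u, g p := (Finset.mul_sum _ _ _).symm
      _ ≤ n * ∑' p, g p := mul_le_mul_of_nonneg_left
          (hg.sum_le_tsum _ fun p _ => hg0 p) (Nat.cast_nonneg n)
  exact Real.tsum_le_of_sum_le hh0 key

lemma card_filter_under_le (A B k l : Type*) [CommRing A] [IsDedekindDomain A] [CommRing B]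
    [IsDedekindDomain B] [Field k] [Field l] [Algebra A B] [Module.Finite A B]
    [Algebra A k] [IsFractionRing A k] [Algebra B l] [IsFractionRing B l] [Algebra k l]
    [Algebra A l] [IsScalarTower A B l] [IsScalarTower A k l]
    [FaithfulSMul A B]
    [DecidableEq (HeightOneSpectrum A)]
    (p : HeightOneSpectrum A) (t : Finset (HeightOneSpectrum B)) :
    (t.filter fun Q => Q.under A = p).card ≤ Module.finrank k l := by
  classical
  have := p.isMaximal
  have : NoZeroSMulDivisors A B := ⟨fun {a b} h => by
    rw [Algebra.smul_def, mul_eq_zero] at h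
    exact h.imp_left fun h => FaithfulSMul.algebraMap_injective A B (by rw [h, map_zero])⟩
  refine le_trans ?_ (Ideal.card_primesOverFinset_le_finrank B k l p.ne_bot)
  refine Finset.card_le_card_of_injOn (fun Q => Q.asIdeal) (fun Q hQ => ?_)
    (fun _ _ _ _ h => HeightOneSpectrum.ext h)
  have hQ' := (Finset.mem_filter.1 (Finset.mem_coe.1 hQ)).2
  refine Finset.mem_coe.2 ((IsDedekindDomain.mem_primesOverFinset_iff p.ne_bot B).2
    ⟨Q.isPrime, ⟨?_⟩⟩)
  rw [← hQ', HeightOneSpectrum.under_asIdeal]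

variable {N : Type*} [Field N] [NumberField N]

open Classical in
/-- The contribution of a set of primes to the logarithm of the zeta function. -/
noncomputable def primeSum (s : ℝ) (T : Set (HeightOneSpectrum (𝓞 N))) : ℝ :=
  ∑' Q, T.indicator (fun Q => normTerm s Q.asIdeal) Q

lemma summable_primeSum {s : ℝ} (hs : 1 < s) (T : Set (HeightOneSpectrum (𝓞 N))) :
    Summable (T.indicator (fun Q => normTerm s Q.asIdeal)) :=
  (summable_normTerm_prime hs).indicator T

lemma primeSum_mono {s : ℝ} (hs : 1 < s) {T T' : Set (HeightOneSpectrum (𝓞 N))} (h : T ⊆ T') :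
    primeSum s T ≤ primeSum s T' :=
  (summable_primeSum hs T).tsum_le_tsum
    (fun Q => Set.indicator_le_indicator_of_subset h (fun Q => normTerm_nonneg s Q.asIdeal) Q)
    (summable_primeSum hs T')

lemma primeSum_union {s : ℝ} (hs : 1 < s) {T T' : Set (HeightOneSpectrum (𝓞 N))}
    (h : Disjoint T T') : primeSum s (T ∪ T') = primeSum s T + primeSum s T' := by
  unfold primeSum
  rw [← (summable_primeSum hs T).tsum_add (summable_primeSum hs T'),
    Set.indicator_union_of_disjoint h]

lemma primeSum_union_le {s : ℝ} (hs : 1 < s) (T T' : Set (HeightOneSpectrum (𝓞 N))) :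
    primeSum s (T ∪ T') ≤ primeSum s T + primeSum s T' := by
  rw [← Set.union_sdiff_self, primeSum_union hs Set.disjoint_sdiff_right]
  gcongr
  exact primeSum_mono hs Set.sdiff_subset

lemma primeSum_le_ncard {s : ℝ} (hs : 1 < s) {T : Set (HeightOneSpectrum (𝓞 N))}
    (hT : T.Finite) : primeSum s T ≤ T.ncard := by
  classical
  unfold primeSum
  rw [tsum_eq_sum (s := hT.toFinset) fun Q hQ => Set.indicator_of_notMem (by simpa using hQ) _,
    Set.ncard_eq_toFinset_card T hT, ← nsmul_one, ← Finset.sum_const]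
  refine Finset.sum_le_sum fun Q hQ => ?_
  rw [Set.indicator_of_mem (by simpa using hQ)]
  linarith [normTerm_prime_le_half hs Q]

lemma finite_setOf_mem_asIdeal {a : 𝓞 N} (ha : a ≠ 0) :
    {Q : HeightOneSpectrum (𝓞 N) | a ∈ Q.asIdeal}.Finite := by
  refine (Ideal.finite_factors (I := Ideal.span {a}) (by simpa using ha)).subset fun Q hQ => ?_
  simpa [Ideal.dvd_span_singleton] using hQ

lemma absNorm_under_eq_of_prime {E : Type*} [Field E] [NumberField E] [Algebra N E]
    (Q : HeightOneSpectrum (𝓞 E)) (hQ : (Ideal.absNorm Q.asIdeal).Prime) :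
    Ideal.absNorm (Q.under (𝓞 N)).asIdeal = Ideal.absNorm Q.asIdeal := by
  have : Q.asIdeal.LiesOver (Q.under (𝓞 N)).asIdeal := ⟨rfl⟩
  have h := Ideal.absNorm_eq_pow_inertiaDeg'_of_liesOver Q.asIdeal (Q.under (𝓞 N)).asIdeal
    (Q.under (𝓞 N)).isPrime (Q.under (𝓞 N)).ne_bot
  have h1 : (Q.under (𝓞 N)).asIdeal.inertiaDeg' Q.asIdeal = 1 := by
    by_contra h1
    rw [h] at hQ
    exact Nat.Prime.not_prime_pow' h1 hQ
  rw [h, h1, pow_one]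

lemma primeSum_le_finrank_mul {E : Type*} [Field E] [NumberField E] [Algebra N E] {s : ℝ}
    (hs : 1 < s) {T : Set (HeightOneSpectrum (𝓞 E))} {B : Set (HeightOneSpectrum (𝓞 N))}
    (hT : ∀ Q ∈ T, (Ideal.absNorm Q.asIdeal).Prime ∧ Q.under (𝓞 N) ∈ B) :
    primeSum s T ≤ Module.finrank N E * primeSum s B := by
  classical
  refine tsum_le_card_mul_tsum (fun Q : HeightOneSpectrum (𝓞 E) => Q.under (𝓞 N))
    (fun p t => card_filter_under_le (𝓞 N) (𝓞 E) N E p t) (summable_primeSum hs B)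
    (fun Q => Set.indicator_nonneg (fun Q _ => normTerm_nonneg s Q.asIdeal) Q)
    (fun Q => Set.indicator_nonneg (fun Q _ => normTerm_nonneg s Q.asIdeal) Q) fun Q => ?_
  by_cases hQ : Q ∈ T
  · rw [Set.indicator_of_mem hQ, Set.indicator_of_mem (hT Q hQ).2, normTerm, normTerm,
      absNorm_under_eq_of_prime Q (hT Q hQ).1]
  · rw [Set.indicator_of_notMem hQ]
    exact Set.indicator_nonneg (fun Q _ => normTerm_nonneg s Q.asIdeal) _

variable (N) in
lemma exists_bound_primeSum_not_prime : ∃ C, ∀ s : ℝ, 1 < s →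
    primeSum s {Q : HeightOneSpectrum (𝓞 N) | ¬ (Ideal.absNorm Q.asIdeal).Prime} ≤ C := by
  classical
  let g : HeightOneSpectrum ℤ → ℝ := fun p => (Ideal.absNorm p.asIdeal : ℝ) ^ (-2 : ℝ)
  have hinj : Function.Injective fun p : HeightOneSpectrum ℤ => Ideal.absNorm p.asIdeal := by
    intro p q h
    have h' : Ideal.absNorm p.asIdeal = Ideal.absNorm q.asIdeal := h
    refine HeightOneSpectrum.ext ?_
    rw [← Int.ideal_span_absNorm_eq_self p.asIdeal, h', Int.ideal_span_absNorm_eq_self]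
  have hg : Summable g :=
    (Real.summable_nat_rpow.2 (by norm_num : (-2 : ℝ) < -1)).comp_injective hinj
  refine ⟨Module.finrank ℚ N * ∑' p, g p, fun s hs => ?_⟩
  refine tsum_le_card_mul_tsum (fun Q : HeightOneSpectrum (𝓞 N) => Q.under ℤ)
    (fun p t => card_filter_under_le ℤ (𝓞 N) ℚ N p t) hg (fun p => by positivity)
    (fun Q => Set.indicator_nonneg (fun Q _ => normTerm_nonneg s Q.asIdeal) Q) fun Q => ?_
  by_cases hQ : ¬ (Ideal.absNorm Q.asIdeal).Prime
  · rw [Set.indicator_of_mem (by exact hQ)]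
    have : Q.asIdeal.LiesOver (Q.under ℤ).asIdeal := ⟨rfl⟩
    have h := Ideal.absNorm_eq_pow_inertiaDeg'_of_liesOver Q.asIdeal (Q.under ℤ).asIdeal
      (Q.under ℤ).isPrime (Q.under ℤ).ne_bot
    have hp : (Ideal.absNorm (Q.under ℤ).asIdeal).Prime := by
      rw [Nat.prime_iff_prime_int, ← Ideal.span_singleton_prime, Int.ideal_span_absNorm_eq_self]
      · exact (Q.under ℤ).isPrime
      · rw [Ne, Nat.cast_eq_zero, Ideal.absNorm_eq_zero_iff]; exact (Q.under ℤ).ne_bot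
    set f := (Q.under ℤ).asIdeal.inertiaDeg' Q.asIdeal
    have hf : 2 ≤ f := by
      have h2 := two_le_absNorm Q
      rcases Nat.lt_or_ge f 2 with hf | hf
      · interval_cases f
        · rw [h] at h2; simp at h2
        · rw [h, pow_one] at hQ; exact absurd hp hQ
      · exact hf
    have h1 : (1 : ℝ) ≤ Ideal.absNorm (Q.under ℤ).asIdeal := by exact_mod_cast hp.one_le
    change (Ideal.absNorm Q.asIdeal : ℝ) ^ (-s) ≤ (Ideal.absNorm (Q.under ℤ).asIdeal : ℝ) ^ (-2 : ℝ)
    rw [h, Nat.cast_pow, ← Real.rpow_natCast, ← Real.rpow_mul (by linarith)]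
    refine Real.rpow_le_rpow_of_exponent_le h1 ?_
    have : (2 : ℝ) ≤ f := by exact_mod_cast hf
    nlinarith
  · rw [Set.indicator_of_notMem (by exact hQ)]
    positivity

variable (N) in
lemma exists_bound_primeSum_univ : ∃ C δ : ℝ, 0 < δ ∧ ∀ s, 1 < s → s < 1 + δ →
    |primeSum s (Set.univ : Set (HeightOneSpectrum (𝓞 N))) - Real.log (1 / (s - 1))| ≤ C := by
  obtain ⟨C, δ, hδ, h⟩ := exists_log_tsum_normTerm_bound N
  obtain ⟨C', h'⟩ := log_tsum_twist N
  classical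
  let f : Ideal (𝓞 N) →*₀ ℝ :=
    { toFun := fun a => if a = ⊥ then 0 else 1
      map_zero' := by simp
      map_one' := by simp
      map_mul' := by
        intro a b
        by_cases ha : a = ⊥ <;> by_cases hb : b = ⊥ <;> simp [ha, hb] }
  have hf0 : ∀ a, f a = if a = ⊥ then 0 else 1 := fun a => rfl
  refine ⟨C + C', δ, hδ, fun s hs hs' => ?_⟩
  have h1 := h s hs hs'
  have h2 := (h' s hs f (fun a => by rw [hf0]; split_ifs <;> simp)).2
  have h3 : (fun a => f a * normTerm s a) = fun a : Ideal (𝓞 N) => normTerm s a := by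
    funext a
    rw [hf0]
    split_ifs with ha
    · rw [ha, normTerm_bot (by linarith), mul_zero]
    · rw [one_mul]
  have h4 : (fun Q : HeightOneSpectrum (𝓞 N) => f Q.asIdeal * normTerm s Q.asIdeal) =
      (Set.univ : Set (HeightOneSpectrum (𝓞 N))).indicator (fun Q => normTerm s Q.asIdeal) := by
    funext Q
    rw [hf0, if_neg Q.ne_bot, one_mul, Set.indicator_univ]
  rw [h3, h4] at h2
  change |_ - primeSum s Set.univ| ≤ C' at h2
  rw [abs_le] at *
  constructor <;> linarith [h1.1, h1.2, h2.1, h2.2]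

end PrimeSums

section Signs

open NumberField

variable {L : Type*} [Field L] [NumberField L]

lemma norm_eq_prod_re (hL : ∀ φ : L →+* ℂ, ComplexEmbedding.IsReal φ) (x : L) :
    ((Algebra.norm ℚ x : ℚ) : ℝ) = ∏ σ : L →ₐ[ℚ] ℂ, (σ x).re := by
  have h := Algebra.norm_eq_prod_embeddings ℚ ℂ x
  have h1 : ∀ σ : L →ₐ[ℚ] ℂ, (((σ x).re : ℝ) : ℂ) = σ x := fun σ => by
    have := RingHom.congr_fun (hL (σ : L →+* ℂ)) x
    exact Complex.conj_eq_iff_re.1 (by simpa using this)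
  have h2 : (((Algebra.norm ℚ x : ℚ) : ℝ) : ℂ) = ((∏ σ : L →ₐ[ℚ] ℂ, (σ x).re : ℝ) : ℂ) := by
    rw [Complex.ofReal_prod, Finset.prod_congr rfl fun σ _ => h1 σ, ← h]
    simp
  exact Complex.ofReal_injective h2

omit [NumberField L] in
lemma exists_realEmbedding_re (hL : ∀ φ : L →+* ℂ, ComplexEmbedding.IsReal φ) (σ : L →+* ℂ) :
    ∃ φ : L →+* ℝ, ∀ x, (φ x : ℂ) = σ x :=
  ⟨(hL σ).embedding, fun x => (hL σ).coe_embedding_apply x⟩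

lemma norm_pos_of_forall_pos (hL : ∀ φ : L →+* ℂ, ComplexEmbedding.IsReal φ) {x : L}
    (hx : ∀ φ : L →+* ℝ, 0 < φ x) : 0 < Algebra.norm ℚ x := by
  have h : (0 : ℝ) < ((Algebra.norm ℚ x : ℚ) : ℝ) := by
    rw [norm_eq_prod_re hL]
    refine Finset.prod_pos fun σ _ => ?_
    obtain ⟨φ, hφ⟩ := exists_realEmbedding_re hL (σ : L →+* ℂ)
    have h2 := hx φ
    have h1 : σ x = (φ x : ℂ) := (hφ x).symm
    rwa [h1, Complex.ofReal_re]
  exact_mod_cast h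

lemma norm_neg_of_exists_neg (hL : ∀ φ : L →+* ℂ, ComplexEmbedding.IsReal φ) {x : L}
    (φ₀ : L →+* ℝ) (h0 : φ₀ x < 0) (hx : ∀ φ : L →+* ℝ, φ ≠ φ₀ → 0 < φ x) :
    Algebra.norm ℚ x < 0 := by
  classical
  have h : ((Algebra.norm ℚ x : ℚ) : ℝ) < 0 := by
    rw [norm_eq_prod_re hL]
    let σ₀ : L →ₐ[ℚ] ℂ := (Complex.ofRealHom.comp φ₀).toRatAlgHom
    have hσ₀ : σ₀ x = (φ₀ x : ℂ) := rfl
    rw [← Finset.mul_prod_erase _ _ (Finset.mem_univ σ₀)]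
    refine mul_neg_of_neg_of_pos (by rwa [hσ₀, Complex.ofReal_re])
      (Finset.prod_pos fun σ hσ => ?_)
    obtain ⟨φ, hφ⟩ := exists_realEmbedding_re hL (σ : L →+* ℂ)
    have h1 : ∀ x, σ x = (φ x : ℂ) := fun x => (hφ x).symm
    rw [h1, Complex.ofReal_re]
    refine hx φ fun h => (Finset.mem_erase.1 hσ).1 (AlgHom.ext fun y => ?_)
    rw [h1, h]
    rfl
  exact_mod_cast h

lemma exists_neg_at_embedding (φ₀ : L →+* ℝ) :
    ∃ w : 𝓞 L, φ₀ w < -1 ∧ ∀ φ : L →+* ℝ, φ ≠ φ₀ → 0 < φ w := by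
  classical
  let pl : (L →+* ℝ) → InfinitePlace L := fun φ => InfinitePlace.mk (Complex.ofRealHom.comp φ)
  have hpl : ∀ φ x, pl φ x = |φ x| := fun φ x => by
    change InfinitePlace.mk _ x = _
    rw [InfinitePlace.apply]
    simp
  have hinj : ∀ φ, φ ≠ φ₀ → pl φ ≠ pl φ₀ := by
    intro φ hφ h
    refine hφ (RingHom.ext fun x => ?_)
    rcases InfinitePlace.mk_eq_iff.1 h with h | h
    · exact Complex.ofReal_injective (RingHom.congr_fun h x)
    · have h2 := RingHom.congr_fun h x
      simp only [ComplexEmbedding.conjugate_coe_eq, RingHom.comp_apply, Complex.ofRealHom_eq_coe,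
        Complex.conj_ofReal] at h2
      exact Complex.ofReal_injective h2
  let t : InfinitePlace L → L := fun v => if v = pl φ₀ then -2 else 2
  let U : Set ((v : InfinitePlace L) → WithAbs v.1) :=
    {y | ∀ v, ‖y v - WithAbs.toAbs v.1 (t v)‖ < 1}
  have hU : IsOpen U := by
    have : U = ⋂ v, {y | ‖y v - WithAbs.toAbs v.1 (t v)‖ < 1} := by ext; simp [U]
    rw [this]
    exact isOpen_iInter_of_finite fun v =>
      isOpen_lt (((continuous_apply v).sub continuous_const).norm) continuous_const
  obtain ⟨y, hy⟩ := (InfinitePlace.denseRange_algebraMap_pi L).exists_mem_open hU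
    ⟨fun v => WithAbs.toAbs v.1 (t v), fun v => by simp⟩
  have hy' : ∀ φ : L →+* ℝ, |φ y - φ (t (pl φ))| < 1 := by
    intro φ
    have h : ‖WithAbs.toAbs (pl φ).1 y - WithAbs.toAbs (pl φ).1 (t (pl φ))‖ < 1 := hy (pl φ)
    rw [← WithAbs.toAbs_sub, WithAbs.norm_toAbs_eq] at h
    rw [← map_sub, ← hpl]
    exact h
  obtain ⟨n, hn0, hn⟩ : ∃ n : ℤ, 0 < n ∧ IsIntegral ℤ ((n : L) * y) := by
    obtain ⟨n, hn0, hn⟩ := ((IsFractionRing.isAlgebraic_iff ℤ ℚ L).2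
      (Algebra.IsAlgebraic.isAlgebraic (R := ℚ) y)).exists_integral_multiple
    refine ⟨n * n, mul_self_pos.2 hn0, ?_⟩
    have h2 := (isIntegral_algebraMap (R := ℤ) (A := L) (x := n)).mul hn
    have e : ((n * n : ℤ) : L) * y = algebraMap ℤ L n * n • y := by
      rw [zsmul_eq_mul, eq_intCast]
      push_cast
      ring
    rw [e]
    exact h2
  have hn1 : (1 : ℝ) ≤ n := by exact_mod_cast hn0
  refine ⟨⟨n * y, hn⟩, ?_, fun φ hφ => ?_⟩
  · change φ₀ (n * y) < -1
    have h := hy' φ₀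
    simp only [t, if_true, map_neg, map_ofNat] at h
    rw [map_mul, map_intCast]
    rw [abs_lt] at h
    nlinarith [h.2]
  · change 0 < φ (n * y)
    have h := hy' φ
    simp only [t, if_neg (hinj φ hφ), map_ofNat] at h
    rw [map_mul, map_intCast]
    rw [abs_lt] at h
    nlinarith [h.1]

end Signs

section Residue

open NumberField IsDedekindDomain

variable {N : Type*} [Field N] [NumberField N]

lemma exists_intCast_sub_mem {Q : Ideal (𝓞 N)} (hQ : (Ideal.absNorm Q).Prime) (y : 𝓞 N) :
    ∃ n : ℤ, y - n ∈ Q := by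
  have : Fact (Ideal.absNorm Q).Prime := ⟨hQ⟩
  have hcard : Nat.card (𝓞 N ⧸ Q) = Ideal.absNorm Q := by
    rw [Ideal.absNorm_apply, Submodule.cardQuot_apply]
  have h1 : (1 : 𝓞 N ⧸ Q) ≠ 0 := by
    intro h
    have : Subsingleton (𝓞 N ⧸ Q) := subsingleton_of_zero_eq_one h.symm
    rw [Nat.card_of_subsingleton 0] at hcard
    exact hQ.one_lt.ne hcard
  obtain ⟨n, hn⟩ := AddSubgroup.mem_zmultiples_iff.1 (mem_zmultiples_of_prime_card hcard h1
    (g' := Ideal.Quotient.mk Q y))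
  refine ⟨n, ?_⟩
  rw [← Ideal.Quotient.eq, ← hn]
  simp

lemma exists_sq_add_one_mem_iff {p : Ideal (𝓞 N)} [p.IsMaximal]
    (hp : p ≠ ⊥) : (∃ x, x ^ 2 + 1 ∈ p) ↔ Ideal.absNorm p % 4 ≠ 3 := by
  let := Ideal.Quotient.field p
  have : Finite (𝓞 N ⧸ p) := Ideal.finiteQuotientOfFreeOfNeBot p hp
  let := Fintype.ofFinite (𝓞 N ⧸ p)
  have hcard : Fintype.card (𝓞 N ⧸ p) = Ideal.absNorm p := by
    rw [Ideal.absNorm_apply, Submodule.cardQuot_apply, Nat.card_eq_fintype_card]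
  rw [← hcard, ← FiniteField.isSquare_neg_one_iff]
  constructor
  · rintro ⟨x, hx⟩
    refine ⟨Ideal.Quotient.mk p x, ?_⟩
    rw [← Ideal.Quotient.eq_zero_iff_mem, map_add, map_pow, map_one] at hx
    linear_combination -hx
  · rintro ⟨y, hy⟩
    obtain ⟨x, rfl⟩ := Ideal.Quotient.mk_surjective y
    refine ⟨x, ?_⟩
    rw [← Ideal.Quotient.eq_zero_iff_mem, map_add, map_pow, map_one]
    linear_combination -hy

lemma norm_sub_dvd {m : ℤ} {x y : 𝓞 N} (h : x - y ∈ Ideal.span {(m : 𝓞 N)}) :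
    m ∣ Algebra.norm ℤ x - Algebra.norm ℤ y := by
  classical
  obtain ⟨z, hz⟩ := Ideal.mem_span_singleton.1 h
  let b := Module.Free.chooseBasis ℤ (𝓞 N)
  have hx : x = y + m * z := by linear_combination hz
  rw [← Ideal.mem_span_singleton, ← Ideal.Quotient.eq, Algebra.norm_eq_matrix_det b,
    Algebra.norm_eq_matrix_det b, RingHom.map_det, RingHom.map_det]
  congr 1
  have hm : ((m : ℤ) : 𝓞 N) = algebraMap ℤ (𝓞 N) m := (eq_intCast _ _).symm
  rw [hx, map_add, map_mul, hm, AlgHom.commutes, map_add, map_mul, add_eq_left]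
  ext i j
  rw [Matrix.mul_apply]
  refine Finset.sum_eq_zero fun k _ => mul_eq_zero_of_left ?_ _
  rw [RingHom.mapMatrix_apply, Matrix.map_apply, Ideal.Quotient.eq_zero_iff_mem,
    Ideal.mem_span_singleton, Matrix.algebraMap_eq_diagonal, Matrix.diagonal_apply]
  split_ifs
  · simp
  · exact dvd_zero m

end Residue

section QuarticTwist

open NumberField IsDedekindDomain

variable {F : Type*} [Field F] [NumberField F]

/-- The character `a ↦ χ (N a) χ₄ (|N a|)`, where `χ₄` is the nontrivial Dirichlet character
modulo `4`. -/
noncomputable def quarticTwist (χ : Ideal (𝓞 F) →*₀ ℝ) (L : Type*) [Field L] [NumberField L]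
    [Algebra F L] : Ideal (𝓞 L) →*₀ ℝ where
  toFun a := χ (Ideal.relNorm (𝓞 F) a) * ((ZMod.χ₄ (Ideal.absNorm a : ZMod 4) : ℤ) : ℝ)
  map_zero' := by simp
  map_one' := by
    rw [map_one, map_one, map_one]; simp
  map_mul' a b := by
    rw [map_mul, map_mul, map_mul, Nat.cast_mul, map_mul]
    push_cast
    ring

variable {L : Type*} [Field L] [NumberField L] [Algebra F L]

lemma quarticTwist_apply (χ : Ideal (𝓞 F) →*₀ ℝ) (a : Ideal (𝓞 L)) :
    quarticTwist χ L a =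
      χ (Ideal.relNorm (𝓞 F) a) * ((ZMod.χ₄ (Ideal.absNorm a : ZMod 4) : ℤ) : ℝ) := rfl

lemma abs_chi_four_le (x : ZMod 4) : |((ZMod.χ₄ x : ℤ) : ℝ)| ≤ 1 := by
  have : ∀ x : ZMod 4, |ZMod.χ₄ x| ≤ 1 := by decide
  exact_mod_cast this x

variable {χ : Ideal (𝓞 F) →*₀ ℝ} (hχ1 : ∀ a, a ≠ ⊥ → |χ a| = 1)
  (hχp : ∀ x : 𝓞 F, x ≠ 0 → χ (Ideal.span {x}) = 1)

include hχ1 in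
omit [NumberField F] in
lemma abs_char_le (a : Ideal (𝓞 F)) : |χ a| ≤ 1 := by
  by_cases ha : a = ⊥
  · rw [ha, ← Ideal.zero_eq_bot, map_zero, abs_zero]; exact zero_le_one
  · exact (hχ1 a ha).le

include hχ1 in
lemma abs_quarticTwist_le (a : Ideal (𝓞 L)) : |quarticTwist χ L a| ≤ 1 := by
  rw [quarticTwist_apply, abs_mul]
  exact mul_le_one₀ (abs_char_le hχ1 _) (abs_nonneg _) (abs_chi_four_le _)

lemma odd_absNorm_of_sup_eq_top {a : Ideal (𝓞 L)} (ha : a ≠ ⊥)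
    (h4 : a ⊔ Ideal.span {4} = ⊤) :
    Odd (Ideal.absNorm a) := by
  by_contra h
  rw [Nat.not_odd_iff_even, even_iff_two_dvd] at h
  obtain ⟨x, hx, y, hy, hxy⟩ := Submodule.mem_sup.1 ((Ideal.eq_top_iff_one _).1 h4)
  obtain ⟨u, rfl⟩ := Ideal.mem_span_singleton.1 hy
  have : Finite (𝓞 L ⧸ a) := Ideal.finiteQuotientOfFreeOfNeBot a ha
  obtain ⟨z, hz⟩ := exists_prime_addOrderOf_dvd_card' (G := 𝓞 L ⧸ a) 2 (by
    rwa [Ideal.absNorm_apply, Submodule.cardQuot_apply] at h)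
  have hz2 : (2 : 𝓞 L ⧸ a) * z = 0 := by
    rw [← addOrderOf_nsmul_eq_zero z, hz, nsmul_eq_mul, Nat.cast_ofNat]
  have h1 : (4 : 𝓞 L ⧸ a) * Ideal.Quotient.mk a u = 1 := by
    have := congrArg (Ideal.Quotient.mk a) hxy
    rw [map_add, Ideal.Quotient.eq_zero_iff_mem.2 hx, zero_add, map_mul, map_ofNat, map_one] at this
    exact this
  have hz0 : z = 0 := by linear_combination (-z) * h1 + 2 * Ideal.Quotient.mk a u * hz2
  rw [hz0, addOrderOf_zero] at hz
  exact absurd hz (by norm_num)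

include hχ1 in
lemma abs_quarticTwist_eq {a : Ideal (𝓞 L)} (ha : a ≠ ⊥) (h4 : a ⊔ Ideal.span {4} = ⊤) :
    |quarticTwist χ L a| = 1 := by
  rw [quarticTwist_apply, abs_mul, hχ1 _ (by rwa [Ne, Ideal.relNorm_eq_bot_iff]), one_mul]
  rcases Nat.odd_mod_four_iff.1 (Nat.odd_iff.1 (odd_absNorm_of_sup_eq_top ha h4)) with h | h
  · rw [ZMod.χ₄_nat_one_mod_four h]; simp
  · rw [ZMod.χ₄_nat_three_mod_four h]; simp

include hχp in
lemma quarticTwist_span {x : 𝓞 L} (hx : x ≠ 0) :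
    quarticTwist χ L (Ideal.span {x}) =
      ((ZMod.χ₄ ((Algebra.norm ℤ x).natAbs : ZMod 4) : ℤ) : ℝ) := by
  rw [quarticTwist_apply, Ideal.relNorm_singleton, hχp _ (by rwa [Ne, Algebra.intNorm_eq_zero]),
    one_mul, Ideal.absNorm_span_singleton]

lemma natAbs_norm_cast (n : ℤ) :
    ((n.natAbs : ℕ) : ZMod 4) = if 0 < n then (n : ZMod 4) else -n := by
  split_ifs with h
  · rw [← Int.cast_natCast, Int.natAbs_of_nonneg h.le]
  · rw [← Int.cast_natCast, Int.ofNat_natAbs_of_nonpos (not_lt.1 h), Int.cast_neg]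

include hχp in
lemma quarticTwist_span_congr (hL : ∀ φ : L →+* ℂ, ComplexEmbedding.IsReal φ) {x y : 𝓞 L}
    (hx : x ≠ 0) (hy : y ≠ 0) (hxy : x - y ∈ Ideal.span {(4 : 𝓞 L)})
    (hs : ∀ φ : L →+* ℝ, 0 < φ x ↔ 0 < φ y) :
    quarticTwist χ L (Ideal.span {x}) = quarticTwist χ L (Ideal.span {y}) := by
  have hm : ((Algebra.norm ℤ x : ℤ) : ZMod 4) = (Algebra.norm ℤ y : ℤ) := by
    have h := norm_sub_dvd (m := 4) (x := x) (y := y) (by simpa using hxy)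
    rw [← sub_eq_zero, ← Int.cast_sub]
    exact (ZMod.intCast_zmod_eq_zero_iff_dvd _ 4).2 h
  have hpos : 0 < Algebra.norm ℤ x * Algebra.norm ℤ y := by
    have h : 0 < Algebra.norm ℚ ((x : L) * y) := by
      refine norm_pos_of_forall_pos hL fun φ => ?_
      have hx0 : φ (x : L) ≠ 0 := by
        rw [Ne, map_eq_zero]; exact RingOfIntegers.coe_ne_zero_iff.2 hx
      have hy0 : φ (y : L) ≠ 0 := by
        rw [Ne, map_eq_zero]; exact RingOfIntegers.coe_ne_zero_iff.2 hy
      rw [map_mul]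
      have := hs φ
      rcases lt_or_gt_of_ne hx0 with h | h
      · exact mul_pos_of_neg_of_neg h
          (lt_of_le_of_ne (not_lt.1 fun h' => (this.2 h').not_gt h) hy0)
      · exact mul_pos h (this.1 h)
    rw [map_mul, ← Algebra.coe_norm_int, ← Algebra.coe_norm_int] at h
    exact_mod_cast h
  rw [quarticTwist_span hχp hx, quarticTwist_span hχp hy, natAbs_norm_cast, natAbs_norm_cast, hm]
  rcases pos_and_pos_or_neg_and_neg_of_mul_pos hpos with ⟨h1, h2⟩ | ⟨h1, h2⟩
  · rw [if_pos h1, if_pos h2]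
  · rw [if_neg h1.not_gt, if_neg h2.not_gt]

include hχp in
lemma exists_quarticTwist_eq_neg_one (hL : ∀ φ : L →+* ℂ, ComplexEmbedding.IsReal φ) :
    ∃ β : Ideal (𝓞 L), quarticTwist χ L β = -1 ∧ β ⊔ Ideal.span {4} = ⊤ := by
  obtain ⟨σ⟩ : Nonempty (L →+* ℂ) := inferInstance
  obtain ⟨φ₀, -⟩ := exists_realEmbedding_re hL σ
  obtain ⟨w, hw0, hw⟩ := exists_neg_at_embedding φ₀
  set α : 𝓞 L := 1 + 4 * w with hα
  have hαφ : ∀ φ : L →+* ℝ, φ (α : L) = 1 + 4 * φ w := fun φ => by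
    have : (α : L) = 1 + 4 * (w : L) := by rw [hα]; push_cast; rfl
    rw [this, map_add, map_mul, map_one, map_ofNat]
  have hneg : Algebra.norm ℤ α < 0 := by
    have h : Algebra.norm ℚ (α : L) < 0 := by
      refine norm_neg_of_exists_neg hL φ₀ (by rw [hαφ]; linarith) fun φ hφ => ?_
      rw [hαφ]; linarith [hw φ hφ]
    rw [← Algebra.coe_norm_int] at h
    exact_mod_cast h
  have hα0 : α ≠ 0 := by
    intro h; rw [h, Algebra.norm_zero] at hneg; exact lt_irrefl _ hneg
  have hm : ((Algebra.norm ℤ α : ℤ) : ZMod 4) = 1 := by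
    have h := norm_sub_dvd (m := 4) (x := α) (y := 1)
      (Ideal.mem_span_singleton.2 ⟨w, by rw [hα]; push_cast; ring⟩)
    rw [map_one] at h
    rw [← sub_eq_zero, ← Int.cast_one, ← Int.cast_sub]
    exact (ZMod.intCast_zmod_eq_zero_iff_dvd _ 4).2 h
  refine ⟨Ideal.span {α}, ?_, ?_⟩
  · rw [quarticTwist_span hχp hα0, natAbs_norm_cast, if_neg hneg.not_gt, hm]
    have : ZMod.χ₄ (-1) = -1 := by decide
    rw [this]; simp
  · rw [Ideal.eq_top_iff_one]
    have : (1 : 𝓞 L) = α + -(4 * w) := by rw [hα]; ring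
    rw [this]
    exact Submodule.add_mem_sup (Ideal.mem_span_singleton_self α)
      (neg_mem (Ideal.mul_mem_right _ _ (Ideal.mem_span_singleton_self 4)))

end QuarticTwist

section SplitPrimes

open NumberField IsDedekindDomain

variable {F : Type*} [Field F] [NumberField F]

lemma two_notMem_of_two_mul_notMem {R : Type*} [CommRing R] {p : Ideal R} {d : R}
    (h : 2 * d ∉ p) : (2 : R) ∉ p ∧ d ∉ p :=
  ⟨fun h2 => h (Ideal.mul_mem_right _ _ h2), fun h2 => h (Ideal.mul_mem_left _ _ h2)⟩

section

variable {K : Type*} [Field K] [NumberField K] [Algebra F K]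

omit [NumberField F] [NumberField K] in
lemma algebraMap_mem_iff_mem_under (Q : HeightOneSpectrum (𝓞 K)) (x : 𝓞 F) :
    x ∈ (Q.under (𝓞 F)).asIdeal ↔ algebraMap (𝓞 F) (𝓞 K) x ∈ Q.asIdeal := Iff.rfl

omit [NumberField F] in
/-- If `Q` has prime norm, every element of `𝓞 K` is congruent to an integer mod `Q`, and
congruences between elements of `𝓞 F` can be read off in `𝓞 F`. -/
lemma exists_intCast_sq_sub_mem_under {Q : HeightOneSpectrum (𝓞 K)}
    (hQ : (Ideal.absNorm Q.asIdeal).Prime) {δ : 𝓞 K} {d : 𝓞 F}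
    (hδ : δ ^ 2 = algebraMap (𝓞 F) (𝓞 K) d) :
    ∃ n : ℤ, (n : 𝓞 F) ^ 2 - d ∈ (Q.under (𝓞 F)).asIdeal := by
  obtain ⟨n, hn⟩ := exists_intCast_sub_mem hQ δ
  refine ⟨n, ?_⟩
  rw [algebraMap_mem_iff_mem_under, map_sub, map_pow, map_intCast, ← hδ]
  have : (n : 𝓞 K) ^ 2 - δ ^ 2 = -(n + δ) * (δ - n) := by ring
  rw [this]
  exact Ideal.mul_mem_left _ _ hn

lemma relNorm_eq_under_of_prime {Q : HeightOneSpectrum (𝓞 K)}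
    (hQ : (Ideal.absNorm Q.asIdeal).Prime) :
    Ideal.relNorm (𝓞 F) Q.asIdeal = (Q.under (𝓞 F)).asIdeal := by
  have hl : Q.asIdeal.LiesOver (Q.under (𝓞 F)).asIdeal := ⟨rfl⟩
  have := (Q.under (𝓞 F)).isPrime
  obtain ⟨k, hk⟩ := Ideal.exists_relNorm_eq_pow_of_isPrime Q.asIdeal (Q.under (𝓞 F)).asIdeal
  have h := Ideal.absNorm_relNorm (𝓞 F) (𝓞 K) Q.asIdeal
  rw [hk, map_pow, absNorm_under_eq_of_prime Q hQ] at h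
  have hk1 : k = 1 := by
    refine Nat.pow_right_injective hQ.two_le ?_
    simpa using h
  rw [hk, hk1, pow_one]

end

/-- A totally positive `d` yields primes that split in `F(√-d)` on which a quadratic class
character is nontrivial. -/
theorem exists_split_prime_char_ne_one {K : Type*} [Field K] [NumberField K] [Algebra F K]
    {L : Type*} [Field L] [NumberField L] [Algebra F L]
    (hL : ∀ φ : L →+* ℂ, ComplexEmbedding.IsReal φ) {d : 𝓞 F} (hd : d ≠ 0)
    {δ : 𝓞 L} (hδ : δ ^ 2 = algebraMap (𝓞 F) (𝓞 L) d)
    {κ : 𝓞 K} (hκ : κ ^ 2 = algebraMap (𝓞 F) (𝓞 K) (-d)) (hK : Module.finrank F K = 2)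
    {χ : Ideal (𝓞 F) →*₀ ℝ} (hχ1 : ∀ a, a ≠ ⊥ → |χ a| = 1)
    (hχp : ∀ x : 𝓞 F, x ≠ 0 → χ (Ideal.span {x}) = 1) {β : Ideal (𝓞 F)} (hβ : χ β = -1) :
    ∃ p : HeightOneSpectrum (𝓞 F), (Ideal.absNorm p.asIdeal).Prime ∧ 2 * d ∉ p.asIdeal ∧
      (∃ x, x ^ 2 + d ∈ p.asIdeal) ∧ χ p.asIdeal ≠ 1 := by
  by_contra! hsplit
  have h2d : 2 * d ≠ 0 := mul_ne_zero two_ne_zero hd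
  -- the sets of primes
  let S₁ : Set (HeightOneSpectrum (𝓞 F)) := {p | (Ideal.absNorm p.asIdeal).Prime ∧
    2 * d ∉ p.asIdeal ∧ ∃ x, x ^ 2 + d ∈ p.asIdeal}
  let D : Set (HeightOneSpectrum (𝓞 F)) := {p | (Ideal.absNorm p.asIdeal).Prime ∧
    2 * d ∉ p.asIdeal ∧ χ p.asIdeal = 1 ∧ ¬ ∃ x, x ^ 2 + d ∈ p.asIdeal}
  let X : Set (HeightOneSpectrum (𝓞 F)) := {p | χ p.asIdeal = 1}
  let TK : Set (HeightOneSpectrum (𝓞 K)) := {Q | (Ideal.absNorm Q.asIdeal).Prime ∧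
    algebraMap (𝓞 F) (𝓞 K) (2 * d) ∉ Q.asIdeal}
  let VK : Set (HeightOneSpectrum (𝓞 K)) := {Q | algebraMap (𝓞 F) (𝓞 K) (2 * d) ∈ Q.asIdeal}
  let VL : Set (HeightOneSpectrum (𝓞 L)) := {Q | algebraMap (𝓞 F) (𝓞 L) (2 * d) ∈ Q.asIdeal}
  let ψ := quarticTwist χ L
  let E : Set (HeightOneSpectrum (𝓞 L)) := {Q | ψ Q.asIdeal ≠ 1}
  let TL : Set (HeightOneSpectrum (𝓞 L)) := {Q | (Ideal.absNorm Q.asIdeal).Prime ∧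
    algebraMap (𝓞 F) (𝓞 L) (2 * d) ∉ Q.asIdeal ∧ ψ Q.asIdeal ≠ 1}
  have hVK : VK.Finite := finite_setOf_mem_asIdeal
    ((map_ne_zero_iff _ (FaithfulSMul.algebraMap_injective (𝓞 F) (𝓞 K))).2 h2d)
  have hVL : VL.Finite := finite_setOf_mem_asIdeal
    ((map_ne_zero_iff _ (FaithfulSMul.algebraMap_injective (𝓞 F) (𝓞 L))).2 h2d)
  have hTK : ∀ Q ∈ TK, (Ideal.absNorm Q.asIdeal).Prime ∧ Q.under (𝓞 F) ∈ S₁ := by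
    rintro Q ⟨hQ, hQ2⟩
    obtain ⟨n, hn⟩ := exists_intCast_sq_sub_mem_under hQ hκ
    exact ⟨hQ, by rwa [absNorm_under_eq_of_prime Q hQ], hQ2, n, by simpa using hn⟩
  have hSX : S₁ ∪ D ⊆ X := by
    rintro p (⟨h1, h2, h3⟩ | ⟨-, -, h, -⟩)
    · exact hsplit p h1 h2 h3
    · exact h
  have hSD : Disjoint S₁ D :=
    Set.disjoint_left.2 fun p h1 h2 => h2.2.2.2 h1.2.2
  have hTL : ∀ Q ∈ TL, (Ideal.absNorm Q.asIdeal).Prime ∧ Q.under (𝓞 F) ∈ D := by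
    rintro Q ⟨hQ, hQ2, hψ⟩
    obtain ⟨n, hn⟩ := exists_intCast_sq_sub_mem_under hQ hδ
    have hN := absNorm_under_eq_of_prime (N := F) Q hQ
    have hQ2' : 2 * d ∉ (Q.under (𝓞 F)).asIdeal := hQ2
    have hp := (Q.under (𝓞 F)).isPrime
    have hmax := (Q.under (𝓞 F)).isMaximal
    have h2 := (two_notMem_of_two_mul_notMem hQ2').1
    have hd' := (two_notMem_of_two_mul_notMem hQ2').2
    have hiff := exists_sq_add_one_mem_iff (Q.under (𝓞 F)).ne_bot
    have hχ := hχ1 _ (Q.under (𝓞 F)).ne_bot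
    have hψQ : ψ Q.asIdeal = χ (Q.under (𝓞 F)).asIdeal *
        ((ZMod.χ₄ (Ideal.absNorm Q.asIdeal : ZMod 4) : ℤ) : ℝ) := by
      change quarticTwist χ L Q.asIdeal = _
      rw [quarticTwist_apply, relNorm_eq_under_of_prime hQ]
    set p := (Q.under (𝓞 F)).asIdeal with hpdef
    have hodd : Ideal.absNorm p % 2 = 1 := by
      rw [← Nat.odd_iff, ← Nat.not_even_iff_odd, hN]
      intro he
      have h3 : Ideal.absNorm p = 2 := hN.trans ((Nat.Prime.even_iff hQ).1 he)
      have h4 := Ideal.absNorm_mem p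
      rw [h3] at h4
      exact h2 (by exact_mod_cast h4)
    have hns : (n : 𝓞 F) ∉ p := by
      intro h5
      refine hd' ?_
      have : d = (n : 𝓞 F) * n - (n ^ 2 - d) := by ring
      rw [this]
      exact sub_mem (Ideal.mul_mem_left _ _ h5) hn
    rcases Nat.odd_mod_four_iff.1 hodd with h | h
    · exfalso
      obtain ⟨x, hx⟩ := hiff.2 (by omega)
      have h6 : χ p = 1 := hsplit (Q.under (𝓞 F)) (by rwa [hN]) hQ2' ⟨x * n, by
        have : (x * n) ^ 2 + d = n ^ 2 * (x ^ 2 + 1) - (n ^ 2 - d) := by ring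
        rw [this]
        exact sub_mem (Ideal.mul_mem_left _ _ hx) hn⟩
      rw [h6, ← hN, ZMod.χ₄_nat_one_mod_four h] at hψQ
      exact hψ (by simpa using hψQ)
    · rw [← hN, ZMod.χ₄_nat_three_mod_four h] at hψQ
      refine ⟨hQ, by rwa [hN], hQ2', ?_, ?_⟩
      · rcases eq_or_eq_neg_of_abs_eq hχ with h7 | h7
        · exact h7
        · rw [h7] at hψQ
          exact absurd (by simpa using hψQ) hψ
      · rintro ⟨x, hx⟩
        refine hiff.1 ?_ h
        obtain ⟨y, hy⟩ : ∃ y, (n : 𝓞 F) * y - 1 ∈ p := by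
          obtain ⟨y, hy⟩ := Ideal.Quotient.exists_inv (I := p) (a := Ideal.Quotient.mk p (n : 𝓞 F))
            (by rwa [Ne, Ideal.Quotient.eq_zero_iff_mem])
          obtain ⟨y, rfl⟩ := Ideal.Quotient.mk_surjective y
          exact ⟨y, by rw [← Ideal.Quotient.eq, map_mul, hy, map_one]⟩
        refine ⟨x * y, ?_⟩
        have : (x * y) ^ 2 + 1 =
            y ^ 2 * (x ^ 2 + d) + y ^ 2 * (n ^ 2 - d) - (n * y + 1) * (n * y - 1) := by ring
        rw [this]
        exact sub_mem (add_mem (Ideal.mul_mem_left _ _ hx) (Ideal.mul_mem_left _ _ hn))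
          (Ideal.mul_mem_left _ _ hy)
  have hE : E ⊆ {Q | ¬ (Ideal.absNorm Q.asIdeal).Prime} ∪ (VL ∪ TL) := by
    intro Q hQ
    by_cases h1 : (Ideal.absNorm Q.asIdeal).Prime
    · by_cases h2 : algebraMap (𝓞 F) (𝓞 L) (2 * d) ∈ Q.asIdeal
      · exact Or.inr (Or.inl h2)
      · exact Or.inr (Or.inr ⟨h1, h2, hQ⟩)
    · exact Or.inl h1
  have hKuniv : (Set.univ : Set (HeightOneSpectrum (𝓞 K))) ⊆
      {Q | ¬ (Ideal.absNorm Q.asIdeal).Prime} ∪ (VK ∪ TK) := by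
    intro Q _
    by_cases h1 : (Ideal.absNorm Q.asIdeal).Prime
    · by_cases h2 : algebraMap (𝓞 F) (𝓞 K) (2 * d) ∈ Q.asIdeal
      · exact Or.inr (Or.inl h2)
      · exact Or.inr (Or.inr ⟨h1, h2⟩)
    · exact Or.inl h1
  -- the analytic input
  have hχle := abs_char_le hχ1
  have hψle : ∀ a, |ψ a| ≤ 1 := fun a => abs_quarticTwist_le hχ1 a
  obtain ⟨γ, hγ, hγ4⟩ := exists_quarticTwist_eq_neg_one (L := L) hχp hL
  obtain ⟨CF, δF, hδF, hF⟩ := exists_bound_primeSum_univ F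
  obtain ⟨CK, δK, hδK, hKu⟩ := exists_bound_primeSum_univ K
  obtain ⟨CL, δL, hδL, hLu⟩ := exists_bound_primeSum_univ L
  obtain ⟨CK', hK'⟩ := exists_bound_primeSum_not_prime K
  obtain ⟨CL', hL'⟩ := exists_bound_primeSum_not_prime L
  obtain ⟨EF, hEF⟩ := log_tsum_twist F
  obtain ⟨EL, hEL⟩ := log_tsum_twist L
  obtain ⟨BF, hBF⟩ := exists_bound_tsum_twist (f := χ) hχle (m := ⊤) top_ne_bot
    (fun a ha _ => hχ1 a ha) (fun x y hx hy _ _ => by rw [hχp x hx, hχp y hy]) hβ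
    (sup_top_eq β)
  obtain ⟨BL, hBL⟩ := exists_bound_tsum_twist (f := ψ) hψle (m := Ideal.span {(4 : 𝓞 L)})
    (by simp) (fun a ha h4 => abs_quarticTwist_eq hχ1 ha h4)
    (fun x y hx hy hxy hs => quarticTwist_span_congr hχp hL hx hy hxy hs) hγ hγ4
  set n : ℝ := ((Module.finrank F L : ℕ) : ℝ)
  have hn : 0 ≤ n := Nat.cast_nonneg _
  -- every bound is uniform in `s`
  have key : ∀ s, 1 < s → s ≤ 2 → s < 1 + δF → s < 1 + δK → s < 1 + δL →
      Real.log (1 / (s - 1)) ≤ CL + EL + Real.log BL + 2 * (CL' + (VL.ncard + n *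
        ((CF + EF + Real.log BF) / 2 + (CK + CK' + VK.ncard) / 2))) := by
    intro s hs hs2 hsF hsK hsL
    have hXsum : 2 * primeSum s X = primeSum s (Set.univ : Set (HeightOneSpectrum (𝓞 F))) +
        ∑' Q : HeightOneSpectrum (𝓞 F), χ Q.asIdeal * normTerm s Q.asIdeal := by
      unfold primeSum
      rw [← tsum_mul_left, ← (summable_primeSum hs _).tsum_add (summable_twist_prime hχle hs)]
      congr 1
      funext Q
      rw [Set.indicator_univ]
      rcases eq_or_eq_neg_of_abs_eq (hχ1 _ Q.ne_bot) with h | h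
      · rw [Set.indicator_of_mem (by exact h), h]; ring
      · rw [Set.indicator_of_notMem (by
          change ¬ χ Q.asIdeal = 1
          rw [h]; norm_num), h]; ring
    have hEsum : primeSum s (Set.univ : Set (HeightOneSpectrum (𝓞 L))) ≤
        ∑' Q : HeightOneSpectrum (𝓞 L), ψ Q.asIdeal * normTerm s Q.asIdeal +
          2 * primeSum s E := by
      unfold primeSum
      rw [← tsum_mul_left, ← (summable_twist_prime hψle hs).tsum_add
        ((summable_primeSum hs _).mul_left 2)]
      refine (summable_primeSum hs _).tsum_le_tsum (fun Q => ?_)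
        ((summable_twist_prime hψle hs).add ((summable_primeSum hs _).mul_left 2))
      rw [Set.indicator_univ]
      have h0 := normTerm_nonneg s Q.asIdeal
      by_cases h : ψ Q.asIdeal = 1
      · rw [Set.indicator_of_notMem (by simpa [E] using h), h]; linarith
      · rw [Set.indicator_of_mem (by exact h)]
        nlinarith [(abs_le.1 (hψle Q.asIdeal)).1]
    have h1 := abs_le.1 (hF s hs hsF)
    have h2 := abs_le.1 (hKu s hs hsK)
    have h3 := abs_le.1 (hLu s hs hsL)
    obtain ⟨hp1, h4⟩ := hEF s hs χ hχle
    obtain ⟨hp2, h5⟩ := hEL s hs ψ hψle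
    have h4' := abs_le.1 h4
    have h5' := abs_le.1 h5
    have h6 := Real.log_le_log hp1 (hBF s hs hs2)
    have h7 := Real.log_le_log hp2 (hBL s hs hs2)
    have h8 := primeSum_mono hs hSX
    rw [primeSum_union hs hSD] at h8
    have h9 := primeSum_le_finrank_mul hs hTK
    rw [hK] at h9
    have h10 := primeSum_le_finrank_mul hs hTL
    have h11 := (primeSum_mono hs hKuniv).trans (primeSum_union_le hs _ _)
    have h12 := primeSum_union_le hs VK TK
    have h13 := (primeSum_mono hs hE).trans (primeSum_union_le hs _ _)
    have h14 := primeSum_union_le hs VL TL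
    have h15 := primeSum_le_ncard hs hVK
    have h16 := primeSum_le_ncard hs hVL
    have h17 := hK' s hs
    have h18 := hL' s hs
    push_cast at h9
    have h19 : primeSum s D ≤
        (CF + EF + Real.log BF) / 2 + (CK + CK' + VK.ncard) / 2 := by linarith [h1.2, h2.1, h4'.1]
    have h20 := mul_le_mul_of_nonneg_left h19 hn
    linarith [h3.1, h5'.1]
  set M := CL + EL + Real.log BL + 2 * (CL' + (VL.ncard + n *
        ((CF + EF + Real.log BF) / 2 + (CK + CK' + VK.ncard) / 2)))
  obtain ⟨t, ht0, ht⟩ : ∃ t : ℝ, 0 < t ∧ t ≤ 1 ∧ t < δF ∧ t < δK ∧ t < δL ∧ t < Real.exp (-M) := by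
    have hm : 0 < min (min 1 (min δF (min δK δL))) (Real.exp (-M)) := by
      simp [hδF, hδK, hδL, Real.exp_pos]
    refine ⟨_, half_pos hm, ?_⟩
    have := half_lt_self hm
    simp only [lt_min_iff] at this
    obtain ⟨⟨a1, a2, a3, a4⟩, a5⟩ := this
    exact ⟨a1.le, a2, a3, a4, a5⟩
  obtain ⟨t1, t2, t3, t4, t5⟩ := ht
  have h := key (1 + t) (by linarith) (by linarith) (by linarith) (by linarith) (by linarith)
  rw [add_sub_cancel_left, one_div, Real.log_inv] at h
  have := Real.log_lt_log ht0 t5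
  rw [Real.log_exp] at this
  linarith

end SplitPrimes

section Conjugation

open NumberField

variable {F K : Type*} [Field F] [NumberField F] [Field K] [NumberField K] [Algebra F K]

/-- Complex conjugation on the ring of integers of a CM extension `K / F`. -/
lemma exists_conj (hF : ∀ φ : F →+* ℂ, ComplexEmbedding.IsReal φ)
    (h2 : Module.finrank F K = 2) (hK : IsEmpty (K →+* ℝ)) :
    ∃ s : 𝓞 K ≃ₐ[𝓞 F] 𝓞 K, (∀ x, s (s x) = x) ∧
      (∀ x, s x = x → ∃ r, algebraMap (𝓞 F) (𝓞 K) r = x) ∧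
      ∀ (φ : K →+* ℂ) (x : 𝓞 K), φ (s x : 𝓞 K) = starRingEnd ℂ (φ x) := by
  have : IsTotallyReal F := ⟨fun v => by
    rw [InfinitePlace.isReal_iff]
    exact hF _⟩
  have : IsTotallyComplex K := ⟨fun v => by
    rw [InfinitePlace.isComplex_iff]
    intro h
    exact hK.false h.embedding⟩
  have : Algebra.IsQuadraticExtension F K := { finrank_eq_two' := h2 }
  have : IsCMField K := IsCMField.ofCMExtension F K
  let σ : K ≃ₐ[F] K := AlgEquiv.ofRingEquiv (f := (IsCMField.complexConj K : K ≃+* K)) (fun r => by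
    have h := IsCMField.complexConj_apply_eq_self K (CMExtension.equivMaximalRealSubfield F K r)
    rw [CMExtension.equivMaximalRealSubfield_apply] at h
    exact h)
  have hσ : ∀ x, σ x = IsCMField.complexConj K x := fun x => rfl
  have hs : ∀ x : 𝓞 K, ((RingOfIntegers.mapAlgEquiv σ x : 𝓞 K) : K) = σ x := fun x => rfl
  refine ⟨RingOfIntegers.mapAlgEquiv σ, fun x => ?_, fun x hx => ?_, fun φ x => ?_⟩
  · apply RingOfIntegers.ext
    rw [hs, hs, hσ, hσ, IsCMField.complexConj_apply_apply]
  · have h1 : IsCMField.complexConj K (x : K) = x := by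
      rw [← hσ, ← hs, hx]
    rw [IsCMField.complexConj_eq_self_iff] at h1
    have h3 := CMExtension.algebraMap_equivMaximalRealSubfield_symm_apply F K ⟨x, h1⟩
    have h4 : IsIntegral ℤ ((CMExtension.equivMaximalRealSubfield F K).symm ⟨x, h1⟩) := by
      rw [← isIntegral_algebraMap_iff (FaithfulSMul.algebraMap_injective F K), h3]
      exact x.isIntegral_coe
    exact ⟨⟨_, h4⟩, RingOfIntegers.ext h3⟩
  · rw [hs, hσ, IsCMField.complexEmbedding_complexConj]

/-- A purely imaginary integral generator of a CM extension. -/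
lemma exists_sq_eq_neg (hK : IsEmpty (K →+* ℝ))
    {s : 𝓞 K ≃ₐ[𝓞 F] 𝓞 K} (hs : ∀ x, s (s x) = x)
    (hfix : ∀ x, s x = x → ∃ r, algebraMap (𝓞 F) (𝓞 K) r = x)
    (hconj : ∀ (φ : K →+* ℂ) (x : 𝓞 K), φ (s x : 𝓞 K) = starRingEnd ℂ (φ x)) :
    ∃ (d : 𝓞 F) (κ : 𝓞 K), d ≠ 0 ∧ κ ^ 2 = algebraMap (𝓞 F) (𝓞 K) (-d) ∧ s κ = -κ ∧
      ∀ φ : F →+* ℂ, ∃ t : ℝ, φ d = (t : ℂ) ^ 2 := by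
  obtain ⟨φ₀⟩ : Nonempty (K →+* ℂ) := inferInstance
  obtain ⟨x, hx⟩ : ∃ x, s x ≠ x := by
    by_contra! h
    have hr : ComplexEmbedding.IsReal φ₀ := by
      rw [ComplexEmbedding.isReal_iff]
      ext y
      rw [ComplexEmbedding.conjugate_coe_eq]
      obtain ⟨a, b, hb, rfl⟩ := IsFractionRing.div_surjective (A := 𝓞 K) y
      have key : ∀ a : 𝓞 K, starRingEnd ℂ (φ₀ a) = φ₀ a := fun a => by
        rw [← hconj, h]
      rw [map_div₀, map_div₀]
      exact congrArg₂ (· / ·) (key a) (key b)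
    exact hK.false hr.embedding
  set κ := x - s x with hκ
  have hκ0 : κ ≠ 0 := fun h => hx (sub_eq_zero.1 h).symm
  have hsκ : s κ = -κ := by rw [hκ, map_sub, hs]; ring
  obtain ⟨e, he⟩ := hfix (κ ^ 2) (by rw [map_pow, hsκ]; ring)
  refine ⟨-e, κ, ?_, by rw [neg_neg, he], hsκ, fun φ => ?_⟩
  · intro h
    rw [neg_eq_zero] at h
    rw [h, map_zero] at he
    exact hκ0 (pow_eq_zero_iff two_ne_zero |>.1 he.symm)
  · let ψ : K →+* ℂ := ComplexEmbedding.lift K φ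
    have hψ : ∀ y : F, ψ (algebraMap F K y) = φ y := fun y =>
      ComplexEmbedding.lift_algebraMap_apply K φ y
    have h1 := hconj ψ κ
    rw [hsκ] at h1
    have h1' : starRingEnd ℂ (ψ κ) = - ψ κ := by
      rw [← h1]; exact map_neg ψ (κ : K)
    have h3 : (ψ κ).re = 0 := by
      have := congrArg Complex.re h1'
      rw [Complex.conj_re, Complex.neg_re] at this
      linarith
    refine ⟨(ψ κ).im, ?_⟩
    have h4 : φ (e : F) = (ψ κ) ^ 2 := by
      rw [← hψ, ← map_pow]
      congr 1
      exact congrArg (algebraMap (𝓞 K) K) he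
    have h5 : φ ((-e : 𝓞 F) : F) = - φ e := map_neg φ (e : F)
    rw [h5, h4]
    apply Complex.ext <;> simp [pow_two, h3]

end Conjugation

section TotallyRealQuadratic

open NumberField

/-- A totally real field containing a square root of a totally positive integer. -/
lemma exists_totallyReal_sqrt {F : Type*} [Field F] [NumberField F]
    (hF : ∀ φ : F →+* ℂ, ComplexEmbedding.IsReal φ) {d : 𝓞 F}
    (hd : ∀ φ : F →+* ℂ, ∃ t : ℝ, φ d = (t : ℂ) ^ 2) :
    ∃ (L : IntermediateField F (AlgebraicClosure F)) (_ : NumberField L),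
      (∀ φ : L →+* ℂ, ComplexEmbedding.IsReal φ) ∧
      ∃ δ : 𝓞 L, δ ^ 2 = algebraMap (𝓞 F) (𝓞 L) d := by
  obtain ⟨δ, hδ⟩ := IsAlgClosed.exists_pow_nat_eq (algebraMap F (AlgebraicClosure F) d) two_pos
  have hδint : IsIntegral F δ := (AlgebraicClosure.isAlgebraic F).isAlgebraic δ |>.isIntegral
  have : FiniteDimensional F (IntermediateField.adjoin F {δ}) :=
    IntermediateField.adjoin.finiteDimensional hδint
  have : NumberField (IntermediateField.adjoin F {δ}) :=
    NumberField.of_module_finite F _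
  have hmem : δ ∈ IntermediateField.adjoin F {δ} :=
    IntermediateField.subset_adjoin F _ rfl
  set δ' : IntermediateField.adjoin F {δ} := ⟨δ, hmem⟩
  have hδ' : δ' ^ 2 = algebraMap F _ (d : F) := Subtype.ext hδ
  have hi : IsIntegral ℤ δ' := by
    refine IsIntegral.of_pow two_pos ?_
    rw [hδ']
    exact d.isIntegral_coe.map (IsScalarTower.toAlgHom ℤ F _)
  refine ⟨IntermediateField.adjoin F {δ}, inferInstance, fun φ => ?_,
    ⟨δ', hi⟩, RingOfIntegers.ext hδ'⟩
  have hreal : ∀ y : F, starRingEnd ℂ (φ (algebraMap F _ y)) = φ (algebraMap F _ y) := fun y =>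
    RingHom.congr_fun (ComplexEmbedding.isReal_iff.1 (hF (φ.comp (algebraMap F _)))) y
  have hφδ : starRingEnd ℂ (φ δ') = φ δ' := by
    obtain ⟨t, ht⟩ := hd (φ.comp (algebraMap F _))
    have h1 : (φ δ') ^ 2 = (t : ℂ) ^ 2 := by
      rw [← ht, ← map_pow, hδ']; rfl
    rcases sq_eq_sq_iff_eq_or_eq_neg.1 h1 with h | h <;> rw [h] <;> simp
  rw [ComplexEmbedding.isReal_iff]
  ext ⟨y, hy⟩
  rw [ComplexEmbedding.conjugate_coe_eq]
  induction hy using IntermediateField.adjoin_induction with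
  | mem x hx => obtain rfl := hx; exact hφδ
  | algebraMap x => exact hreal x
  | add x y hx hy h1 h2 =>
    have := congrArg₂ (· + ·) h1 h2
    simp only [← map_add] at this
    exact this
  | inv x hx h1 =>
    have := congrArg (·⁻¹) h1
    simp only [← map_inv₀] at this
    exact this
  | mul x y hx hy h1 h2 =>
    have := congrArg₂ (· * ·) h1 h2
    simp only [← map_mul] at this
    exact this

end TotallyRealQuadratic

section IdealCharacter

/-- A finite commutative group of even order has a nontrivial quadratic character. -/
lemma exists_quadratic_char {G : Type*} [CommGroup G] [Finite G] (hG : Even (Nat.card G)) :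
    ∃ ψ : G →* ℝ, (∀ g, ψ g = 1 ∨ ψ g = -1) ∧ ∃ g, ψ g = -1 := by
  obtain ⟨t, ht⟩ := exists_prime_orderOf_dvd_card' 2 hG.two_dvd
  obtain ⟨g, hg⟩ : ∃ g : G, g ∉ (powMonoidHom 2 : G →* G).range := by
    by_contra! h
    have hsurj : Function.Surjective (powMonoidHom 2 : G →* G) := h
    have h1 : t = 1 := by
      apply (Finite.injective_iff_surjective.2 hsurj)
      rw [powMonoidHom_apply, powMonoidHom_apply, ← ht, pow_orderOf_eq_one, one_pow]
    rw [h1, orderOf_one] at ht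
    omega
  obtain ⟨φ, hφ⟩ := CommGroup.exists_apply_ne_one_of_hasEnoughRootsOfUnity
    (G ⧸ (powMonoidHom 2 : G →* G).range) ℂ (a := QuotientGroup.mk g)
    (fun h => hg ((QuotientGroup.eq_one_iff g).1 h))
  have hpm : ∀ x : G, (φ (QuotientGroup.mk x) : ℂ) = 1 ∨ (φ (QuotientGroup.mk x) : ℂ) = -1 := by
    intro x
    rw [← sq_eq_one_iff, ← Units.val_pow_eq_pow_val, ← map_pow, ← QuotientGroup.mk_pow,
      (QuotientGroup.eq_one_iff (x ^ 2)).2 (MonoidHom.mem_range.2 ⟨x, rfl⟩), map_one,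
      Units.val_one]
  refine ⟨{ toFun := fun x => (φ (QuotientGroup.mk x) : ℂ).re, map_one' := ?_, map_mul' := ?_ },
    fun x => ?_, g, ?_⟩
  · rw [QuotientGroup.mk_one, map_one, Units.val_one, Complex.one_re]
  · intro x y
    rw [QuotientGroup.mk_mul, map_mul, Units.val_mul]
    rcases hpm x with h | h <;> rcases hpm y with h' | h' <;> rw [h, h'] <;> simp
  · rcases hpm x with h | h
    · left; simp [h]
    · right; simp [h]
  · rcases hpm g with h | h
    · exact absurd (Units.ext h) hφ
    · simp [h]

open NumberField nonZeroDivisors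

/-- A quadratic character of the class group, viewed as a character of ideals. -/
lemma exists_ideal_quadratic_char {F : Type*} [Field F] [NumberField F]
    (hF : Even (Nat.card (ClassGroup (𝓞 F)))) :
    ∃ χ : Ideal (𝓞 F) →*₀ ℝ, (∀ a, a ≠ ⊥ → χ a = 1 ∨ χ a = -1) ∧
      (∀ x : 𝓞 F, x ≠ 0 → χ (Ideal.span {x}) = 1) ∧ ∃ β, χ β = -1 := by
  classical
  obtain ⟨ψ, hψ, g, hg⟩ := exists_quadratic_char hF
  have hmem : ∀ {a : Ideal (𝓞 F)}, a ≠ ⊥ → a ∈ (Ideal (𝓞 F))⁰ := fun h =>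
    mem_nonZeroDivisors_iff_ne_zero.2 h
  let f : Ideal (𝓞 F) → ℝ := fun a =>
    if h : a = ⊥ then 0 else ψ (ClassGroup.mk0 ⟨a, hmem h⟩)
  have hf0 : f ⊥ = 0 := dif_pos rfl
  have hf : ∀ a (h : a ≠ ⊥), f a = ψ (ClassGroup.mk0 ⟨a, hmem h⟩) := fun a h => dif_neg h
  refine ⟨{ toFun := f, map_zero' := hf0, map_one' := ?_, map_mul' := fun a b => ?_ },
    fun a ha => ?_, fun x hx => ?_, ?_⟩
  · rw [hf 1 one_ne_zero]
    have : (⟨1, hmem one_ne_zero⟩ : (Ideal (𝓞 F))⁰) = 1 := rfl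
    rw [this, map_one, map_one]
  · by_cases ha : a = ⊥
    · rw [ha, hf0, zero_mul, show (⊥ : Ideal (𝓞 F)) * b = ⊥ from Ideal.bot_mul b, hf0]
    by_cases hb : b = ⊥
    · rw [hb, hf0, mul_zero, show a * (⊥ : Ideal (𝓞 F)) = ⊥ from Ideal.mul_bot a, hf0]
    rw [hf a ha, hf b hb, hf (a * b) (mul_ne_zero ha hb), ← map_mul, ← map_mul]
    rfl
  · change f a = 1 ∨ f a = -1
    rw [hf a ha]; exact hψ _
  · have hx' : Ideal.span {x} ≠ ⊥ := by rwa [Ne, Ideal.span_singleton_eq_bot]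
    change f _ = 1
    rw [hf _ hx', (ClassGroup.mk0_eq_one_iff _).2 ⟨x, rfl⟩, map_one]
  · obtain ⟨b, rfl⟩ := ClassGroup.mk0_surjective g
    refine ⟨b, ?_⟩
    change f _ = -1
    rw [hf _ (mem_nonZeroDivisors_iff_ne_zero.1 b.2)]
    exact hg

end IdealCharacter

section Capitulation

open NumberField nonZeroDivisors

variable {F K : Type*} [Field F] [NumberField F] [Field K] [NumberField K] [Algebra F K]

omit [NumberField F] [NumberField K] in
lemma map_conj_map (s : 𝓞 K ≃ₐ[𝓞 F] 𝓞 K) (I : Ideal (𝓞 F)) :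
    (I.map (algebraMap (𝓞 F) (𝓞 K))).map s = I.map (algebraMap (𝓞 F) (𝓞 K)) := by
  have h : (s : 𝓞 K →+* 𝓞 K).comp (algebraMap (𝓞 F) (𝓞 K)) = algebraMap (𝓞 F) (𝓞 K) :=
    RingHom.ext s.commutes
  conv_rhs => rw [← h]
  exact Ideal.map_map _ (s : 𝓞 K →+* 𝓞 K)

lemma finrank_ringOfIntegers (h2 : Module.finrank F K = 2) :
    Module.finrank (𝓞 F) (𝓞 K) = 2 := by
  rw [← h2]
  exact (IsFractionRing.finrank_eq (𝓞 F) F (𝓞 K) K).symm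

/-- If `x² ≡ -d` modulo `p` and `κ² = -d`, the ideal `(p, x - κ)` has norm `p`. -/
lemma relNorm_span_sup_eq {s : 𝓞 K ≃ₐ[𝓞 F] 𝓞 K} {d : 𝓞 F} {κ : 𝓞 K}
    (hK : Module.finrank F K = 2)
    (hκ : κ ^ 2 = algebraMap (𝓞 F) (𝓞 K) (-d)) (hsκ : s κ = -κ) {p : Ideal (𝓞 F)}
    (hp : p.IsMaximal) (h2d : 2 * d ∉ p) {x : 𝓞 F} (hx : x ^ 2 + d ∈ p) :
    Ideal.relNorm (𝓞 F) (p.map (algebraMap (𝓞 F) (𝓞 K)) ⊔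
      Ideal.span {algebraMap (𝓞 F) (𝓞 K) x - κ}) = p := by
  set j := algebraMap (𝓞 F) (𝓞 K)
  set A := p.map j ⊔ Ideal.span {j x - κ}
  have hsA : A.map s = p.map j ⊔ Ideal.span {j x + κ} := by
    rw [Ideal.map_sup, Ideal.map_span, Set.image_singleton, map_sub, hsκ, sub_neg_eq_add]
    rw [map_conj_map, show s (j x) = j x from s.commutes x]
  have hprod : A * A.map s = p.map j := by
    rw [hsA]
    apply le_antisymm
    · rw [Ideal.mul_sup, sup_le_iff]
      refine ⟨Ideal.mul_le_right, ?_⟩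
      rw [Ideal.sup_mul, sup_le_iff]
      refine ⟨Ideal.mul_le_left, ?_⟩
      rw [Ideal.span_singleton_mul_span_singleton, Ideal.span_singleton_le_iff_mem]
      have : (j x - κ) * (j x + κ) = j (x ^ 2 + d) := by
        rw [map_neg] at hκ
        rw [map_add, map_pow]
        linear_combination -hκ
      rw [this]
      exact Ideal.mem_map_of_mem j hx
    · rw [Ideal.map_le_iff_le_comap]
      intro r hr
      rw [Ideal.mem_comap]
      obtain ⟨y, hy⟩ : ∃ y, 2 * (2 * d) * y - 1 ∈ p := by
        have h4 : 2 * (2 * d) ∉ p := fun h => by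
          rcases hp.isPrime.mem_or_mem h with h | h
          · exact h2d (Ideal.mul_mem_right _ _ h)
          · exact h2d h
        obtain ⟨y, hy⟩ := hp.exists_inv h4
        obtain ⟨i, hi, hyi⟩ := hy
        refine ⟨y, ?_⟩
        rw [show 2 * (2 * d) * y - 1 = -i by linear_combination hyi]
        exact p.neg_mem hi
      have hr' : j r ∈ p.map j := Ideal.mem_map_of_mem j hr
      have e1 : j r * (j x + κ) ∈ A * (p.map j ⊔ Ideal.span {j x + κ}) :=
        Ideal.mul_mem_mul (Ideal.mem_sup_left hr')
          (Ideal.mem_sup_right (Ideal.mem_span_singleton_self _))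
      have e2 : (j x - κ) * j r ∈ A * (p.map j ⊔ Ideal.span {j x + κ}) :=
        Ideal.mul_mem_mul (Ideal.mem_sup_right (Ideal.mem_span_singleton_self _))
          (Ideal.mem_sup_left hr')
      have e3 : j r * j (2 * (2 * d) * y - 1) ∈ A * (p.map j ⊔ Ideal.span {j x + κ}) :=
        Ideal.mul_mem_mul (Ideal.mem_sup_left hr')
          (Ideal.mem_sup_left (Ideal.mem_map_of_mem j hy))
      have : j r = (j r * (j x + κ) - (j x - κ) * j r) * (-2 * κ * j y) -
          j r * j (2 * (2 * d) * y - 1) := by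
        rw [map_neg] at hκ
        simp only [map_sub, map_mul, map_one, map_ofNat]
        linear_combination (4 * j r * j y) * hκ
      rw [this]
      exact Ideal.sub_mem _ (Ideal.mul_mem_right _ _ (Ideal.sub_mem _ e1 e2)) e3
  have h := congrArg (Ideal.relNorm (𝓞 F)) hprod
  have hfr : Module.finrank (𝓞 F) (𝓞 K) = 2 := finrank_ringOfIntegers hK
  rw [map_mul, Ideal.relNorm_map_algEquiv, Ideal.relNorm_algebraMap, hfr, ← pow_two] at h
  exact pow_left_injective two_ne_zero h

/-- Some nonprincipal ideal of `F` becomes principal in `K` if the class number of the totally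
real field `F` is even and the relative class number of the CM extension `K / F` is odd. -/
theorem exists_capitulation (hF : ∀ φ : F →+* ℂ, ComplexEmbedding.IsReal φ)
    (h2 : Module.finrank F K = 2) (hK : IsEmpty (K →+* ℝ))
    (heven : Even (Nat.card (ClassGroup (𝓞 F)))) {m : ℕ} (hm : Odd m)
    (hcard : Nat.card (ClassGroup (𝓞 K)) = Nat.card (ClassGroup (𝓞 F)) * m) :
    ¬ Function.Injective (ClassGroup.extendedHom (𝓞 F) (𝓞 K)) := by
  intro hinj
  obtain ⟨s, hs, hfix, hconj⟩ := exists_conj hF h2 hK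
  obtain ⟨d, κ, hd, hκ, hsκ, hpos⟩ := exists_sq_eq_neg hK hs hfix hconj
  obtain ⟨L, _, hL, δ, hδ⟩ := exists_totallyReal_sqrt hF hpos
  obtain ⟨χ, hχ1, hχp, β, hβ⟩ := exists_ideal_quadratic_char heven
  obtain ⟨p, -, h2d, ⟨x, hx⟩, hχ⟩ := exists_split_prime_char_ne_one hL hd hδ hκ h2
    (fun a ha => by rcases hχ1 a ha with h | h <;> rw [h] <;> simp) hχp hβ
  set A := p.asIdeal.map (algebraMap (𝓞 F) (𝓞 K)) ⊔
      Ideal.span {algebraMap (𝓞 F) (𝓞 K) x - κ} with hA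
  have hNA : Ideal.relNorm (𝓞 F) A = p.asIdeal :=
    relNorm_span_sup_eq h2 hκ hsκ p.isMaximal h2d hx
  have hA0 : A ≠ ⊥ := by
    intro h
    rw [h, Ideal.relNorm_bot] at hNA
    exact p.ne_bot hNA.symm
  set H := (ClassGroup.extendedHom (𝓞 F) (𝓞 K)).range
  have hidx : H.index = m := by
    have h1 := H.card_mul_index
    have h3 : Nat.card H = Nat.card (ClassGroup (𝓞 F)) :=
      (Nat.card_congr (MonoidHom.ofInjective hinj).toEquiv).symm
    rw [h3, hcard] at h1
    exact Nat.eq_of_mul_eq_mul_left Nat.card_pos h1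
  let A' : (Ideal (𝓞 K))⁰ := ⟨A, mem_nonZeroDivisors_iff_ne_zero.2 hA0⟩
  obtain ⟨c, hc⟩ : ClassGroup.mk0 A' ^ m ∈ H := by
    rw [← hidx]
    exact H.pow_index_mem _
  obtain ⟨c, rfl⟩ := ClassGroup.mk0_surjective c
  rw [ClassGroup.extendedHom_mk0, ← map_pow, ClassGroup.mk0_eq_mk0_iff] at hc
  obtain ⟨y, z, hy, hz, hyz⟩ := hc
  have key := congrArg (fun I => χ (Ideal.relNorm (𝓞 F) I)) hyz
  have hfr : Module.finrank (𝓞 F) (𝓞 K) = 2 := finrank_ringOfIntegers h2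
  have hspan : ∀ w : 𝓞 K, w ≠ 0 → χ (Ideal.relNorm (𝓞 F) (Ideal.span {w})) = 1 := by
    intro w hw
    rw [Ideal.relNorm_singleton]
    exact hχp _ (Algebra.intNorm_ne_zero.2 hw)
  have hc0 : (c : Ideal (𝓞 F)) ≠ ⊥ := mem_nonZeroDivisors_iff_ne_zero.1 c.2
  simp only [map_mul, hspan y hy, hspan z hz, one_mul,
    Ideal.relNorm_algebraMap, hfr, SubmonoidClass.coe_pow, map_pow, A', hNA] at key
  have h4 : χ (c : Ideal (𝓞 F)) ^ 2 = 1 := by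
    rcases hχ1 _ hc0 with h | h <;> rw [h] <;> norm_num
  rw [h4] at key
  rcases hχ1 _ p.ne_bot with h | h
  · exact hχ h
  · rw [h, hm.neg_one_pow] at key
    norm_num at key

end Capitulation

section CyclicGroup

variable {G : Type*} [CommGroup G] [Finite G] [IsCyclic G]

/-- In a finite cyclic group, the cosets of squares are represented by `1` and any nonsquare `ζ`;
moreover `ζ` generates a subgroup of odd index. -/
lemma exists_sq_or_eq_mul_sq {ζ : G} (hζ : ∀ t, ζ ≠ t ^ 2) :
    (∀ u : G, ∃ t, u = t ^ 2 ∨ u = ζ * t ^ 2) ∧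
      ∃ n : ℕ, Odd n ∧ ∀ t : G, ∃ i : ℕ, t ^ n = ζ ^ i := by
  obtain ⟨g, hg⟩ := IsCyclic.exists_monoid_generator (α := G)
  obtain ⟨k, rfl⟩ := Submonoid.mem_powers_iff _ _ |>.1 (hg ζ)
  have hk : Odd k := by
    rw [← Nat.not_even_iff_odd]
    rintro ⟨j, rfl⟩
    exact hζ (g ^ j) (by rw [← pow_mul, mul_two])
  refine ⟨fun u => ?_, k, hk, fun t => ?_⟩
  · obtain ⟨i, rfl⟩ := Submonoid.mem_powers_iff _ _ |>.1 (hg u)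
    rcases Nat.even_or_odd i with ⟨j, rfl⟩ | ⟨j, rfl⟩
    · exact ⟨g ^ j, Or.inl (by rw [← pow_mul, mul_two])⟩
    · obtain ⟨k', rfl⟩ := hk
      refine ⟨g ^ j * (g ^ k')⁻¹, Or.inr ?_⟩
      rw [mul_pow, inv_pow, ← pow_mul, ← pow_mul, pow_succ, pow_succ, mul_comm j 2, mul_comm k' 2]
      rw [mul_comm (g ^ (2 * j)) ((g ^ (2 * k'))⁻¹), mul_assoc, mul_left_comm g, ← mul_assoc,
        mul_inv_cancel, one_mul, mul_comm]
  · obtain ⟨i, rfl⟩ := Submonoid.mem_powers_iff _ _ |>.1 (hg t)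
    exact ⟨i, by rw [← pow_mul, ← pow_mul, mul_comm]⟩

end CyclicGroup

section Units

open NumberField NumberField.Units nonZeroDivisors

variable {F K : Type*} [Field F] [NumberField F] [Field K] [NumberField K] [Algebra F K]

variable (F K) in
/-- The properties characterizing complex conjugation on the integers of a CM extension. -/
def IsConjugation (s : 𝓞 K ≃ₐ[𝓞 F] 𝓞 K) : Prop :=
  (∀ x, s (s x) = x) ∧ (∀ x, s x = x → ∃ r, algebraMap (𝓞 F) (𝓞 K) r = x) ∧
    ∀ (φ : K →+* ℂ) (x : 𝓞 K), φ (s x : 𝓞 K) = starRingEnd ℂ (φ x)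

omit [NumberField F] in
lemma IsConjugation.mul_eq_one_of_mem_torsion {s : 𝓞 K ≃ₐ[𝓞 F] 𝓞 K} (h : IsConjugation F K s)
    {t : (𝓞 K)ˣ} (ht : t ∈ torsion K) : (t : 𝓞 K) * s t = 1 := by
  obtain ⟨φ⟩ : Nonempty (K →+* ℂ) := inferInstance
  have h1 : ‖φ (t : 𝓞 K)‖ = 1 := by
    rw [torsion, CommGroup.mem_torsion, isOfFinOrder_iff_pow_eq_one] at ht
    obtain ⟨n, hn, htn⟩ := ht
    refine Complex.norm_eq_one_of_pow_eq_one (ζ := φ (t : 𝓞 K)) (n := n) ?_ hn.ne'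
    rw [← map_pow]
    have : ((t : 𝓞 K) : K) ^ n = 1 := by
      have := congrArg (fun u : (𝓞 K)ˣ => ((u : 𝓞 K) : K)) htn
      simpa using this
    rw [this, map_one]
  apply RingOfIntegers.ext
  apply φ.injective
  have e : (((t : 𝓞 K) * s t : 𝓞 K) : K) = (t : 𝓞 K) * (s t : 𝓞 K) :=
    map_mul (algebraMap (𝓞 K) K) _ _
  rw [e, map_mul, h.2.2, Complex.mul_conj, Complex.normSq_eq_norm_sq, h1]
  simp

omit [NumberField F] in
lemma IsConjugation.mem_torsion_of_mul_eq_one {s : 𝓞 K ≃ₐ[𝓞 F] 𝓞 K} (h : IsConjugation F K s)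
    {t : (𝓞 K)ˣ} (ht : (t : 𝓞 K) * s t = 1) : t ∈ torsion K := by
  have h1 : ∀ φ : K →+* ℂ, ‖φ (t : 𝓞 K)‖ = 1 := fun φ => by
    have := congrArg (fun x : 𝓞 K => φ (algebraMap (𝓞 K) K x)) ht
    simp only [map_mul, map_one] at this
    rw [h.2.2 φ t, Complex.mul_conj, Complex.normSq_eq_norm_sq] at this
    have h2 : ‖φ (t : 𝓞 K)‖ ^ 2 = 1 := by exact_mod_cast this
    exact (pow_eq_one_iff_of_nonneg (norm_nonneg _) two_ne_zero).1 h2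
  obtain ⟨n, hn, hpow⟩ := NumberField.Embeddings.pow_eq_one_of_norm_eq_one K ℂ
    (RingOfIntegers.isIntegral_coe (t : 𝓞 K)) h1
  rw [torsion, CommGroup.mem_torsion, isOfFinOrder_iff_pow_eq_one]
  refine ⟨n, hn, ?_⟩
  apply Units.ext
  apply RingOfIntegers.ext
  have e : (((t ^ n : (𝓞 K)ˣ) : 𝓞 K) : K) = ((t : 𝓞 K) : K) ^ n := by
    rw [Units.val_pow_eq_pow_val]; exact map_pow (algebraMap (𝓞 K) K) _ _
  rw [e, hpow]
  exact (map_one (algebraMap (𝓞 K) K)).symm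

omit [NumberField K] in
lemma map_algebraMap_injective {I J : Ideal (𝓞 F)}
    (h : I.map (algebraMap (𝓞 F) (𝓞 K)) = J.map (algebraMap (𝓞 F) (𝓞 K))) : I = J := by
  rw [← Ideal.comap_map_eq_self_of_faithfullyFlat (B := 𝓞 K) I, h,
    Ideal.comap_map_eq_self_of_faithfullyFlat]

omit [NumberField K] in
lemma eq_span_of_map_eq {a : Ideal (𝓞 F)} {r : 𝓞 F}
    (h : a.map (algebraMap (𝓞 F) (𝓞 K)) = Ideal.span {algebraMap (𝓞 F) (𝓞 K) r}) :
    a = Ideal.span {r} := by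
  apply map_algebraMap_injective (K := K)
  rw [h, Ideal.map_span, Set.image_singleton]

omit [NumberField F] in
/-- If `aO_K = lO_K`, then `l` and its conjugate differ by a root of unity. -/
lemma IsConjugation.exists_torsion {s : 𝓞 K ≃ₐ[𝓞 F] 𝓞 K} (h : IsConjugation F K s)
    {a : Ideal (𝓞 F)} (ha : a ≠ ⊥) {l : 𝓞 K}
    (hl : a.map (algebraMap (𝓞 F) (𝓞 K)) = Ideal.span {l}) :
    ∃ ζ : torsion K, l = ((ζ : (𝓞 K)ˣ) : 𝓞 K) * s l := by
  have hl0 : l ≠ 0 := by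
    rintro rfl
    rw [Ideal.span_singleton_eq_bot.2 rfl,
      Ideal.map_eq_bot_iff_of_injective (FaithfulSMul.algebraMap_injective (𝓞 F) (𝓞 K))] at hl
    exact ha hl
  have h1 : Ideal.span {s l} = Ideal.span {l} := by
    rw [← hl]
    conv_rhs => rw [← map_conj_map s, hl, Ideal.map_span, Set.image_singleton]
  obtain ⟨u, hu⟩ := Ideal.span_singleton_eq_span_singleton.1 h1
  have h2 : (u : 𝓞 K) * s u = 1 := by
    have h3 := congrArg s hu
    rw [map_mul, h.1] at h3
    have h4 : l * ((u : 𝓞 K) * s u) = l * 1 := by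
      rw [mul_one]
      nth_rewrite 2 [← hu]
      rw [← h3]; ring
    exact mul_left_cancel₀ hl0 h4
  exact ⟨⟨u, h.mem_torsion_of_mul_eq_one h2⟩, by rw [mul_comm]; exact hu.symm⟩

/-- If `aO_K = lO_K` with `a` nonprincipal, the root of unity `l / σ l` is not a square. -/
lemma IsConjugation.ne_sq {s : 𝓞 K ≃ₐ[𝓞 F] 𝓞 K} (h : IsConjugation F K s)
    {a : Ideal (𝓞 F)} (ha : ¬ a.IsPrincipal) {l : 𝓞 K}
    (hl : a.map (algebraMap (𝓞 F) (𝓞 K)) = Ideal.span {l}) {ζ : torsion K}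
    (hζ : l = ((ζ : (𝓞 K)ˣ) : 𝓞 K) * s l) (t : torsion K) : ζ ≠ t ^ 2 := by
  rintro rfl
  have ht := h.mul_eq_one_of_mem_torsion t.2
  have hz : (((t ^ 2 : torsion K) : (𝓞 K)ˣ) : 𝓞 K) = ((t : (𝓞 K)ˣ) : 𝓞 K) ^ 2 := by
    push_cast; rfl
  rw [hz] at hζ
  obtain ⟨r, hr⟩ := h.2.1 (l * s (t : (𝓞 K)ˣ)) (by
    rw [map_mul, h.1]
    conv_rhs => rw [hζ]
    linear_combination (-((t : (𝓞 K)ˣ) : 𝓞 K) * s l) * ht)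
  apply ha
  have : a = Ideal.span {r} := by
    apply eq_span_of_map_eq (K := K)
    rw [hl, hr, Ideal.span_singleton_eq_span_singleton]
    refine ⟨(t : (𝓞 K)ˣ)⁻¹, ?_⟩
    congr 1
    rw [Units.inv_eq_of_mul_eq_one_right ht]
  rw [this]
  exact ⟨r, rfl⟩

/-- An element which differs from its conjugate by a unit is, up to a root of unity, an element of
`F` or such an element divided by the conjugate of `l`, where `aO_K = lO_K` with
`a` nonprincipal. -/
lemma IsConjugation.exists_eq_torsion_mul {s : 𝓞 K ≃ₐ[𝓞 F] 𝓞 K} (h : IsConjugation F K s)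
    {a : Ideal (𝓞 F)} (ha : ¬ a.IsPrincipal) (ha0 : a ≠ ⊥) {l : 𝓞 K}
    (hl : a.map (algebraMap (𝓞 F) (𝓞 K)) = Ideal.span {l}) {β : 𝓞 K} (hβ : β ≠ 0)
    {u : (𝓞 K)ˣ} (hu : β = u * s β) :
    ∃ (t : torsion K) (r : 𝓞 F),
      β = ((t : (𝓞 K)ˣ) : 𝓞 K) * algebraMap (𝓞 F) (𝓞 K) r ∨
      β * s l = ((t : (𝓞 K)ˣ) : 𝓞 K) * algebraMap (𝓞 F) (𝓞 K) r := by
  obtain ⟨ζ, hζ⟩ := h.exists_torsion ha0 hl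
  have huu : (u : 𝓞 K) * s u = 1 := by
    have h3 := congrArg s hu
    rw [map_mul, h.1] at h3
    have h4 : β * ((u : 𝓞 K) * s u) = β * 1 := by
      rw [mul_one]
      nth_rewrite 2 [hu]
      rw [h3]; ring
    exact mul_left_cancel₀ hβ h4
  obtain ⟨t, ht⟩ := (exists_sq_or_eq_mul_sq (h.ne_sq ha hl hζ)).1
    ⟨u, h.mem_torsion_of_mul_eq_one huu⟩
  have htt := h.mul_eq_one_of_mem_torsion t.2
  rcases ht with ht | ht
  · have hut : (u : 𝓞 K) = ((t : (𝓞 K)ˣ) : 𝓞 K) ^ 2 := by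
      have := congrArg (fun x : torsion K => ((x : (𝓞 K)ˣ) : 𝓞 K)) ht
      simpa using this
    rw [hut] at hu
    obtain ⟨r, hr⟩ := h.2.1 (β * s (t : (𝓞 K)ˣ)) (by
      rw [map_mul, h.1]
      conv_rhs => rw [hu]
      linear_combination (-((t : (𝓞 K)ˣ) : 𝓞 K) * s β) * htt)
    exact ⟨t, r, Or.inl (by rw [hr]; linear_combination (-β) * htt)⟩
  · have hut : (u : 𝓞 K) = ((ζ : (𝓞 K)ˣ) : 𝓞 K) * ((t : (𝓞 K)ˣ) : 𝓞 K) ^ 2 := by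
      have := congrArg (fun x : torsion K => ((x : (𝓞 K)ˣ) : 𝓞 K)) ht
      simpa using this
    rw [hut] at hu
    obtain ⟨r, hr⟩ := h.2.1 (β * s l * s (t : (𝓞 K)ˣ)) (by
      rw [map_mul, map_mul, h.1, h.1]
      conv_rhs => rw [hu]
      nth_rewrite 1 [hζ]
      linear_combination (-((t : (𝓞 K)ˣ) : 𝓞 K) * s β * s l * ((ζ : (𝓞 K)ˣ) : 𝓞 K)) * htt)
    exact ⟨t, r, Or.inr (by rw [hr]; linear_combination (-β * s l) * htt)⟩

/-- If some nonprincipal ideal of `F` becomes principal in `K`, every unit of `K` is a root of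
unity times a unit of `F`. -/
lemma IsConjugation.exists_unit_eq {s : 𝓞 K ≃ₐ[𝓞 F] 𝓞 K} (h : IsConjugation F K s)
    {a : Ideal (𝓞 F)} (ha : ¬ a.IsPrincipal) (ha0 : a ≠ ⊥) {l : 𝓞 K}
    (hl : a.map (algebraMap (𝓞 F) (𝓞 K)) = Ideal.span {l}) (ε : (𝓞 K)ˣ) :
    ∃ (t : torsion K) (r : (𝓞 F)ˣ), (ε : 𝓞 K) = ((t : (𝓞 K)ˣ) : 𝓞 K) *
      algebraMap (𝓞 F) (𝓞 K) r := by
  have hu : (ε : 𝓞 K) = (ε * (Units.map (s : 𝓞 K →* 𝓞 K) ε)⁻¹ : (𝓞 K)ˣ) * s ε := by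
    have : s ε = (Units.map (s : 𝓞 K →* 𝓞 K) ε : (𝓞 K)ˣ) := rfl
    rw [this, ← Units.val_mul, inv_mul_cancel_right]
  obtain ⟨t, r, hr | hr⟩ := h.exists_eq_torsion_mul ha ha0 hl ε.ne_zero hu
  · have hr' : IsUnit (algebraMap (𝓞 F) (𝓞 K) r) := by
      rw [← Units.inv_mul_eq_iff_eq_mul] at hr
      rw [← hr, ← Units.val_mul]
      exact Units.isUnit _
    have hrr : IsUnit r := IsUnit.of_map (algebraMap (𝓞 F) (𝓞 K)) r hr'
    exact ⟨t, hrr.unit, hr⟩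
  · exfalso
    apply ha
    have : a = Ideal.span {r} := by
      apply eq_span_of_map_eq (K := K)
      rw [← map_conj_map s, hl, Ideal.map_span, Set.image_singleton,
        Ideal.span_singleton_eq_span_singleton]
      refine ⟨ε * (t : (𝓞 K)ˣ)⁻¹, ?_⟩
      rw [Units.val_mul, ← mul_assoc, mul_comm (s l), hr, mul_comm, ← mul_assoc,
        Units.inv_mul, one_mul]
    rw [this]
    exact ⟨r, rfl⟩

/-- A fixed odd power of every unit of `K` is a power of `l / σ l` times a unit of `F`. -/
lemma IsConjugation.exists_odd_pow {s : 𝓞 K ≃ₐ[𝓞 F] 𝓞 K} (h : IsConjugation F K s)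
    {a : Ideal (𝓞 F)} (ha : ¬ a.IsPrincipal) (ha0 : a ≠ ⊥) {l : 𝓞 K}
    (hl : a.map (algebraMap (𝓞 F) (𝓞 K)) = Ideal.span {l}) {ζ : torsion K}
    (hζ : l = ((ζ : (𝓞 K)ˣ) : 𝓞 K) * s l) :
    ∃ n : ℕ, Odd n ∧ ∀ ε : (𝓞 K)ˣ, ∃ (i : ℕ) (r : 𝓞 F),
      (ε : 𝓞 K) ^ n = ((ζ : (𝓞 K)ˣ) : 𝓞 K) ^ i * algebraMap (𝓞 F) (𝓞 K) r := by
  obtain ⟨n, hn, hpow⟩ := (exists_sq_or_eq_mul_sq (h.ne_sq ha hl hζ)).2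
  refine ⟨n, hn, fun ε => ?_⟩
  obtain ⟨t, r, hr⟩ := h.exists_unit_eq ha ha0 hl ε
  obtain ⟨i, hi⟩ := hpow t
  refine ⟨i, (r : 𝓞 F) ^ n, ?_⟩
  have hi' : ((t : (𝓞 K)ˣ) : 𝓞 K) ^ n = ((ζ : (𝓞 K)ˣ) : 𝓞 K) ^ i := by
    have := congrArg (fun x : torsion K => ((x : (𝓞 K)ˣ) : 𝓞 K)) hi
    simpa using this
  rw [hr, mul_pow, hi', map_pow]

/-- If conjugation acts trivially modulo a prime `P`, then `P` is dyadic. -/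
lemma IsConjugation.two_mem {s : 𝓞 K ≃ₐ[𝓞 F] 𝓞 K} (h : IsConjugation F K s)
    (hcap : ¬ Function.Injective (ClassGroup.extendedHom (𝓞 F) (𝓞 K)))
    {P : Ideal (𝓞 K)} [hP : P.IsPrime] (hP0 : P ≠ ⊥) (hPs : ∀ z, z - s z ∈ P) :
    (2 : 𝓞 K) ∈ P := by
  set p := P.comap (algebraMap (𝓞 F) (𝓞 K)) with hp
  have hp0 : p ≠ ⊥ := Ideal.comap_ne_bot_of_integral_mem
    (x := (Submodule.exists_mem_ne_zero_of_ne_bot hP0).choose)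
    (Submodule.exists_mem_ne_zero_of_ne_bot hP0).choose_spec.2
    (Submodule.exists_mem_ne_zero_of_ne_bot hP0).choose_spec.1 (Algebra.IsIntegral.isIntegral _)
  rw [injective_iff_map_eq_one] at hcap
  push Not at hcap
  obtain ⟨C, hC, hC1⟩ := hcap
  obtain ⟨b, rfl, hb⟩ := exists_mk0_eq_sup_eq_top C hp0
  have hbnp : ¬ (b : Ideal (𝓞 F)).IsPrincipal := fun h => hC1 ((ClassGroup.mk0_eq_one_iff b.2).2 h)
  rw [ClassGroup.extendedHom_mk0, ClassGroup.mk0_eq_one_iff] at hC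
  obtain ⟨l, hl⟩ := hC
  change Ideal.map _ _ = Ideal.span {l} at hl
  have hb0 : (b : Ideal (𝓞 F)) ≠ ⊥ := mem_nonZeroDivisors_iff_ne_zero.1 b.2
  obtain ⟨ζ, hζ⟩ := h.exists_torsion hb0 hl
  have hsq := h.ne_sq hbnp hl hζ
  have hlP : l ∉ P := fun hmem => by
    have h1 : (b : Ideal (𝓞 F)) ≤ p := by
      rw [hp, ← Ideal.map_le_iff_le_comap, hl, Ideal.span_singleton_le_iff_mem]
      exact hmem
    rw [sup_eq_right.2 h1] at hb
    exact (Ideal.IsPrime.comap (algebraMap (𝓞 F) (𝓞 K)) (hK := hP)).ne_top hb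
  have hζ1 : ((ζ : (𝓞 K)ˣ) : 𝓞 K) - 1 ∈ P := by
    have h1 : (((ζ : (𝓞 K)ˣ) : 𝓞 K) - 1) * s l ∈ P := by
      have := hPs l
      nth_rewrite 1 [hζ] at this
      rwa [sub_mul, one_mul]
    rcases hP.mem_or_mem h1 with h2 | h2
    · exact h2
    · exact absurd (by simpa using P.add_mem (hPs l) h2) hlP
  -- a nonsquare root of unity has even order
  have heven : Even (orderOf ζ) := by
    rw [← Nat.not_odd_iff_even]
    rintro ⟨k, hk⟩
    apply hsq (ζ ^ (k + 1))
    rw [← pow_mul, show (k + 1) * 2 = (2 * k + 1) + 1 by ring, pow_succ, ← hk, pow_orderOf_eq_one,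
      one_mul]
  obtain ⟨k, hk⟩ := heven
  have hk0 : 0 < k := by
    have := orderOf_pos ζ
    omega
  have hneg : ((ζ : (𝓞 K)ˣ) : 𝓞 K) ^ k = -1 := by
    have h1 : (((ζ : (𝓞 K)ˣ) : 𝓞 K) ^ k) ^ 2 = 1 := by
      have := congrArg (fun x : torsion K => ((x : (𝓞 K)ˣ) : 𝓞 K)) (pow_orderOf_eq_one ζ)
      rw [hk] at this
      rw [← pow_mul, mul_two]
      simpa using this
    refine (sq_eq_one_iff.1 h1).resolve_left fun h2 => ?_
    have h3 : ζ ^ k = 1 := by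
      apply Subtype.ext; apply Units.ext; simpa using h2
    have := orderOf_le_of_pow_eq_one hk0 h3
    omega
  have h2 : ((ζ : (𝓞 K)ˣ) : 𝓞 K) ^ k - 1 ^ k ∈ P :=
    Ideal.mem_of_dvd _ (sub_dvd_pow_sub_pow _ _ k) hζ1
  rw [hneg, one_pow] at h2
  have := P.neg_mem h2
  convert this using 1
  norm_num

end Units

section CapitulationKernel

open NumberField NumberField.Units nonZeroDivisors

variable {F K : Type*} [Field F] [NumberField F] [Field K] [NumberField K] [Algebra F K]

omit [NumberField F] [NumberField K] in
lemma IsConjugation.map_eq_span_conj {s : 𝓞 K ≃ₐ[𝓞 F] 𝓞 K} {a : Ideal (𝓞 F)} {l : 𝓞 K}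
    (hl : a.map (algebraMap (𝓞 F) (𝓞 K)) = Ideal.span {l}) :
    a.map (algebraMap (𝓞 F) (𝓞 K)) = Ideal.span {s l} := by
  rw [← map_conj_map s, hl, Ideal.map_span, Set.image_singleton]

omit [NumberField K] in
lemma IsConjugation.exists_mul_self_eq_span {s : 𝓞 K ≃ₐ[𝓞 F] 𝓞 K} (h : IsConjugation F K s)
    {a : Ideal (𝓞 F)} {l : 𝓞 K} (hl : a.map (algebraMap (𝓞 F) (𝓞 K)) = Ideal.span {l}) :
    ∃ ν : 𝓞 F, l * s l = algebraMap (𝓞 F) (𝓞 K) ν ∧ a * a = Ideal.span {ν} := by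
  obtain ⟨ν, hν⟩ := h.2.1 (l * s l) (by rw [map_mul, h.1, mul_comm])
  refine ⟨ν, hν.symm, eq_span_of_map_eq (K := K) ?_⟩
  rw [Ideal.map_mul, hν, ← Ideal.span_singleton_mul_span_singleton, ← map_eq_span_conj hl, hl]

lemma IsConjugation.eq_one_or_eq_of_extendedHom_eq_one {s : 𝓞 K ≃ₐ[𝓞 F] 𝓞 K}
    (h : IsConjugation F K s) {a : (Ideal (𝓞 F))⁰} (ha : ¬ (a : Ideal (𝓞 F)).IsPrincipal) {l : 𝓞 K}
    (hl : (a : Ideal (𝓞 F)).map (algebraMap (𝓞 F) (𝓞 K)) = Ideal.span {l})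
    {C : ClassGroup (𝓞 F)} (hC : ClassGroup.extendedHom (𝓞 F) (𝓞 K) C = 1) :
    C = 1 ∨ C = ClassGroup.mk0 a := by
  have ha0 : (a : Ideal (𝓞 F)) ≠ ⊥ := mem_nonZeroDivisors_iff_ne_zero.1 a.2
  obtain ⟨b, rfl⟩ := ClassGroup.mk0_surjective C
  have hb0 : (b : Ideal (𝓞 F)) ≠ ⊥ := mem_nonZeroDivisors_iff_ne_zero.1 b.2
  rw [ClassGroup.extendedHom_mk0, ClassGroup.mk0_eq_one_iff] at hC
  obtain ⟨l', hl'⟩ := hC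
  change Ideal.map _ _ = Ideal.span {l'} at hl'
  obtain ⟨ζ, hζ⟩ := h.exists_torsion hb0 hl'
  have hl'0 : l' ≠ 0 := by
    rintro rfl
    rw [Ideal.span_singleton_eq_bot.2 rfl,
      Ideal.map_eq_bot_iff_of_injective (FaithfulSMul.algebraMap_injective (𝓞 F) (𝓞 K))] at hl'
    exact hb0 hl'
  obtain ⟨t, r, hr | hr⟩ := h.exists_eq_torsion_mul ha ha0 hl hl'0 hζ
  · left
    rw [ClassGroup.mk0_eq_one_iff b.2]
    refine ⟨r, eq_span_of_map_eq (K := K) ?_⟩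
    rw [hl', Ideal.span_singleton_eq_span_singleton, hr, mul_comm]
    exact Associated.symm ⟨(t : (𝓞 K)ˣ), rfl⟩
  · right
    have h1 : ClassGroup.mk0 b * ClassGroup.mk0 a = 1 := by
      rw [← map_mul, ClassGroup.mk0_eq_one_iff]
      refine ⟨r, eq_span_of_map_eq (K := K) ?_⟩
      rw [Submonoid.coe_mul, Ideal.map_mul, hl', map_eq_span_conj hl,
        Ideal.span_singleton_mul_span_singleton,
        Ideal.span_singleton_eq_span_singleton, hr, mul_comm]
      exact Associated.symm ⟨(t : (𝓞 K)ˣ), rfl⟩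
    have h2 : ClassGroup.mk0 a * ClassGroup.mk0 a = 1 := by
      obtain ⟨ν, -, hν⟩ := h.exists_mul_self_eq_span hl
      rw [← map_mul, ClassGroup.mk0_eq_one_iff]
      exact ⟨ν, hν⟩
    exact mul_right_cancel (h1.trans h2.symm)

lemma IsConjugation.card_ker_extendedHom {s : 𝓞 K ≃ₐ[𝓞 F] 𝓞 K}
    (h : IsConjugation F K s)
    (hcap : ¬ Function.Injective (ClassGroup.extendedHom (𝓞 F) (𝓞 K))) :
    Nat.card (ClassGroup.extendedHom (𝓞 F) (𝓞 K)).ker = 2 := by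
  rw [injective_iff_map_eq_one] at hcap
  push Not at hcap
  obtain ⟨C, hC, hC1⟩ := hcap
  obtain ⟨a, rfl⟩ := ClassGroup.mk0_surjective C
  have ha : ¬ (a : Ideal (𝓞 F)).IsPrincipal := fun h => hC1 ((ClassGroup.mk0_eq_one_iff a.2).2 h)
  have hC' := hC
  rw [ClassGroup.extendedHom_mk0, ClassGroup.mk0_eq_one_iff] at hC'
  obtain ⟨l, hl⟩ := hC'
  change Ideal.map _ _ = Ideal.span {l} at hl
  rw [Nat.card_eq_two_iff]
  refine ⟨1, ⟨_, hC⟩, fun h => hC1 (congrArg Subtype.val h).symm, ?_⟩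
  ext ⟨x, hx⟩
  simpa [Subtype.ext_iff] using h.eq_one_or_eq_of_extendedHom_eq_one ha hl hx

end CapitulationKernel

section IndexTwoMulOdd

variable {G : Type*} [CommGroup G]

open Classical in
lemma eq_one_or_eq_one_or_mul_eq_one {m : ℕ} (hm : Odd m) (hG : Nat.card G = 2 * m) {x y : G}
    (hx : x ^ 2 = 1) (hy : y ^ 2 = 1) : x = 1 ∨ y = 1 ∨ x * y = 1 := by
  by_cases hx1 : x = 1
  · exact Or.inl hx1
  right
  have hord : orderOf x = 2 := orderOf_eq_prime hx hx1
  have hidx : (Subgroup.zpowers x).index = m := by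
    have := (Subgroup.zpowers x).card_mul_index
    rw [Nat.card_zpowers, hord, hG] at this
    omega
  have hmem := (Subgroup.zpowers x).pow_index_mem y
  obtain ⟨k, rfl⟩ := hm
  rw [hidx, pow_succ, pow_mul, hy, one_pow, one_mul] at hmem
  have hfin : IsOfFinOrder x := isOfFinOrder_iff_pow_eq_one.2 ⟨2, by norm_num, hx⟩
  rw [← hfin.mem_powers_iff_mem_zpowers, hfin.mem_powers_iff_mem_range_orderOf, hord] at hmem
  simp only [Finset.mem_image, Finset.mem_range] at hmem
  obtain ⟨i, hi, rfl⟩ := hmem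
  interval_cases i
  · exact Or.inl (pow_zero x)
  · right; rw [pow_one, ← sq, hx]

lemma Subgroup.mem_or_mem_or_mul_mem {m : ℕ} (hm : Odd m) (H : Subgroup G) (hH : H.index = 2 * m)
    {x y : G} (hx : x ^ 2 ∈ H) (hy : y ^ 2 ∈ H) : x ∈ H ∨ y ∈ H ∨ x * y ∈ H := by
  simp only [← QuotientGroup.eq_one_iff, QuotientGroup.mk_mul, QuotientGroup.mk_pow] at hx hy ⊢
  exact eq_one_or_eq_one_or_mul_eq_one hm (H.index_eq_card.symm.trans hH) hx hy

end IndexTwoMulOdd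

section Ramified

open NumberField NumberField.Units nonZeroDivisors

variable {F K : Type*} [Field F] [NumberField F] [Field K] [NumberField K] [Algebra F K]

lemma absNorm_le_absNorm {P : Ideal (𝓞 K)} (hP0 : P ≠ ⊥) {p : Ideal (𝓞 F)}
    (hp : p = P.comap (algebraMap (𝓞 F) (𝓞 K))) : Ideal.absNorm p ≤ Ideal.absNorm P := by
  subst hp
  rw [Ideal.absNorm_apply, Ideal.absNorm_apply, Submodule.cardQuot_apply, Submodule.cardQuot_apply]
  have := Ideal.finiteQuotientOfFreeOfNeBot P hP0
  exact Nat.card_le_card_of_injective _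
    (Ideal.quotientMap_injective (I := P) (f := algebraMap (𝓞 F) (𝓞 K)))

omit [NumberField K] in
lemma eq_comap_of_map_le {p : Ideal (𝓞 F)} [hp : p.IsPrime] (hp0 : p ≠ ⊥) {Q : Ideal (𝓞 K)}
    [hQ : Q.IsPrime] (h : p.map (algebraMap (𝓞 F) (𝓞 K)) ≤ Q) :
    p = Q.comap (algebraMap (𝓞 F) (𝓞 K)) :=
  (hp.isMaximal hp0).eq_of_le (hQ.comap _).ne_top (Ideal.map_le_iff_le_comap.1 h)

lemma map_eq_sq_of_le (h2 : Module.finrank F K = 2) {p : Ideal (𝓞 F)} [hp : p.IsPrime]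
    (hp0 : p ≠ ⊥) {Q : Ideal (𝓞 K)} [hQ : Q.IsPrime]
    (h : p.map (algebraMap (𝓞 F) (𝓞 K)) ≤ Q ^ 2) :
    p.map (algebraMap (𝓞 F) (𝓞 K)) = Q ^ 2 ∧ Ideal.absNorm Q = Ideal.absNorm p := by
  have hmap0 : p.map (algebraMap (𝓞 F) (𝓞 K)) ≠ ⊥ := fun h =>
    hp0 ((Ideal.map_eq_bot_iff_of_injective (FaithfulSMul.algebraMap_injective (𝓞 F) (𝓞 K))).1 h)
  have hQ0 : Q ≠ ⊥ := by
    rintro rfl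
    exact hmap0 (le_bot_iff.1 (h.trans (by rw [sq]; exact Ideal.mul_le_left)))
  obtain ⟨J, hJ⟩ := Ideal.dvd_iff_le.2 h
  have hle : Ideal.absNorm p ≤ Ideal.absNorm Q :=
    absNorm_le_absNorm hQ0 (eq_comap_of_map_le hp0 (h.trans (Ideal.pow_le_self two_ne_zero)))
  have hn : Ideal.absNorm p ^ 2 = Ideal.absNorm Q ^ 2 * Ideal.absNorm J := by
    have := congrArg Ideal.absNorm hJ
    rwa [map_mul, map_pow, Ideal.absNorm_algebraMap, finrank_ringOfIntegers h2] at this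
  have hp1 : 0 < Ideal.absNorm p := Nat.pos_of_ne_zero fun h => hp0 (Ideal.absNorm_eq_zero_iff.1 h)
  have hJ0 : Ideal.absNorm J ≠ 0 := fun h => by
    rw [h, mul_zero] at hn
    exact (pow_pos hp1 2).ne' hn
  have hJ1 : Ideal.absNorm J = 1 := by
    by_contra hne
    have h2 : 2 ≤ Ideal.absNorm J := by omega
    have := Nat.pow_le_pow_left hle 2
    nlinarith [pow_pos hp1 2]
  rw [hJ1, mul_one] at hn
  refine ⟨?_, (Nat.pow_left_injective (n := 2) (by norm_num) hn).symm⟩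
  rw [hJ, Ideal.absNorm_eq_one_iff.1 hJ1, Ideal.mul_top]

/-- An ambiguous ideal whose class comes from `F` becomes an ideal of `F` after multiplication
by an ideal of `F`. -/
lemma IsConjugation.exists_mul_map_eq_map {s : 𝓞 K ≃ₐ[𝓞 F] 𝓞 K} (h : IsConjugation F K s)
    {a : Ideal (𝓞 F)} (ha : ¬ a.IsPrincipal) (ha0 : a ≠ ⊥) {l : 𝓞 K}
    (hl : a.map (algebraMap (𝓞 F) (𝓞 K)) = Ideal.span {l})
    {A : (Ideal (𝓞 K))⁰} (hA : (A : Ideal (𝓞 K)).map s = A)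
    (hrange : ClassGroup.mk0 A ∈ (ClassGroup.extendedHom (𝓞 F) (𝓞 K)).range) :
    ∃ e₁ e₂ : Ideal (𝓞 F), e₁ ≠ ⊥ ∧ (A : Ideal (𝓞 K)) * e₁.map (algebraMap (𝓞 F) (𝓞 K)) =
      e₂.map (algebraMap (𝓞 F) (𝓞 K)) := by
  obtain ⟨C, hC⟩ := hrange
  obtain ⟨b, rfl⟩ := ClassGroup.mk0_surjective C
  rw [ClassGroup.extendedHom_mk0, eq_comm, ClassGroup.mk0_eq_mk0_iff] at hC
  obtain ⟨x, y, hx, hy, hxy⟩ := hC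
  change Ideal.span {x} * (A : Ideal (𝓞 K)) =
    Ideal.span {y} * (b : Ideal (𝓞 F)).map (algebraMap (𝓞 F) (𝓞 K)) at hxy
  have hxy' : Ideal.span {s x} * (A : Ideal (𝓞 K)) =
      Ideal.span {s y} * (b : Ideal (𝓞 F)).map (algebraMap (𝓞 F) (𝓞 K)) := by
    have := congrArg (Ideal.map s) hxy
    rwa [Ideal.map_mul, Ideal.map_mul, hA, map_conj_map, Ideal.map_span, Ideal.map_span,
      Set.image_singleton, Set.image_singleton] at this
  have hb0 : (b : Ideal (𝓞 F)) ≠ ⊥ := mem_nonZeroDivisors_iff_ne_zero.1 b.2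
  have hbm0 : (b : Ideal (𝓞 F)).map (algebraMap (𝓞 F) (𝓞 K)) ≠ 0 := fun h =>
    hb0 ((Ideal.map_eq_bot_iff_of_injective (FaithfulSMul.algebraMap_injective (𝓞 F) (𝓞 K))).1 h)
  have hA0 : (A : Ideal (𝓞 K)) ≠ 0 := mem_nonZeroDivisors_iff_ne_zero.1 A.2
  have hsx : s x ≠ 0 := by simpa using hx
  have hsp : Ideal.span {y * s x} = Ideal.span {s y * x} := by
    simp only [← Ideal.span_singleton_mul_span_singleton]
    apply mul_right_cancel₀ (mul_ne_zero hA0 hbm0)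
    calc _ = (Ideal.span {y} * (b : Ideal (𝓞 F)).map (algebraMap (𝓞 F) (𝓞 K))) *
          (Ideal.span {s x} * (A : Ideal (𝓞 K))) := by ring
      _ = (Ideal.span {s y} * (b : Ideal (𝓞 F)).map (algebraMap (𝓞 F) (𝓞 K))) *
          (Ideal.span {x} * (A : Ideal (𝓞 K))) := by rw [← hxy, hxy']; ring
      _ = _ := by ring
  obtain ⟨u, hu⟩ := Ideal.span_singleton_eq_span_singleton.1 hsp.symm
  have hβ : y * s x = u * s (y * s x) := by
    rw [map_mul, h.1, mul_comm (u : 𝓞 K)]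
    exact hu.symm
  obtain ⟨ν, hν⟩ := h.2.1 (x * s x) (by rw [map_mul, h.1, mul_comm])
  have hν0 : ν ≠ 0 := by
    rintro rfl
    rw [map_zero] at hν
    exact mul_ne_zero hx hsx hν.symm
  have key : (A : Ideal (𝓞 K)) * (Ideal.span {ν}).map (algebraMap (𝓞 F) (𝓞 K)) =
      Ideal.span {y * s x} * (b : Ideal (𝓞 F)).map (algebraMap (𝓞 F) (𝓞 K)) := by
    rw [Ideal.map_span, Set.image_singleton, hν]
    simp only [← Ideal.span_singleton_mul_span_singleton]
    calc _ = Ideal.span {x} * (A : Ideal (𝓞 K)) * Ideal.span {s x} := by ring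
      _ = _ := by rw [hxy]; ring
  obtain ⟨t, r, hr | hr⟩ := h.exists_eq_torsion_mul ha ha0 hl (mul_ne_zero hy hsx) hβ
  · refine ⟨Ideal.span {ν}, Ideal.span {r} * b, by simpa using hν0, ?_⟩
    rw [key, Ideal.map_mul, Ideal.map_span, Set.image_singleton]
    congr 1
    rw [Ideal.span_singleton_eq_span_singleton, hr, mul_comm]
    exact Associated.symm ⟨(t : (𝓞 K)ˣ), rfl⟩
  · refine ⟨Ideal.span {ν} * a, Ideal.span {r} * b, mul_ne_zero (by simpa using hν0) ha0, ?_⟩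
    rw [Ideal.map_mul, ← mul_assoc, key, Ideal.map_mul, Ideal.map_span, Set.image_singleton,
      map_eq_span_conj (s := s) hl, mul_right_comm, Ideal.span_singleton_mul_span_singleton]
    congr 1
    rw [Ideal.span_singleton_eq_span_singleton, hr, mul_comm]
    exact Associated.symm ⟨(t : (𝓞 K)ˣ), rfl⟩

omit [NumberField K] in
lemma isUnit_of_squarefree_of_map_eq_sq {d : Ideal (𝓞 F)} (hd : Squarefree d) {A : Ideal (𝓞 K)}
    (hA : d.map (algebraMap (𝓞 F) (𝓞 K)) = A ^ 2) {e₁ e₂ : Ideal (𝓞 F)} (he : e₁ ≠ ⊥)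
    (h : A * e₁.map (algebraMap (𝓞 F) (𝓞 K)) = e₂.map (algebraMap (𝓞 F) (𝓞 K))) : IsUnit d := by
  have h1 : d * e₁ ^ 2 = e₂ ^ 2 := by
    apply map_algebraMap_injective (K := K)
    rw [Ideal.map_mul, Ideal.map_pow, Ideal.map_pow, hA, ← h, mul_pow]
  obtain ⟨c, rfl⟩ : e₁ ∣ e₂ := by
    rw [← UniqueFactorizationMonoid.pow_dvd_pow_iff_dvd (n := 2) two_ne_zero]
    exact Dvd.intro_left d h1
  rw [mul_pow, mul_comm] at h1
  have h2 : d = c ^ 2 := mul_left_cancel₀ (pow_ne_zero 2 he) h1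
  rw [h2]
  exact (hd c (by rw [h2, sq])).pow 2

/-- If the relative class number is odd and there is capitulation, at most one prime ramifies. -/
lemma IsConjugation.eq_of_ramified (h2 : Module.finrank F K = 2) {s : 𝓞 K ≃ₐ[𝓞 F] 𝓞 K}
    (h : IsConjugation F K s) (hcap : ¬ Function.Injective (ClassGroup.extendedHom (𝓞 F) (𝓞 K)))
    {m : ℕ} (hm : Odd m) (hcard : Nat.card (ClassGroup (𝓞 K)) = Nat.card (ClassGroup (𝓞 F)) * m)
    {p₁ p₂ : Ideal (𝓞 F)} (hp₁ : p₁.IsPrime) (hp₁0 : p₁ ≠ ⊥) (hp₂ : p₂.IsPrime) (hp₂0 : p₂ ≠ ⊥)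
    {Q₁ Q₂ : Ideal (𝓞 K)} (hQ₁ : Q₁.IsPrime) (hQ₂ : Q₂.IsPrime)
    (h₁ : p₁.map (algebraMap (𝓞 F) (𝓞 K)) ≤ Q₁ ^ 2)
    (h₂ : p₂.map (algebraMap (𝓞 F) (𝓞 K)) ≤ Q₂ ^ 2) : p₁ = p₂ := by
  by_contra hne
  replace h₁ := (map_eq_sq_of_le h2 hp₁0 h₁).1
  replace h₂ := (map_eq_sq_of_le h2 hp₂0 h₂).1
  have hQ0 : ∀ {p : Ideal (𝓞 F)} {Q : Ideal (𝓞 K)}, p ≠ ⊥ →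
      p.map (algebraMap (𝓞 F) (𝓞 K)) = Q ^ 2 → Q ≠ ⊥ := by
    rintro p Q hp hpQ rfl
    rw [← Ideal.zero_eq_bot, zero_pow two_ne_zero, Ideal.zero_eq_bot,
      Ideal.map_eq_bot_iff_of_injective (FaithfulSMul.algebraMap_injective (𝓞 F) (𝓞 K))] at hpQ
    exact hp hpQ
  have hsQ : ∀ {p : Ideal (𝓞 F)} {Q : Ideal (𝓞 K)},
      p.map (algebraMap (𝓞 F) (𝓞 K)) = Q ^ 2 → Q.map s = Q := by
    intro p Q hpQ
    apply pow_left_injective two_ne_zero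
    change (Q.map s) ^ 2 = Q ^ 2
    rw [← Ideal.map_pow, ← hpQ, map_conj_map]
  have hrange : ∀ {p : (Ideal (𝓞 F))⁰} {Q : (Ideal (𝓞 K))⁰},
      (p : Ideal (𝓞 F)).map (algebraMap (𝓞 F) (𝓞 K)) = (Q : Ideal (𝓞 K)) ^ 2 →
      ClassGroup.mk0 Q ^ 2 ∈ (ClassGroup.extendedHom (𝓞 F) (𝓞 K)).range := by
    intro p Q hpQ
    refine ⟨ClassGroup.mk0 p, ?_⟩
    rw [ClassGroup.extendedHom_mk0, ← map_pow]
    congr 1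
    exact Subtype.ext hpQ
  have hindex : (ClassGroup.extendedHom (𝓞 F) (𝓞 K)).range.index = 2 * m := by
    have e1 := (ClassGroup.extendedHom (𝓞 F) (𝓞 K)).range.card_mul_index
    have e2 := (ClassGroup.extendedHom (𝓞 F) (𝓞 K)).ker.card_mul_index
    rw [Subgroup.index_ker, h.card_ker_extendedHom hcap] at e2
    rw [hcard, ← e2, mul_comm 2, mul_assoc] at e1
    refine Nat.eq_of_mul_eq_mul_left ?_ e1
    exact Nat.card_pos
  obtain ⟨C, hC, hC1⟩ : ∃ C, ClassGroup.extendedHom (𝓞 F) (𝓞 K) C = 1 ∧ C ≠ 1 := by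
    rw [injective_iff_map_eq_one] at hcap
    push Not at hcap
    exact hcap
  obtain ⟨a, rfl⟩ := ClassGroup.mk0_surjective C
  have ha : ¬ (a : Ideal (𝓞 F)).IsPrincipal := fun h => hC1 ((ClassGroup.mk0_eq_one_iff a.2).2 h)
  rw [ClassGroup.extendedHom_mk0, ClassGroup.mk0_eq_one_iff] at hC
  obtain ⟨l, hl⟩ := hC
  change Ideal.map _ _ = Ideal.span {l} at hl
  have ha0 : (a : Ideal (𝓞 F)) ≠ ⊥ := mem_nonZeroDivisors_iff_ne_zero.1 a.2
  have hnu : ∀ {p : Ideal (𝓞 F)}, p.IsPrime → ¬ IsUnit p := fun hp hu =>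
    hp.ne_top (Ideal.isUnit_iff.1 hu)
  have key : ∀ {d : Ideal (𝓞 F)} (A : (Ideal (𝓞 K))⁰), Squarefree d →
      d.map (algebraMap (𝓞 F) (𝓞 K)) = (A : Ideal (𝓞 K)) ^ 2 →
      ClassGroup.mk0 A ∈ (ClassGroup.extendedHom (𝓞 F) (𝓞 K)).range → IsUnit d := by
    intro d A hd hdA hA
    obtain ⟨e₁, e₂, he, hee⟩ := h.exists_mul_map_eq_map ha ha0 hl (hsQ hdA) hA
    exact isUnit_of_squarefree_of_map_eq_sq hd hdA he hee
  have hpr : ∀ {p : Ideal (𝓞 F)}, p.IsPrime → p ≠ ⊥ → Prime p := fun hp hp0 =>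
    Ideal.prime_of_isPrime hp0 hp
  have hsf := fun {p : Ideal (𝓞 F)} (hp : p.IsPrime) (hp0 : p ≠ ⊥) => (hpr hp hp0).squarefree
  let p₁' : (Ideal (𝓞 F))⁰ := ⟨p₁, mem_nonZeroDivisors_iff_ne_zero.2 hp₁0⟩
  let p₂' : (Ideal (𝓞 F))⁰ := ⟨p₂, mem_nonZeroDivisors_iff_ne_zero.2 hp₂0⟩
  let Q₁' : (Ideal (𝓞 K))⁰ := ⟨Q₁, mem_nonZeroDivisors_iff_ne_zero.2 (hQ0 hp₁0 h₁)⟩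
  let Q₂' : (Ideal (𝓞 K))⁰ := ⟨Q₂, mem_nonZeroDivisors_iff_ne_zero.2 (hQ0 hp₂0 h₂)⟩
  rcases Subgroup.mem_or_mem_or_mul_mem hm _ hindex (hrange (p := p₁') (Q := Q₁') h₁)
    (hrange (p := p₂') (Q := Q₂') h₂) with h' | h' | h'
  · exact hnu hp₁ (key Q₁' (hsf hp₁ hp₁0) h₁ h')
  · exact hnu hp₂ (key Q₂' (hsf hp₂ hp₂0) h₂ h')
  · rw [← map_mul] at h'
    refine hnu hp₁ (isUnit_of_mul_isUnit_left (key (d := p₁ * p₂) (Q₁' * Q₂') ?_ ?_ h'))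
    · rw [squarefree_mul_iff]
      refine ⟨?_, hsf hp₁ hp₁0, hsf hp₂ hp₂0⟩
      rw [(hpr hp₁ hp₁0).irreducible.isRelPrime_iff_not_dvd]
      intro hdvd
      exact hne ((hp₂.isMaximal hp₂0).eq_of_le hp₁.ne_top (Ideal.dvd_iff_le.1 hdvd)).symm
    · rw [Ideal.map_mul, h₁, h₂, Submonoid.coe_mul, mul_pow]

end Ramified

section OrdersInQuadraticExtensions

open NumberField NumberField.Units nonZeroDivisors

variable {F K : Type*} [Field F] [NumberField F] [Field K] [NumberField K] [Algebra F K]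

variable {B : Subalgebra (𝓞 F) (𝓞 K)} {n N : ℕ}

omit [NumberField K] in
lemma exists_sub_mem_map_sq (hn : n ≠ 0)
    (hB : ∀ y y' w : 𝓞 K, y * y' = 1 + n * w → y ^ N ∈ B) {p : Ideal (𝓞 F)} [hp : p.IsPrime]
    (hp0 : p ≠ ⊥) {y y' : 𝓞 K} (hy : y * y' - 1 ∈ p.map (algebraMap (𝓞 F) (𝓞 K))) :
    ∃ b ∈ B, y ^ N - b ∈ (p ^ 2).map (algebraMap (𝓞 F) (𝓞 K)) := by
  have hpm := hp.isMaximal hp0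
  have hspan0 : Ideal.span {(n : 𝓞 F)} ≠ 0 := by simpa using hn
  have hpp : Prime p := Ideal.prime_of_isPrime hp0 hp
  obtain ⟨q, hq, hnq⟩ := (FiniteMultiplicity.of_prime_left hpp hspan0).exists_eq_pow_mul_and_not_dvd
  have hpq : p ⊔ q = ⊤ := by
    by_contra hne
    exact hnq (Ideal.dvd_iff_le.2 (sup_eq_left.1 (hpm.eq_of_le hne le_sup_left).symm))
  have hpq2 : p ^ 2 ⊔ q = ⊤ := Ideal.pow_sup_eq_top hpq
  obtain ⟨i, hi, e, he, hie⟩ := Submodule.mem_sup.1 ((Ideal.eq_top_iff_one _).1 hpq2)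
  set j := algebraMap (𝓞 F) (𝓞 K)
  have hie' : j i + j e = 1 := by rw [← map_add, hie, map_one]
  have hi2 : j i ∈ (p ^ 2).map j := Ideal.mem_map_of_mem _ hi
  have hi1 : j i ∈ p.map j := Ideal.mem_map_of_mem _ (Ideal.pow_le_self two_ne_zero hi)
  have he1 : j e ∈ q.map j := Ideal.mem_map_of_mem _ he
  set z := j e * y + j i with hz
  have hzy : z - y ∈ (p ^ 2).map j := by
    have : z - y = j i * (1 - y) := by rw [hz]; linear_combination y * hie'
    rw [this]
    exact Ideal.mul_mem_right _ _ hi2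
  have hzp : Ideal.span {z} ⊔ p.map j = ⊤ := by
    rw [Ideal.eq_top_iff_one]
    have h1 : z * y' - 1 ∈ p.map j := by
      have : z * y' - 1 = (y * y' - 1) + (z - y) * y' := by ring
      rw [this]
      exact Ideal.add_mem _ hy (Ideal.mul_mem_right _ _
        (Ideal.map_mono (Ideal.pow_le_self two_ne_zero) hzy))
    have : (1 : 𝓞 K) = z * y' + -(z * y' - 1) := by ring
    rw [this]
    exact Submodule.add_mem_sup (Ideal.mul_mem_right _ _ (Ideal.mem_span_singleton_self z))
      (Submodule.neg_mem _ h1)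
  have hzq : Ideal.span {z} ⊔ q.map j = ⊤ := by
    rw [Ideal.eq_top_iff_one]
    have : (1 : 𝓞 K) = z + j e * (1 - y) := by rw [hz]; linear_combination -hie'
    rw [this]
    exact Submodule.add_mem_sup (Ideal.mem_span_singleton_self z) (Ideal.mul_mem_right _ _ he1)
  have hzn : Ideal.span {z} ⊔ Ideal.span {(n : 𝓞 K)} = ⊤ := by
    have : Ideal.span {(n : 𝓞 K)} = (Ideal.span {(n : 𝓞 F)}).map j := by
      rw [Ideal.map_span, Set.image_singleton, map_natCast]
    rw [this, hq, Ideal.map_mul, Ideal.map_pow,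
      Ideal.sup_mul_eq_of_coprime_left (Ideal.sup_pow_eq_top hzp), hzq]
  obtain ⟨u, hu, v, hv, huv⟩ := Submodule.mem_sup.1 ((Ideal.eq_top_iff_one _).1 hzn)
  obtain ⟨c, rfl⟩ := Ideal.mem_span_singleton'.1 hu
  obtain ⟨w, rfl⟩ := Ideal.mem_span_singleton'.1 hv
  refine ⟨z ^ N, hB z c (-w) (by linear_combination huv), ?_⟩
  rw [← neg_mem_iff, neg_sub]
  exact Ideal.mem_of_dvd _ (sub_dvd_pow_sub_pow z y N) hzy

lemma IsConjugation.exists_sub_mem_map_of_two_notMem {s : 𝓞 K ≃ₐ[𝓞 F] 𝓞 K}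
    (h : IsConjugation F K s) (hcap : ¬ Function.Injective (ClassGroup.extendedHom (𝓞 F) (𝓞 K)))
    (hn : n ≠ 0) (hN : Odd N)
    (hB : ∀ y y' w : 𝓞 K, y * y' = 1 + n * w → y ^ N ∈ B) {p : Ideal (𝓞 F)} [hp : p.IsPrime]
    (hp0 : p ≠ ⊥) (h2 : (2 : 𝓞 F) ∉ p) (x : 𝓞 K) :
    ∃ b ∈ B, x - b ∈ p.map (algebraMap (𝓞 F) (𝓞 K)) := by
  have hpm := hp.isMaximal hp0
  have hmap0 : p.map (algebraMap (𝓞 F) (𝓞 K)) ≠ ⊥ := fun h =>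
    hp0 ((Ideal.map_eq_bot_iff_of_injective (FaithfulSMul.algebraMap_injective (𝓞 F) (𝓞 K))).1 h)
  have hmaptop : p.map (algebraMap (𝓞 F) (𝓞 K)) ≠ ⊤ := fun h => hp.ne_top (by
    rw [← Ideal.comap_map_eq_self_of_faithfullyFlat (B := 𝓞 K) p, h, Ideal.comap_top])
  obtain ⟨P, hP, hPp⟩ := Ideal.exists_le_maximal _ hmaptop
  have hP0 : P ≠ ⊥ := fun h => hmap0 (le_bot_iff.1 (h ▸ hPp))
  have hPprime := hP.isPrime
  have hcomap := eq_comap_of_map_le hp0 hPp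
  have h2P : (2 : 𝓞 K) ∉ P := fun hmem => h2 (by
    rw [hcomap, Ideal.mem_comap, map_ofNat]; exact hmem)
  obtain ⟨z, hz⟩ : ∃ z, z - s z ∉ P := by
    by_contra! hall
    exact h2P (h.two_mem hcap hP0 hall)
  set y := z - s z with hy
  have hsy : s y = -y := by rw [hy, map_sub, h.1]; ring
  obtain ⟨ρ, hρ⟩ := h.2.1 (y * y) (by rw [map_mul, hsy]; ring)
  have hρp : ρ ∉ p := fun hmem => by
    rw [hcomap, Ideal.mem_comap, hρ] at hmem
    exact hz ((hPprime.mem_or_mem hmem).elim id id)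
  obtain ⟨ρ', i, hi, hρi⟩ := hpm.exists_inv hρp
  obtain ⟨k, rfl⟩ := hN
  obtain ⟨δ, i', hi', hδi⟩ := hpm.exists_inv (x := 2 * ρ ^ (k + 1))
    (hp.mul_notMem h2 fun hmem => hρp (hp.mem_of_pow_mem _ hmem))
  obtain ⟨α, hα⟩ := h.2.1 (x + s x) (by rw [map_add, h.1, add_comm])
  obtain ⟨β, hβ⟩ := h.2.1 ((x - s x) * y) (by rw [map_mul, map_sub, h.1, hsy]; ring)
  set j := algebraMap (𝓞 F) (𝓞 K) with hj
  obtain ⟨b, hb, hyb⟩ := exists_sub_mem_map_sq (y := y) (y' := y * j ρ') hn hB hp0 (by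
    have : y * (y * j ρ') - 1 = -j i := by
      have e := congrArg j hρi
      rw [map_add, map_mul, map_one, hρ] at e
      linear_combination e
    rw [this]
    exact neg_mem (Ideal.mem_map_of_mem _ hi))
  refine ⟨j δ * (j (α * ρ ^ (k + 1)) + j β * b), B.mul_mem (B.algebraMap_mem _)
    (B.add_mem (B.algebraMap_mem _) (B.mul_mem (B.algebraMap_mem _) hb)), ?_⟩
  have e1 : j δ * (2 * (y * y) ^ (k + 1)) + j i' = 1 := by
    have e := congrArg j hδi
    rwa [map_add, map_mul, map_mul, map_pow, map_one, hρ, map_ofNat] at e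
  have : x - j δ * (j (α * ρ ^ (k + 1)) + j β * b) =
      j i' * x + j δ * j β * (y ^ (2 * k + 1) - b) := by
    clear_value y
    rw [map_mul, map_pow, hα, hβ, hρ, ← sq, ← pow_mul]
    rw [← sq, ← pow_mul] at e1
    linear_combination (-x) * e1
  rw [this]
  exact Ideal.add_mem _ (Ideal.mul_mem_right _ _ (Ideal.mem_map_of_mem _ hi'))
    (Ideal.mul_mem_left _ _ (Ideal.map_mono (Ideal.pow_le_self two_ne_zero) hyb))

omit [NumberField K] in
lemma exists_sub_mem_of_sq_mem (hn : n ≠ 0) (hN : Odd N)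
    (hB : ∀ y y' w : 𝓞 K, y * y' = 1 + n * w → y ^ N ∈ B) {p : Ideal (𝓞 F)} [hp : p.IsPrime]
    (hp0 : p ≠ ⊥) {I : Ideal (𝓞 K)} (hI : (p ^ 2).map (algebraMap (𝓞 F) (𝓞 K)) ≤ I)
    (hIp : I ≤ p.map (algebraMap (𝓞 F) (𝓞 K))) {z : 𝓞 K} (hz : z * z ∈ I) (h2z : 2 * z ∈ I) :
    ∃ b ∈ B, z - b ∈ I := by
  obtain ⟨b, hb, hyb⟩ := exists_sub_mem_map_sq (y := 1 + z) (y' := 1 - z) hn hB hp0 (by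
    have : (1 + z) * (1 - z) - 1 = -(z * z) := by ring
    rw [this]
    exact neg_mem (hIp hz))
  refine ⟨b - 1, B.sub_mem hb B.one_mem, ?_⟩
  obtain ⟨k, rfl⟩ := hN
  have h1 : (1 + z) ^ (2 * k + 1) - (1 + z) ∈ I := by
    have h2 : (1 + z) ^ 2 - 1 ∈ I := by
      have : (1 + z) ^ 2 - 1 = 2 * z + z * z := by ring
      rw [this]
      exact I.add_mem h2z hz
    have h3 : ((1 + z) ^ 2) ^ k - 1 ^ k ∈ I := Ideal.mem_of_dvd _ (sub_dvd_pow_sub_pow _ _ k) h2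
    have : (1 + z) ^ (2 * k + 1) - (1 + z) = (((1 + z) ^ 2) ^ k - 1 ^ k) * (1 + z) := by
      rw [one_pow, ← pow_mul]; ring
    rw [this]
    exact Ideal.mul_mem_right _ _ h3
  have : z - (b - 1) = ((1 + z) ^ (2 * k + 1) - b) - ((1 + z) ^ (2 * k + 1) - (1 + z)) := by ring
  rw [this]
  exact I.sub_mem (hI hyb) h1

/-- The residue field at a totally ramified prime does not grow. -/
lemma exists_sub_mem_of_absNorm_eq {p : Ideal (𝓞 F)} {Q : Ideal (𝓞 K)}
    (hQ0 : Q ≠ ⊥) (hpQ : p = Q.comap (algebraMap (𝓞 F) (𝓞 K)))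
    (hnorm : Ideal.absNorm Q = Ideal.absNorm p) (x : 𝓞 K) :
    ∃ r, x - algebraMap (𝓞 F) (𝓞 K) r ∈ Q := by
  subst hpQ
  rw [Ideal.absNorm_apply, Ideal.absNorm_apply, Submodule.cardQuot_apply,
    Submodule.cardQuot_apply] at hnorm
  have := Ideal.finiteQuotientOfFreeOfNeBot Q hQ0
  have hinj := Ideal.quotientMap_injective (I := Q) (f := algebraMap (𝓞 F) (𝓞 K))
  have : Finite (𝓞 F ⧸ Q.comap (algebraMap (𝓞 F) (𝓞 K))) := Finite.of_injective _ hinj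
  obtain ⟨r, hr⟩ := (hinj.bijective_of_nat_card_le hnorm.le).2 (Ideal.Quotient.mk Q x)
  obtain ⟨r, rfl⟩ := Ideal.Quotient.mk_surjective r
  rw [Ideal.quotientMap_mk, eq_comm, Ideal.Quotient.mk_eq_mk_iff_sub_mem] at hr
  exact ⟨r, hr⟩

lemma exists_sub_mem_map_of_ramified (hK : Module.finrank F K = 2) (hn : n ≠ 0) (hN : Odd N)
    (hB : ∀ y y' w : 𝓞 K, y * y' = 1 + n * w → y ^ N ∈ B) {p : Ideal (𝓞 F)} [hp : p.IsPrime]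
    (hp0 : p ≠ ⊥) (h2 : (2 : 𝓞 F) ∈ p) {Q : Ideal (𝓞 K)} [hQ : Q.IsPrime]
    (hQp : p.map (algebraMap (𝓞 F) (𝓞 K)) ≤ Q ^ 2) (x : 𝓞 K) :
    ∃ b ∈ B, x - b ∈ p.map (algebraMap (𝓞 F) (𝓞 K)) := by
  have hmap0 : p.map (algebraMap (𝓞 F) (𝓞 K)) ≠ ⊥ := fun h =>
    hp0 ((Ideal.map_eq_bot_iff_of_injective (FaithfulSMul.algebraMap_injective (𝓞 F) (𝓞 K))).1 h)
  have hle := hQp.trans (Ideal.pow_le_self two_ne_zero)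
  have hQ0 : Q ≠ ⊥ := fun h => hmap0 (le_bot_iff.1 (h ▸ hle))
  obtain ⟨hmap, hnorm⟩ := map_eq_sq_of_le hK hp0 hQp
  obtain ⟨r, hr⟩ := exists_sub_mem_of_absNorm_eq hQ0 (eq_comap_of_map_le hp0 hle) hnorm x
  obtain ⟨b, hb, hzb⟩ := exists_sub_mem_of_sq_mem hn hN hB hp0
    (Ideal.map_mono (Ideal.pow_le_self two_ne_zero)) le_rfl
    (z := x - algebraMap (𝓞 F) (𝓞 K) r)
    (by rw [hmap, sq]; exact Ideal.mul_mem_mul hr hr)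
    (Ideal.mul_mem_right _ _ (by
      rw [← map_ofNat (algebraMap (𝓞 F) (𝓞 K)) 2]; exact Ideal.mem_map_of_mem _ h2))
  refine ⟨algebraMap (𝓞 F) (𝓞 K) r + b, B.add_mem (B.algebraMap_mem _) hb, ?_⟩
  rwa [← sub_sub]

/-- An order all of whose elements `y` invertible modulo a conductor have a fixed odd power in `B`
contains `fO_K`, provided every dyadic prime not dividing `f` is ramified. -/
lemma IsConjugation.map_le_of_forall_pow_mem (hK : Module.finrank F K = 2)
    {s : 𝓞 K ≃ₐ[𝓞 F] 𝓞 K}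
    (h : IsConjugation F K s) (hcap : ¬ Function.Injective (ClassGroup.extendedHom (𝓞 F) (𝓞 K)))
    (hn : n ≠ 0) (hnB : ∀ x : 𝓞 K, n * x ∈ B) (hN : Odd N)
    (hB : ∀ y y' w : 𝓞 K, y * y' = 1 + n * w → y ^ N ∈ B) {f : Ideal (𝓞 F)}
    (hf : ∀ p : Ideal (𝓞 F), p.IsPrime → p ≠ ⊥ → 2 ∈ p → p ∣ f ∨
      ∃ Q : Ideal (𝓞 K), Q.IsPrime ∧ p.map (algebraMap (𝓞 F) (𝓞 K)) ≤ Q ^ 2)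
    {x : 𝓞 K} (hx : x ∈ f.map (algebraMap (𝓞 F) (𝓞 K))) : x ∈ B := by
  set V : Submodule (𝓞 F) (𝓞 K) := f • ⊤ with hV
  have aux : ∀ {p g : Ideal (𝓞 F)} {W : Submodule (𝓞 F) (𝓞 K)},
      W ≤ Subalgebra.toSubmodule B ⊔ p • W →
      g • W ≤ Subalgebra.toSubmodule B ⊔ p • (g • W) := by
    intro p g W hW
    calc g • W ≤ g • (Subalgebra.toSubmodule B ⊔ p • W) := Submodule.smul_mono le_rfl hW
      _ = g • Subalgebra.toSubmodule B ⊔ p • (g • W) := by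
        rw [Submodule.smul_sup, ← mul_smul, ← mul_smul, mul_comm]
      _ ≤ _ := sup_le_sup_right Submodule.smul_le_right _
  have hprime : ∀ p : Ideal (𝓞 F), p.IsPrime → p ≠ ⊥ →
      V ≤ Subalgebra.toSubmodule B ⊔ p • V := by
    intro p hp hp0
    have htop : (∀ x : 𝓞 K, ∃ b ∈ B, x - b ∈ p.map (algebraMap (𝓞 F) (𝓞 K))) →
        V ≤ Subalgebra.toSubmodule B ⊔ p • V := by
      refine fun hall => aux fun x _ => ?_
      obtain ⟨b, hb, hxb⟩ := hall x
      rw [← add_sub_cancel b x]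
      refine Submodule.add_mem_sup hb ?_
      rw [Ideal.smul_top_eq_map]
      exact hxb
    by_cases h2 : (2 : 𝓞 F) ∈ p
    · rcases hf p hp hp0 h2 with ⟨g, rfl⟩ | ⟨Q, hQ, hQp⟩
      · rw [hV, mul_comm, mul_smul]
        refine aux fun x hx => ?_
        rw [Ideal.smul_top_eq_map] at hx
        replace hx : x ∈ p.map (algebraMap (𝓞 F) (𝓞 K)) := hx
        obtain ⟨b, hb, hxb⟩ := exists_sub_mem_of_sq_mem hn hN hB hp0 le_rfl
          (Ideal.map_mono (Ideal.pow_le_self two_ne_zero)) (z := x)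
          (by rw [sq, Ideal.map_mul]; exact Ideal.mul_mem_mul hx hx)
          (by
            rw [sq, Ideal.map_mul, ← map_ofNat (algebraMap (𝓞 F) (𝓞 K)) 2]
            exact Ideal.mul_mem_mul (Ideal.mem_map_of_mem _ h2) hx)
        rw [← add_sub_cancel b x]
        refine Submodule.add_mem_sup hb ?_
        rw [← mul_smul, Ideal.smul_top_eq_map, ← sq]
        exact hxb
      · exact htop (exists_sub_mem_map_of_ramified hK hn hN hB hp0 h2 hQp)
    · exact htop (h.exists_sub_mem_map_of_two_notMem hcap hn hN hB hp0 h2)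
  have hall : ∀ I : Ideal (𝓞 F), I ≠ 0 → V ≤ Subalgebra.toSubmodule B ⊔ I • V := by
    intro I
    induction I using UniqueFactorizationMonoid.induction_on_prime with
    | h₁ => exact fun h => absurd rfl h
    | h₂ I hI =>
      intro _
      rw [Ideal.isUnit_iff.1 hI, Submodule.top_smul]
      exact le_sup_right
    | h₃ I p hI0 hp ih =>
      intro _
      calc V ≤ Subalgebra.toSubmodule B ⊔ p • V :=
            hprime p (Ideal.isPrime_of_prime hp) hp.ne_zero
        _ ≤ Subalgebra.toSubmodule B ⊔ p • (Subalgebra.toSubmodule B ⊔ I • V) :=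
            sup_le_sup_left (Submodule.smul_mono le_rfl (ih hI0)) _
        _ ≤ _ := by
            rw [Submodule.smul_sup, mul_smul, ← sup_assoc]
            exact sup_le_sup_right (sup_le le_rfl Submodule.smul_le_right) _
  have hfin := hall (Ideal.span {(n : 𝓞 F)}) (by simpa using hn)
  have hle : Ideal.span {(n : 𝓞 F)} • V ≤ Subalgebra.toSubmodule B := by
    refine (Submodule.smul_mono le_rfl le_top).trans ?_
    rw [Submodule.ideal_span_singleton_smul]
    rintro _ ⟨x, -, rfl⟩
    change (n : 𝓞 F) • x ∈ B
    rw [Algebra.smul_def, map_natCast]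
    exact hnB x
  have hxV : x ∈ V := by
    rw [hV, Ideal.smul_top_eq_map]; exact hx
  exact (hfin.trans (sup_le le_rfl hle)) hxV

end OrdersInQuadraticExtensions

section DiamondIdeal

open NumberField NumberField.Units nonZeroDivisors

variable {F K : Type*} [Field F] [NumberField F] [Field K] [NumberField K] [Algebra F K]

/-- `IsDyadic`, phrased for Mathlib's ring of integers. -/
def IsDyadicPrime (P : Ideal (𝓞 F)) : Prop := P.IsPrime ∧ P ≠ ⊥ ∧ (2 : 𝓞 F) ∈ P

variable (K) in
/-- `IsRamifiedIn`, phrased for Mathlib's ring of integers. -/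
def IsRamifiedPrime (P : Ideal (𝓞 F)) : Prop :=
  ∃ Q : Ideal (𝓞 K), Q.IsPrime ∧ Q ≠ ⊥ ∧ P.map (algebraMap (𝓞 F) (𝓞 K)) ≤ Q ^ 2

variable (F K) in
/-- `fDiamond`, phrased for Mathlib's ring of integers. -/
noncomputable def diamondIdeal : Ideal (𝓞 F) :=
  ∏ᶠ (P : Ideal (𝓞 F)) (_ : IsDyadicPrime P ∧ ¬ IsRamifiedPrime K P), P

lemma mem_BDiamond_iff {x : K} : x ∈ BDiamond F K ↔ ∃ (f : 𝓞 F) (y : 𝓞 K),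
    y ∈ (diamondIdeal F K).map (algebraMap (𝓞 F) (𝓞 K)) ∧ x = algebraMap F K f + y := Iff.rfl

lemma IsDyadicPrime.prime {P : Ideal (𝓞 F)} (h : IsDyadicPrime P) : Prime P :=
  Ideal.prime_of_isPrime h.2.1 h.1

lemma IsDyadicPrime.dvd_span_two {P : Ideal (𝓞 F)} (h : IsDyadicPrime P) : P ∣ Ideal.span {2} :=
  Ideal.dvd_span_singleton.2 h.2.2

variable (F) in
lemma finite_isDyadicPrime : {P : Ideal (𝓞 F) | IsDyadicPrime P}.Finite := by
  have h0 : (Ideal.span {2} : Ideal (𝓞 F)) ≠ 0 := by simp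
  have : Fintype {P : Ideal (𝓞 F) // P ∣ Ideal.span {2}} :=
    UniqueFactorizationMonoid.fintypeSubtypeDvd _ h0
  exact Set.Finite.subset (s := {P : Ideal (𝓞 F) | P ∣ Ideal.span {2}})
    (Set.finite_coe_iff.1 (Finite.of_fintype {P : Ideal (𝓞 F) // P ∣ Ideal.span {2}}))
    fun P hP => hP.dvd_span_two

variable (F) in
lemma exists_isDyadicPrime : ∃ P : Ideal (𝓞 F), IsDyadicPrime P := by
  have h1 : (Ideal.span {2} : Ideal (𝓞 F)) ≠ ⊤ := fun h => by
    have h2 := Ideal.absNorm_eq_one_iff.2 h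
    rw [Ideal.absNorm_span_singleton, show (2 : 𝓞 F) = algebraMap ℤ (𝓞 F) 2 by simp,
      Algebra.norm_algebraMap, RingOfIntegers.rank, Int.natAbs_pow] at h2
    have := (Nat.pow_eq_one.1 h2).resolve_left (by norm_num)
    exact (Module.finrank_pos (R := ℚ) (M := F)).ne' this
  obtain ⟨P, hP, hle⟩ := Ideal.exists_le_maximal _ h1
  have h2 : (2 : 𝓞 F) ∈ P := hle (Ideal.mem_span_singleton_self 2)
  refine ⟨P, hP.isPrime, fun h => ?_, h2⟩
  rw [h, Ideal.mem_bot] at h2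
  exact two_ne_zero h2

omit [NumberField K] in
variable (F K) in
lemma exists_diamondIdeal_eq_prod : ∃ T : Finset (Ideal (𝓞 F)),
    (∀ P, P ∈ T ↔ IsDyadicPrime P ∧ ¬ IsRamifiedPrime K P) ∧ diamondIdeal F K = ∏ P ∈ T, P := by
  have hfin : {P : Ideal (𝓞 F) | IsDyadicPrime P ∧ ¬ IsRamifiedPrime K P}.Finite :=
    (finite_isDyadicPrime F).subset fun P hP => hP.1
  exact ⟨hfin.toFinset, by simp, finprod_mem_eq_finite_toFinset_prod (fun P => P) hfin⟩

omit [NumberField K] in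
lemma dvd_diamondIdeal {P : Ideal (𝓞 F)} (hP : IsDyadicPrime P) (hr : ¬ IsRamifiedPrime K P) :
    P ∣ diamondIdeal F K := by
  obtain ⟨T, hT, hprod⟩ := exists_diamondIdeal_eq_prod F K
  rw [hprod]
  exact Finset.dvd_prod_of_mem (fun P => P) ((hT P).2 ⟨hP, hr⟩)

omit [NumberField K] in
variable (F K) in
lemma two_mem_diamondIdeal : (2 : 𝓞 F) ∈ diamondIdeal F K := by
  obtain ⟨T, hT, hprod⟩ := exists_diamondIdeal_eq_prod F K
  rw [hprod, ← Ideal.dvd_span_singleton]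
  exact Finset.prod_primes_dvd _ (fun P hP => ((hT P).1 hP).1.prime)
    fun P hP => ((hT P).1 hP).1.dvd_span_two

variable (F K) in
lemma squarefree_map_diamondIdeal :
    Squarefree ((diamondIdeal F K).map (algebraMap (𝓞 F) (𝓞 K))) := by
  classical
  obtain ⟨T, hT, hprod⟩ := exists_diamondIdeal_eq_prod F K
  have h0 : (diamondIdeal F K).map (algebraMap (𝓞 F) (𝓞 K)) ≠ 0 := fun h => by
    rw [Ideal.zero_eq_bot,
      Ideal.map_eq_bot_iff_of_injective (FaithfulSMul.algebraMap_injective (𝓞 F) (𝓞 K))] at h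
    have := two_mem_diamondIdeal F K
    rw [h, Ideal.mem_bot] at this
    exact two_ne_zero this
  rw [squarefree_iff_no_irreducibles h0]
  intro Q hQ hdvd
  have hQp : Prime Q := hQ.prime
  have hQP : Q.IsPrime := Ideal.isPrime_of_prime hQp
  have hdvd1 : Q ∣ (diamondIdeal F K).map (algebraMap (𝓞 F) (𝓞 K)) := (dvd_mul_right Q Q).trans hdvd
  have hmapprod : ∀ T : Finset (Ideal (𝓞 F)), (∏ P ∈ T, P).map (algebraMap (𝓞 F) (𝓞 K)) =
      ∏ P ∈ T, P.map (algebraMap (𝓞 F) (𝓞 K)) := fun T =>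
    map_prod (Ideal.mapHom (algebraMap (𝓞 F) (𝓞 K))) _ _
  rw [hprod, hmapprod] at hdvd hdvd1
  obtain ⟨P, hP, hQP'⟩ := hQp.exists_mem_finset_dvd hdvd1
  rw [← Finset.mul_prod_erase T _ hP, ← sq] at hdvd
  have hPd := (hT P).1 hP
  have hPcomap := eq_comap_of_map_le (hp := hPd.1.1) hPd.1.2.1 (Ideal.dvd_iff_le.1 hQP')
  have hnot : ¬ Q ∣ ∏ P ∈ T.erase P, P.map (algebraMap (𝓞 F) (𝓞 K)) := by
    intro h
    obtain ⟨P', hP', hQP''⟩ := hQp.exists_mem_finset_dvd h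
    have hP'd := (hT P').1 (Finset.mem_of_mem_erase hP')
    have := eq_comap_of_map_le (hp := hP'd.1.1) hP'd.1.2.1 (Ideal.dvd_iff_le.1 hQP'')
    exact Finset.ne_of_mem_erase hP' (this.trans hPcomap.symm)
  exact hPd.2 ⟨Q, hQP, hQp.ne_zero,
    Ideal.dvd_iff_le.1 (hQp.pow_dvd_of_dvd_mul_right 2 hnot hdvd)⟩

/-- In a finite reduced ring of characteristic two, some iterate of Frobenius is the identity. -/
lemma exists_pow_two_pow_eq {R : Type*} [CommRing R] [Finite R] [IsReduced R] (h2 : (2 : R) = 0) :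
    ∃ k, 0 < k ∧ ∀ x : R, x ^ 2 ^ k = x := by
  have hinj : Function.Injective fun x : R => x ^ 2 := by
    intro x y hxy
    have h : (x - y) ^ 2 = 0 := by
      linear_combination (hxy : x ^ 2 = y ^ 2) + (y ^ 2 - x * y) * h2
    exact sub_eq_zero.1 (pow_eq_zero_iff two_ne_zero |>.1 h)
  let σ : Equiv.Perm R := Equiv.ofBijective _ (Finite.injective_iff_bijective.1 hinj)
  have hσ : ∀ k x, (σ ^ k) x = x ^ 2 ^ k := by
    intro k
    induction k with
    | zero => intro x; simp
    | succ k ih =>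
      intro x
      rw [pow_succ', Equiv.Perm.mul_apply, ih, pow_succ, pow_mul]
      rfl
  refine ⟨orderOf σ, orderOf_pos σ, fun x => ?_⟩
  rw [← hσ, pow_orderOf_eq_one, Equiv.Perm.one_apply]

variable (F K) in
lemma exists_pow_sub_mem_map_diamondIdeal : ∃ k, 0 < k ∧ ∀ x : 𝓞 K,
    x ^ 2 ^ k - x ∈ (diamondIdeal F K).map (algebraMap (𝓞 F) (𝓞 K)) := by
  set J := (diamondIdeal F K).map (algebraMap (𝓞 F) (𝓞 K)) with hJ
  have h2 : (2 : 𝓞 K) ∈ J := by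
    rw [← map_ofNat (algebraMap (𝓞 F) (𝓞 K)) 2]
    exact Ideal.mem_map_of_mem _ (two_mem_diamondIdeal F K)
  have hJ0 : J ≠ ⊥ := fun h => by
    rw [h, Ideal.mem_bot] at h2
    exact two_ne_zero h2
  have hrad : J.IsRadical := by
    rintro x ⟨n, hn⟩
    rw [← Ideal.dvd_span_singleton] at hn ⊢
    rw [← Ideal.span_singleton_pow] at hn
    exact (squarefree_map_diamondIdeal F K).isRadical n _ hn
  have : IsReduced (𝓞 K ⧸ J) := Ideal.isRadical_iff_quotient_reduced J |>.1 hrad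
  have := Ideal.finiteQuotientOfFreeOfNeBot J hJ0
  obtain ⟨k, hk, hpow⟩ := exists_pow_two_pow_eq (R := 𝓞 K ⧸ J)
    (by rw [← map_ofNat (Ideal.Quotient.mk J) 2]; exact Ideal.Quotient.eq_zero_iff_mem.2 h2)
  refine ⟨k, hk, fun x => ?_⟩
  rw [← Ideal.Quotient.mk_eq_mk_iff_sub_mem, map_pow, hpow]

/-- If `O_F` surjects onto `O_K / f_⋄O_K`, then no dyadic prime is unramified in `K`. -/
lemma isRamifiedPrime_of_forall_exists_sub_mem (hK : Module.finrank F K = 2)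
    (h : ∀ x : 𝓞 K, ∃ r : 𝓞 F, x - algebraMap (𝓞 F) (𝓞 K) r ∈
      (diamondIdeal F K).map (algebraMap (𝓞 F) (𝓞 K))) {P : Ideal (𝓞 F)} (hP : IsDyadicPrime P) :
    IsRamifiedPrime K P := by
  by_contra hr
  have hle := Ideal.dvd_iff_le.1 (dvd_diamondIdeal hP hr)
  have hmap0 : P.map (algebraMap (𝓞 F) (𝓞 K)) ≠ ⊥ := fun h => hP.2.1
    ((Ideal.map_eq_bot_iff_of_injective (FaithfulSMul.algebraMap_injective (𝓞 F) (𝓞 K))).1 h)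
  have := Ideal.finiteQuotientOfFreeOfNeBot P hP.2.1
  have hsurj : Function.Surjective (Ideal.quotientMap (P.map (algebraMap (𝓞 F) (𝓞 K)))
      (algebraMap (𝓞 F) (𝓞 K)) Ideal.le_comap_map) := by
    intro y
    obtain ⟨x, rfl⟩ := Ideal.Quotient.mk_surjective y
    obtain ⟨r, hr⟩ := h x
    refine ⟨Ideal.Quotient.mk _ r, ?_⟩
    rw [Ideal.quotientMap_mk, eq_comm, Ideal.Quotient.mk_eq_mk_iff_sub_mem]
    exact Ideal.map_mono hle hr
  have hcard := Nat.card_le_card_of_surjective _ hsurj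
  rw [← Submodule.cardQuot_apply, ← Submodule.cardQuot_apply, ← Ideal.absNorm_apply,
    ← Ideal.absNorm_apply, Ideal.absNorm_algebraMap, finrank_ringOfIntegers hK] at hcard
  have h0 : Ideal.absNorm P ≠ 0 := fun h => hP.2.1 (Ideal.absNorm_eq_zero_iff.1 h)
  have h1 : Ideal.absNorm P ≠ 1 := fun h => hP.1.ne_top (Ideal.absNorm_eq_one_iff.1 h)
  have : 2 ≤ Ideal.absNorm P := by omega
  nlinarith

end DiamondIdeal

section PicardExtension

variable {L : Type*} [Field L] {A S : Subalgebra ℤ L}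

lemma span_span_of_le (h : A ≤ S) (X : Set L) :
    Submodule.span S (Submodule.span A X : Set L) = Submodule.span S X := by
  refine le_antisymm (Submodule.span_le.2 fun x hx => ?_)
    (Submodule.span_mono Submodule.subset_span)
  induction hx using Submodule.span_induction with
  | mem x hx => exact Submodule.subset_span hx
  | zero => exact Submodule.zero_mem _
  | add x y _ _ hx hy => exact Submodule.add_mem _ hx hy
  | smul a x _ hx => exact Submodule.smul_mem _ (⟨a, h a.2⟩ : S) hx

/-- Extension of scalars for modules contained in a field. -/
def extendSubmodule (h : A ≤ S) : Submodule A L →* Submodule S L where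
  toFun X := Submodule.span S (X : Set L)
  map_one' := by
    rw [Submodule.one_eq_span, span_span_of_le h, Submodule.one_eq_span]
  map_mul' X Y := by
    rw [Submodule.mul_eq_span_mul_set, span_span_of_le h, Submodule.span_mul_span]

lemma extendSubmodule_span (h : A ≤ S) (X : Set L) :
    extendSubmodule h (Submodule.span A X) = Submodule.span S X := span_span_of_le h X

lemma subset_extendSubmodule (h : A ≤ S) {X : Submodule A L} {x : L} (hx : x ∈ X) :
    x ∈ extendSubmodule h X := Submodule.subset_span hx

lemma extendSubmodule_le_iff (h : A ≤ S) {X : Submodule A L} {Y : Submodule S L} :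
    extendSubmodule h X ≤ Y ↔ ∀ x ∈ X, x ∈ Y := Submodule.span_le

lemma mem_one_submodule_iff {x : L} : x ∈ (1 : Submodule A L) ↔ x ∈ A := by
  rw [Submodule.mem_one]
  exact ⟨fun ⟨a, ha⟩ => ha ▸ a.2, fun hx => ⟨⟨x, hx⟩, rfl⟩⟩

/-- Extension of scalars on invertible modules. -/
def extendUnits (h : A ≤ S) : (Submodule A L)ˣ →* (Submodule S L)ˣ :=
  Units.map (extendSubmodule h)

lemma coe_extendUnits (h : A ≤ S) (u : (Submodule A L)ˣ) :
    (extendUnits h u : Submodule S L) = extendSubmodule h u := rfl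

/-- The homomorphism of Picard groups given by extension of scalars. -/
def picardExtend (h : A ≤ S) : Picard A →* Picard S :=
  QuotientGroup.map (principalSub A) (principalSub S) (extendUnits h) <| by
    rintro u ⟨x, hx, hu⟩
    refine ⟨x, hx, ?_⟩
    rw [coe_extendUnits, hu, extendSubmodule_span]

lemma picardExtend_picCls (h : A ≤ S) (u : (Submodule A L)ˣ) :
    picardExtend h (picCls A u) = picCls S (extendUnits h u) := rfl

lemma picCls_mul (u v : (Submodule A L)ˣ) : picCls A (u * v) = picCls A u * picCls A v := rfl

lemma picCls_pow (u : (Submodule A L)ˣ) (n : ℕ) : picCls A (u ^ n) = picCls A u ^ n := rfl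

lemma picCls_eq_one_iff {u : (Submodule A L)ˣ} :
    picCls A u = 1 ↔ ∃ x : L, IsUnit x ∧ (u : Submodule A L) = Submodule.span A {x} :=
  QuotientGroup.eq_one_iff u

variable (A) in
/-- The principal module generated by a nonzero element. -/
def principalUnit (x : Lˣ) : (Submodule A L)ˣ where
  val := Submodule.span A {(x : L)}
  inv := Submodule.span A {((x⁻¹ : Lˣ) : L)}
  val_inv := by
    rw [Submodule.span_mul_span, Set.singleton_mul_singleton, Units.mul_inv, Submodule.one_eq_span]
  inv_val := by
    rw [Submodule.span_mul_span, Set.singleton_mul_singleton, Units.inv_mul, Submodule.one_eq_span]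

lemma picCls_principalUnit (x : Lˣ) : picCls A (principalUnit A x) = 1 :=
  picCls_eq_one_iff.2 ⟨x, x.isUnit, rfl⟩

/-- Every class in the kernel is represented by a module generating the unit module. -/
lemma exists_extendUnits_eq_one (h : A ≤ S) {z : Picard A} (hz : picardExtend h z = 1) :
    ∃ u, picCls A u = z ∧ extendUnits h u = 1 := by
  obtain ⟨v, rfl⟩ := QuotientGroup.mk_surjective z
  obtain ⟨x, hx, hv⟩ := picCls_eq_one_iff.1 hz
  refine ⟨v * principalUnit A hx.unit⁻¹, ?_, ?_⟩
  · rw [picCls_mul, picCls_principalUnit, mul_one]; rfl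
  · apply Units.ext
    rw [map_mul, Units.val_mul, hv, coe_extendUnits]
    change _ * extendSubmodule h (Submodule.span A _) = _
    rw [extendSubmodule_span, Submodule.span_mul_span, Set.singleton_mul_singleton,
      Units.val_one, Submodule.one_eq_span, IsUnit.mul_val_inv]

lemma mem_of_extendUnits_eq_one (h : A ≤ S) {u : (Submodule A L)ˣ} (hu : extendUnits h u = 1)
    {x : L} (hx : x ∈ (u : Submodule A L)) : x ∈ S := by
  rw [← mem_one_submodule_iff, ← Units.val_one, ← hu]
  exact subset_extendSubmodule h hx

/-- A module generating the unit module contains every `S`-ideal lying in `A`. -/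
lemma mem_of_forall_mul_mem (h : A ≤ S) {u : (Submodule A L)ˣ} (hu : extendUnits h u = 1)
    {c : L} (hc : ∀ s ∈ S, s * c ∈ A) : c ∈ (u : Submodule A L) := by
  have hu' : extendUnits h u⁻¹ = 1 := by rw [map_inv, hu, inv_one]
  have key : ∀ x ∈ ((u : Submodule A L) * ((u⁻¹ : (Submodule A L)ˣ) : Submodule A L)),
      x * c ∈ (u : Submodule A L) := by
    intro x hx
    induction hx using Submodule.mul_induction_on' with
    | mem_mul_mem a ha b hb =>
      have := hc b (mem_of_extendUnits_eq_one h hu' hb)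
      have h2 := Submodule.smul_mem (u : Submodule A L) (⟨b * c, this⟩ : A) ha
      have : a * b * c = (⟨b * c, this⟩ : A) • a := by
        change _ = b * c * a
        ring
      rwa [this]
    | add x _ y _ hx hy => rw [add_mul]; exact Submodule.add_mem _ hx hy
  rw [Units.mul_inv] at key
  simpa using key 1 (mem_one_submodule_iff.2 A.one_mem)

end PicardExtension

section PicardKernel

variable {L : Type*} [Field L] {A S : Subalgebra ℤ L} {n : ℕ}

lemma finite_ker_extendUnits (h : A ≤ S) (hn : ∀ x ∈ S, n * x ∈ A)
    [Finite (S ⧸ Ideal.span {(n : S)})] : Finite (extendUnits h).ker := by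
  have hle : ∀ u v : (extendUnits h).ker,
      (Ideal.Quotient.mk (Ideal.span {(n : S)})) '' {s | (s : L) ∈ (u.1 : Submodule A L)} =
        (Ideal.Quotient.mk (Ideal.span {(n : S)})) '' {s | (s : L) ∈ (v.1 : Submodule A L)} →
      (u.1 : Submodule A L) ≤ v.1 := by
    intro u v huv x hx
    have hxS := mem_of_extendUnits_eq_one h u.2 hx
    obtain ⟨s, hs, hsx⟩ := huv ▸ Set.mem_image_of_mem (Ideal.Quotient.mk (Ideal.span {(n : S)}))
      (show (⟨x, hxS⟩ : S) ∈ {s : S | (s : L) ∈ (u.1 : Submodule A L)} from hx)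
    obtain ⟨t, ht⟩ := Ideal.mem_span_singleton'.1 (Ideal.Quotient.mk_eq_mk_iff_sub_mem _ _ |>.1 hsx)
    have ht' : (t : L) * n = s - x := congrArg (Subtype.val : S → L) ht
    have h1 : (s : L) - x ∈ (v.1 : Submodule A L) := by
      refine mem_of_forall_mul_mem h v.2 fun r hr => ?_
      rw [← ht', show r * ((t : L) * n) = n * (r * t) by ring]
      exact hn _ (mul_mem hr t.2)
    simpa using Submodule.sub_mem _ hs h1
  refine Finite.of_injective (β := Set (S ⧸ Ideal.span {(n : S)}))
    (fun u => (Ideal.Quotient.mk _) '' {s : S | (s : L) ∈ (u.1 : Submodule A L)}) fun u v huv => ?_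
  exact Subtype.ext (Units.ext (le_antisymm (hle u v huv) (hle v u huv.symm)))

lemma finite_ker_picardExtend (h : A ≤ S) (hn : ∀ x ∈ S, n * x ∈ A)
    [Finite (S ⧸ Ideal.span {(n : S)})] : Finite (picardExtend h).ker := by
  have := finite_ker_extendUnits h hn
  refine Finite.of_surjective (α := (extendUnits h).ker)
    (fun u => ⟨picCls A u.1, by
      rw [MonoidHom.mem_ker, picardExtend_picCls, MonoidHom.mem_ker.1 u.2]; rfl⟩) fun z => ?_
  obtain ⟨u, hu, hu1⟩ := exists_extendUnits_eq_one h z.2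
  exact ⟨⟨u, hu1⟩, Subtype.ext hu⟩

lemma pow_eq_self_of_extendUnits_eq_one (h : A ≤ S) {q : ℕ}
    (hq : ∀ x ∈ S, ∀ s ∈ S, s * (x ^ q - x) ∈ A) {u : (Submodule A L)ˣ} (hu : extendUnits h u = 1) :
    u ^ q = u := by
  have key : ∀ v : (Submodule A L)ˣ, extendUnits h v = 1 →
      (v : Submodule A L) ≤ ((v ^ q : (Submodule A L)ˣ) : Submodule A L) := by
    intro v hv x hx
    have h1 : x ^ q ∈ ((v ^ q : (Submodule A L)ˣ) : Submodule A L) := by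
      rw [Units.val_pow_eq_pow_val]
      exact Submodule.pow_mem_pow _ hx q
    have h2 : x ^ q - x ∈ ((v ^ q : (Submodule A L)ˣ) : Submodule A L) :=
      mem_of_forall_mul_mem h (by rw [map_pow, hv, one_pow])
        (hq x (mem_of_extendUnits_eq_one h hv hx))
    simpa using Submodule.sub_mem _ h1 h2
  refine Units.ext (le_antisymm ?_ (key u hu))
  have h1 := key u⁻¹ (by rw [map_inv, hu, inv_one])
  have h2 := mul_le_mul_right h1 ((u * u ^ q : (Submodule A L)ˣ) : Submodule A L)
  rwa [← Units.val_mul, ← Units.val_mul, inv_pow, mul_inv_cancel_right, mul_comm u,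
    mul_inv_cancel_right] at h2

lemma odd_card_ker_picardExtend (h : A ≤ S) [Finite (picardExtend h).ker] {k : ℕ} (hk : 0 < k)
    (hq : ∀ x ∈ S, ∀ s ∈ S, s * (x ^ 2 ^ k - x) ∈ A) : Odd (Nat.card (picardExtend h).ker) := by
  rw [← Nat.not_even_iff_odd, even_iff_two_dvd]
  intro h2
  obtain ⟨z, hz⟩ := exists_prime_orderOf_dvd_card' 2 h2
  obtain ⟨u, hu, hu1⟩ := exists_extendUnits_eq_one h z.2
  have h1 : (z : Picard A) ^ 2 ^ k = z := by
    rw [← hu, ← picCls_pow, pow_eq_self_of_extendUnits_eq_one h hq hu1]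
  have h3 : z ^ 2 ^ k = 1 := by
    obtain ⟨k, rfl⟩ := Nat.exists_eq_succ_of_ne_zero hk.ne'
    rw [pow_succ', pow_mul, ← hz, pow_orderOf_eq_one, one_pow]
  have h4 : z = 1 := by rw [← h3]; exact (Subtype.ext h1).symm
  rw [h4, orderOf_one] at hz
  omega

/-- The `A`-module `zA + nS`. -/
def spanSupSMul (A S : Subalgebra ℤ L) (h : A ≤ S) (n : ℕ) (z : L) : Submodule A L where
  carrier := {t | ∃ a ∈ A, ∃ s ∈ S, t = a * z + n * s}
  zero_mem' := ⟨0, zero_mem _, 0, zero_mem _, by simp⟩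
  add_mem' := by
    rintro _ _ ⟨a, ha, s, hs, rfl⟩ ⟨b, hb, t, ht, rfl⟩
    exact ⟨a + b, add_mem ha hb, s + t, add_mem hs ht, by ring⟩
  smul_mem' := by
    rintro c _ ⟨a, ha, s, hs, rfl⟩
    refine ⟨c * a, mul_mem c.2 ha, c * s, mul_mem (h c.2) hs, ?_⟩
    change (c : L) * (a * z + n * s) = _
    ring

lemma spanSupSMul_mul_spanSupSMul (h : A ≤ S) (hn : ∀ x ∈ S, n * x ∈ A) {y y' w : L}
    (hy : y ∈ S) (hy' : y' ∈ S) (hw : w ∈ S) (hyw : y * y' = 1 + n * w) :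
    spanSupSMul A S h n y * spanSupSMul A S h n y' = 1 := by
  refine le_antisymm (Submodule.mul_le.2 ?_) ?_
  · rintro _ ⟨a, ha, s, hs, rfl⟩ _ ⟨b, hb, t, ht, rfl⟩
    rw [mem_one_submodule_iff, show (a * y + n * s) * (b * y' + n * t) =
      a * b + n * (a * b * w + a * y * t + s * b * y' + s * (n * t)) by
        linear_combination a * b * hyw]
    refine add_mem (mul_mem ha hb) (hn _ ?_)
    exact add_mem (add_mem (add_mem (mul_mem (mul_mem (h ha) (h hb)) hw)
      (mul_mem (mul_mem (h ha) hy) ht)) (mul_mem (mul_mem hs (h hb)) hy'))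
      (mul_mem hs (h (hn t ht)))
  · rw [Submodule.one_eq_span, Submodule.span_le, Set.singleton_subset_iff]
    have h1 : ∀ s ∈ S, n * (n * s) ∈ spanSupSMul A S h n y * spanSupSMul A S h n y' :=
        fun s hs => by
      rw [show n * (n * s) = (0 * y + n * 1 : L) * (0 * y' + n * s) by ring]
      exact Submodule.mul_mem_mul ⟨0, zero_mem _, 1, one_mem _, rfl⟩ ⟨0, zero_mem _, s, hs, rfl⟩
    have h2 : ∀ s ∈ S, n * s * y ∈ spanSupSMul A S h n y * spanSupSMul A S h n y' := fun s hs => by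
      rw [show n * s * y = (1 * y + n * 0 : L) * (0 * y' + n * s) by ring]
      exact Submodule.mul_mem_mul ⟨1, one_mem _, 0, zero_mem _, rfl⟩ ⟨0, zero_mem _, s, hs, rfl⟩
    have h3 : y * y' ∈ spanSupSMul A S h n y * spanSupSMul A S h n y' := by
      rw [show y * y' = (1 * y + n * 0 : L) * (1 * y' + n * 0) by ring]
      exact Submodule.mul_mem_mul ⟨1, one_mem _, 0, zero_mem _, rfl⟩
        ⟨1, one_mem _, 0, zero_mem _, rfl⟩
    have h4 := Submodule.add_mem _ (Submodule.sub_mem _ h3 (h2 _ (mul_mem hy' hw)))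
      (h1 _ (mul_mem hw hw))
    rwa [show y * y' - n * (y' * w) * y + n * (n * (w * w)) = 1 by
      linear_combination (1 - n * w) * hyw] at h4

/-- An element of `S` invertible modulo `nS` lies in an invertible `A`-module generating `S`. -/
lemma exists_mem_extendUnits_eq_one (h : A ≤ S) (hn : ∀ x ∈ S, n * x ∈ A) {y y' w : L}
    (hy : y ∈ S) (hy' : y' ∈ S) (hw : w ∈ S) (hyw : y * y' = 1 + n * w) :
    ∃ u : (Submodule A L)ˣ, extendUnits h u = 1 ∧ y ∈ (u : Submodule A L) := by
  refine ⟨⟨spanSupSMul A S h n y, spanSupSMul A S h n y',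
    spanSupSMul_mul_spanSupSMul h hn hy hy' hw hyw,
    spanSupSMul_mul_spanSupSMul h hn hy' hy hw (by rw [mul_comm, hyw])⟩, Units.ext ?_,
    ⟨1, one_mem _, 0, zero_mem _, by ring⟩⟩
  rw [coe_extendUnits, Units.val_one]
  refine le_antisymm ((extendSubmodule_le_iff h).2 ?_) ?_
  · rintro _ ⟨a, ha, s, hs, rfl⟩
    exact mem_one_submodule_iff.2 (add_mem (mul_mem (h ha) hy) (mul_mem (natCast_mem _ _) hs))
  · rw [Submodule.one_eq_span, Submodule.span_le, Set.singleton_subset_iff]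
    have h1 : y ∈ extendSubmodule h (spanSupSMul A S h n y) :=
      subset_extendSubmodule h ⟨1, one_mem _, 0, zero_mem _, by ring⟩
    have h2 : n * w ∈ extendSubmodule h (spanSupSMul A S h n y) :=
      subset_extendSubmodule h ⟨0, zero_mem _, w, hw, by ring⟩
    have h3 := Submodule.sub_mem _ (Submodule.smul_mem _ (⟨y', hy'⟩ : S) h1) h2
    rwa [show (⟨y', hy'⟩ : S) • y - n * w = 1 by
      change y' * y - _ = _; linear_combination hyw] at h3

/-- If the kernel of `Pic A → Pic S` is finite, elements of `S` invertible modulo `nS` have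
a power in `A`, up to a unit. -/
lemma exists_pow_card_ker_eq (h : A ≤ S) (hn : ∀ x ∈ S, n * x ∈ A) {y y' w : L}
    (hy : y ∈ S) (hy' : y' ∈ S) (hw : w ∈ S) (hyw : y * y' = 1 + n * w) :
    ∃ e ∈ S, ∃ e' ∈ S, e * e' = 1 ∧ ∃ a ∈ A, y ^ Nat.card (picardExtend h).ker = e * a := by
  obtain ⟨u, hu, hyu⟩ := exists_mem_extendUnits_eq_one h hn hy hy' hw hyw
  set N := Nat.card (picardExtend h).ker
  have h1 : picCls A (u ^ N) = 1 := by
    have hz : picCls A u ∈ (picardExtend h).ker := by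
      rw [MonoidHom.mem_ker, picardExtend_picCls, hu]; rfl
    exact congrArg Subtype.val (pow_card_eq_one' (x := (⟨_, hz⟩ : (picardExtend h).ker)))
  obtain ⟨e, he, heu⟩ := picCls_eq_one_iff.1 h1
  have h2 : extendUnits h (u ^ N) = 1 := by rw [map_pow, hu, one_pow]
  have h3 : Submodule.span S {e} = 1 := by
    rw [← extendSubmodule_span h, ← heu, ← coe_extendUnits, h2, Units.val_one]
  have heS : e ∈ S := by
    rw [← mem_one_submodule_iff, ← h3]; exact Submodule.mem_span_singleton_self e
  have h1S : (1 : L) ∈ Submodule.span S {e} := by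
    rw [h3]; exact mem_one_submodule_iff.2 (one_mem _)
  obtain ⟨e', he'⟩ := Submodule.mem_span_singleton.1 h1S
  have hyN : y ^ N ∈ Submodule.span A {e} := by
    rw [← heu, Units.val_pow_eq_pow_val]; exact Submodule.pow_mem_pow _ hyu N
  obtain ⟨a, ha⟩ := Submodule.mem_span_singleton.1 hyN
  exact ⟨e, heS, e', e'.2, by rw [mul_comm]; exact he', a, a.2, by rw [mul_comm]; exact ha.symm⟩

/-- The part of an `S`-module that lies in `A`. -/
def infSubalgebra (h : A ≤ S) (J : Submodule S L) : Submodule A L where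
  carrier := {t | t ∈ J ∧ t ∈ A}
  zero_mem' := ⟨zero_mem _, zero_mem _⟩
  add_mem' hx hy := ⟨add_mem hx.1 hy.1, add_mem hx.2 hy.2⟩
  smul_mem' c _ hx := ⟨J.smul_mem (⟨c, h c.2⟩ : S) hx.1, mul_mem c.2 hx.2⟩

/-- The elements of an `S`-module that `j` multiplies into `A`. -/
def colonSubalgebra (h : A ≤ S) (J : Submodule S L) (j : L) : Submodule A L where
  carrier := {t | t ∈ J ∧ j * t ∈ A}
  zero_mem' := ⟨zero_mem _, by rw [mul_zero]; exact zero_mem _⟩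
  add_mem' hx hy := ⟨add_mem hx.1 hy.1, by rw [mul_add]; exact add_mem hx.2 hy.2⟩
  smul_mem' c x hx := ⟨J.smul_mem (⟨c, h c.2⟩ : S) hx.1, by
    change j * (c * x) ∈ A
    rw [mul_left_comm]
    exact mul_mem c.2 hx.2⟩

lemma infSubalgebra_mul_colonSubalgebra (h : A ≤ S) (hn : ∀ x ∈ S, n * x ∈ A)
    (J : (Submodule S L)ˣ) (hJ : (J : Submodule S L) ≤ 1) {s : L} (hs : s ∈ S)
    (hj : 1 - n * (n * s) ∈ (J : Submodule S L)) :
    infSubalgebra h J * colonSubalgebra h (J⁻¹ : (Submodule S L)ˣ) (1 - n * (n * s)) = 1 := by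
  set J' : Submodule S L := ((J⁻¹ : (Submodule S L)ˣ) : Submodule S L)
  have hJJ : (J : Submodule S L) * J' = 1 := Units.mul_inv J
  set j := 1 - n * (n * s) with hj_def
  have hjA : j ∈ A := sub_mem (one_mem _) (hn _ (mul_mem (natCast_mem _ _) hs))
  refine le_antisymm (Submodule.mul_le.2 ?_) ?_
  · rintro a ⟨haJ, haA⟩ b ⟨hbJ, hbA⟩
    have habS : a * b ∈ S := mem_one_submodule_iff.1 (hJJ ▸ Submodule.mul_mem_mul haJ hbJ)
    rw [mem_one_submodule_iff, show a * b = a * (j * b) + n * (n * s * (a * b)) by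
      rw [hj_def]; ring]
    exact add_mem (mul_mem haA hbA) (hn _ (mul_mem (mul_mem (natCast_mem _ _) hs) habS))
  · set T := infSubalgebra h J * colonSubalgebra h J' j with hT
    have h1 : ∀ x ∈ (J : Submodule S L) * J', n * (n * x) ∈ T := by
      intro x hx
      induction hx using Submodule.mul_induction_on' with
      | mem_mul_mem a ha b hb =>
        rw [show n * (n * (a * b)) = (n * a : L) * (n * b) by ring]
        have haS : a ∈ S := mem_one_submodule_iff.1 (hJ ha)
        have hjb : j * b ∈ S := mem_one_submodule_iff.1 (hJJ ▸ Submodule.mul_mem_mul hj hb)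
        refine Submodule.mul_mem_mul ⟨?_, hn a haS⟩ ⟨?_, ?_⟩
        · exact Submodule.smul_mem _ (n : S) ha
        · exact Submodule.smul_mem _ (n : S) hb
        · rw [mul_left_comm]; exact hn _ hjb
      | add x _ y _ hx hy => rw [mul_add, mul_add]; exact add_mem hx hy
    rw [hJJ] at h1
    have h2 : j * 1 ∈ T := by
      refine Submodule.mul_mem_mul ⟨hj, hjA⟩ ⟨?_, by rwa [mul_one]⟩
      have : (1 : Submodule S L) ≤ J' := by
        calc (1 : Submodule S L) = J * J' := hJJ.symm
          _ ≤ 1 * J' := mul_le_mul_left hJ J'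
          _ = J' := one_mul J'
      exact this (mem_one_submodule_iff.2 (one_mem _))
    have h3 := Submodule.add_mem _ h2 (h1 s (mem_one_submodule_iff.2 hs))
    rw [Submodule.one_eq_span, Submodule.span_le, Set.singleton_subset_iff]
    rwa [show j * 1 + n * (n * s) = 1 by rw [hj_def]; ring] at h3

/-- An integral invertible `S`-module prime to `n` is extended from `A`. -/
lemma exists_extendUnits_eq (h : A ≤ S) (hn : ∀ x ∈ S, n * x ∈ A)
    (J : (Submodule S L)ˣ) (hJ : (J : Submodule S L) ≤ 1) {s : L} (hs : s ∈ S)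
    (hj : 1 - n * (n * s) ∈ (J : Submodule S L)) : ∃ u, extendUnits h u = J := by
  have hmul := infSubalgebra_mul_colonSubalgebra h hn J hJ hs hj
  refine ⟨⟨_, _, hmul, by rw [mul_comm]; exact hmul⟩, Units.ext ?_⟩
  rw [coe_extendUnits]
  refine le_antisymm ((extendSubmodule_le_iff h).2 fun x hx => hx.1) fun a ha => ?_
  change a ∈ extendSubmodule h (infSubalgebra h J)
  have haS : a ∈ S := mem_one_submodule_iff.1 (hJ ha)
  have h1 : 1 - n * (n * s) ∈ infSubalgebra h (J : Submodule S L) :=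
    ⟨hj, sub_mem (one_mem _) (hn _ (mul_mem (natCast_mem _ _) hs))⟩
  have h2 : n * (n * s * a) ∈ infSubalgebra h (J : Submodule S L) :=
    ⟨Submodule.smul_mem _
      (⟨n * (n * s), mul_mem (natCast_mem _ _) (mul_mem (natCast_mem _ _) hs)⟩ : S)
      ha |> fun H => by rwa [show n * (n * s * a) = (n * (n * s)) * a by ring],
      hn _ (mul_mem (mul_mem (natCast_mem _ _) hs) haS)⟩
  have h3 := Submodule.add_mem _
    (Submodule.smul_mem _ (⟨a, haS⟩ : S) (subset_extendSubmodule h h1))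
    (subset_extendSubmodule h h2)
  rwa [show (⟨a, haS⟩ : S) • (1 - n * (n * s)) + n * (n * s * a) = a by
    change a * _ + _ = a; ring] at h3

end PicardKernel

section PicardRingOfIntegers

open NumberField nonZeroDivisors

variable {L : Type*} [Field L] [NumberField L]

variable (L) in
/-- Invertible fractional ideals are invertible submodules. -/
noncomputable def fractionalIdealUnitsEquiv :
    (FractionalIdeal (𝓞 L)⁰ L)ˣ ≃* (Submodule (integralClosure ℤ L) L)ˣ :=
  FractionalIdeal.unitsMulEquivSubmodule (R := 𝓞 L) (S := (𝓞 L)⁰) (P := L)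

lemma coe_fractionalIdealUnitsEquiv (I : (FractionalIdeal (𝓞 L)⁰ L)ˣ) :
    (fractionalIdealUnitsEquiv L I : Submodule (integralClosure ℤ L) L) =
      ((I : FractionalIdeal (𝓞 L)⁰ L) : Submodule (𝓞 L) L) := rfl

lemma map_range_toPrincipalIdeal : (toPrincipalIdeal (𝓞 L) L).range.map
    (fractionalIdealUnitsEquiv L : (FractionalIdeal (𝓞 L)⁰ L)ˣ →* _) =
      principalSub (integralClosure ℤ L) := by
  ext u
  constructor
  · rintro ⟨_, ⟨x, rfl⟩, rfl⟩
    refine ⟨x, x.isUnit, ?_⟩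
    rw [MonoidHom.coe_coe, coe_fractionalIdealUnitsEquiv, coe_toPrincipalIdeal,
      FractionalIdeal.coe_spanSingleton]
    rfl
  · rintro ⟨x, hx, hu⟩
    refine ⟨_, ⟨hx.unit, rfl⟩, Units.ext ?_⟩
    rw [MonoidHom.coe_coe, coe_fractionalIdealUnitsEquiv, coe_toPrincipalIdeal,
      FractionalIdeal.coe_spanSingleton, hu]
    rfl

variable (L) in
/-- The ideal class group is the Picard group of the maximal order. -/
noncomputable def classGroupEquivPicard : ClassGroup (𝓞 L) ≃* Picard (integralClosure ℤ L) :=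
  (ClassGroup.equiv L).trans
    (QuotientGroup.congr _ _ (fractionalIdealUnitsEquiv L) map_range_toPrincipalIdeal)

lemma classGroupEquivPicard_mk0 (b : (Ideal (𝓞 L))⁰) :
    classGroupEquivPicard L (ClassGroup.mk0 b) =
      picCls _ (fractionalIdealUnitsEquiv L (FractionalIdeal.mk0 L b)) := by
  change QuotientGroup.congr _ _ (fractionalIdealUnitsEquiv L) map_range_toPrincipalIdeal
    (ClassGroup.equiv L (ClassGroup.mk0 b)) = _
  rw [ClassGroup.equiv_mk0]
  rfl

variable (L) in
lemma hPic_integralClosure : hPic (integralClosure ℤ L) = Nat.card (ClassGroup (𝓞 L)) :=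
  (Nat.card_congr (classGroupEquivPicard L).toEquiv).symm

lemma mem_fractionalIdealUnitsEquiv_mk0 {b : (Ideal (𝓞 L))⁰} {x : L} :
    x ∈ (fractionalIdealUnitsEquiv L (FractionalIdeal.mk0 L b) :
      Submodule (integralClosure ℤ L) L) ↔ ∃ y ∈ (b : Ideal (𝓞 L)), (y : L) = x := by
  rw [coe_fractionalIdealUnitsEquiv, FractionalIdeal.coe_mk0]
  exact FractionalIdeal.mem_coeIdeal (𝓞 L)⁰

lemma picardExtend_surjective {B : Subalgebra ℤ L} (h : B ≤ integralClosure ℤ L) {n : ℕ}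
    (hn0 : n ≠ 0) (hn : ∀ x ∈ integralClosure ℤ L, n * x ∈ B) :
    Function.Surjective (picardExtend h) := by
  intro z
  have hm : (Ideal.span {((n * n : ℕ) : 𝓞 L)}) ≠ ⊥ := by
    rw [Ne, Ideal.span_singleton_eq_bot]
    exact Nat.cast_ne_zero.2 (mul_ne_zero hn0 hn0)
  obtain ⟨b, hb, hbm⟩ := exists_mk0_eq_sup_eq_top ((classGroupEquivPicard L).symm z) hm
  obtain ⟨j, hj, t, ht, hjt⟩ := Submodule.mem_sup.1 ((Ideal.eq_top_iff_one _).1 hbm)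
  obtain ⟨s, hs⟩ := Ideal.mem_span_singleton'.1 ht
  have h1 : (fractionalIdealUnitsEquiv L (FractionalIdeal.mk0 L b) :
      Submodule (integralClosure ℤ L) L) ≤ 1 := by
    intro x hx
    obtain ⟨y, -, rfl⟩ := mem_fractionalIdealUnitsEquiv_mk0.1 hx
    exact mem_one_submodule_iff.2 y.2
  have h2 : 1 - n * (n * (s : L)) ∈ (fractionalIdealUnitsEquiv L (FractionalIdeal.mk0 L b) :
      Submodule (integralClosure ℤ L) L) := by
    refine mem_fractionalIdealUnitsEquiv_mk0.2 ⟨j, hj, ?_⟩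
    have := congrArg (algebraMap (𝓞 L) L) hjt
    rw [← hs, Nat.cast_mul] at this
    simp only [map_add, map_mul, map_natCast, map_one] at this
    linear_combination this
  obtain ⟨u, hu⟩ := exists_extendUnits_eq h hn _ h1 s.2 h2
  refine ⟨picCls _ u, ?_⟩
  rw [picardExtend_picCls, hu, ← classGroupEquivPicard_mk0, hb, MulEquiv.apply_symm_apply]

lemma hPic_eq_mul_card_ker {B : Subalgebra ℤ L} (h : B ≤ integralClosure ℤ L) {n : ℕ}
    (hn0 : n ≠ 0) (hn : ∀ x ∈ integralClosure ℤ L, n * x ∈ B) :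
    hPic B = hPic (integralClosure ℤ L) * Nat.card (picardExtend h).ker := by
  rw [hPic, Subgroup.card_eq_card_quotient_mul_card_subgroup (picardExtend h).ker, hPic,
    Nat.card_congr (QuotientGroup.quotientKerEquivOfSurjective _
      (picardExtend_surjective h hn0 hn)).toEquiv]

/-- An order has finite index in the maximal order. -/
lemma exists_natCast_mul_mem {B : Subalgebra ℤ L} (hB : IsZOrder B) :
    ∃ n : ℕ, n ≠ 0 ∧ ∀ x ∈ integralClosure ℤ L, n * x ∈ B := by
  have key : ∀ x : L, ∃ n : ℕ, n ≠ 0 ∧ n * x ∈ B := by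
    intro x
    have hx : x ∈ Submodule.span ℚ (B : Set L) := hB.2 ▸ Submodule.mem_top
    induction hx using Submodule.span_induction with
    | mem x hx => exact ⟨1, one_ne_zero, by simpa using hx⟩
    | zero => exact ⟨1, one_ne_zero, by simp⟩
    | add x y _ _ hx hy =>
      obtain ⟨n, hn, hnx⟩ := hx
      obtain ⟨m, hm, hmy⟩ := hy
      refine ⟨n * m, mul_ne_zero hn hm, ?_⟩
      rw [show ((n * m : ℕ) : L) * (x + y) = m * (n * x) + n * (m * y) by push_cast; ring]
      exact add_mem (mul_mem (natCast_mem _ _) hnx) (mul_mem (natCast_mem _ _) hmy)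
    | smul q x _ hx =>
      obtain ⟨n, hn, hnx⟩ := hx
      refine ⟨q.den * n, mul_ne_zero q.den_ne_zero hn, ?_⟩
      have hq : (q.den : L) * (q : L) = q.num := by
        exact_mod_cast congrArg (Rat.cast : ℚ → L) (Rat.den_mul_eq_num q)
      rw [Algebra.smul_def, show ((q.den * n : ℕ) : L) * (algebraMap ℚ L q * x) = q.num * (n * x) by
        rw [eq_ratCast, ← hq]; push_cast; ring]
      exact mul_mem (intCast_mem _ _) hnx
  obtain ⟨T, hT⟩ := (Module.finite_def (R := ℤ) (M := 𝓞 L)).1 inferInstance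
  choose n hn hnB using key
  refine ⟨∏ x ∈ T, n x, Finset.prod_ne_zero_iff.2 fun x _ => hn x, fun x hx => ?_⟩
  suffices hs : ∀ y : 𝓞 L, ((∏ x ∈ T, n x : ℕ) : L) * algebraMap (𝓞 L) L y ∈ B from hs ⟨x, hx⟩
  intro y
  have hy : y ∈ Submodule.span ℤ (T : Set (𝓞 L)) := hT ▸ Submodule.mem_top
  induction hy using Submodule.span_induction with
  | mem y hy =>
    obtain ⟨c, hc⟩ := Finset.dvd_prod_of_mem (fun x : 𝓞 L => n x) hy
    rw [hc, Nat.cast_mul, mul_comm (n y : L), mul_assoc]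
    exact mul_mem (natCast_mem _ _) (hnB _)
  | zero => rw [map_zero, mul_zero]; exact zero_mem _
  | add y z _ _ hy hz => rw [map_add, mul_add]; exact add_mem hy hz
  | smul a y _ hy =>
    rw [zsmul_eq_mul, map_mul, map_intCast, mul_left_comm]
    exact mul_mem (intCast_mem _ _) hy

end PicardRingOfIntegers

section RelativeOrders

open NumberField NumberField.Units nonZeroDivisors

variable {F K : Type*} [Field F] [NumberField F] [Field K] [NumberField K] [Algebra F K]

lemma finite_quotient_natCast {n : ℕ} (hn0 : n ≠ 0) :
    Finite (integralClosure ℤ K ⧸ Ideal.span {(n : integralClosure ℤ K)}) :=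
  Ideal.finiteQuotientOfFreeOfNeBot (S := 𝓞 K) (Ideal.span {(n : 𝓞 K)}) <| by
    rw [Ne, Ideal.span_singleton_eq_bot]
    exact Nat.cast_ne_zero.2 hn0

variable {B : Subalgebra ℤ K} {n : ℕ}

lemma odd_card_ker_of_BDiamond_subset (h : B ≤ integralClosure ℤ K) (hn0 : n ≠ 0)
    (hn : ∀ x ∈ integralClosure ℤ K, n * x ∈ B) (hsub : BDiamond F K ⊆ (B : Set K)) :
    Odd (Nat.card (picardExtend h).ker) := by
  have := finite_quotient_natCast (K := K) hn0
  have := finite_ker_picardExtend h hn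
  obtain ⟨k, hk, hq⟩ := exists_pow_sub_mem_map_diamondIdeal F K
  refine odd_card_ker_picardExtend h hk fun x hx s hs => hsub (mem_BDiamond_iff.2 ?_)
  obtain ⟨x, rfl⟩ : ∃ y : 𝓞 K, algebraMap (𝓞 K) K y = x := ⟨⟨x, hx⟩, rfl⟩
  obtain ⟨s, rfl⟩ : ∃ y : 𝓞 K, algebraMap (𝓞 K) K y = s := ⟨⟨s, hs⟩, rfl⟩
  refine ⟨0, s * (x ^ 2 ^ k - x), Ideal.mul_mem_left _ _ (hq x), ?_⟩
  change _ = algebraMap F K (algebraMap (𝓞 F) F 0) + algebraMap (𝓞 K) K _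
  rw [map_zero, map_zero, zero_add, ← map_pow, ← map_sub, ← map_mul]

variable (B) in
/-- An order containing `O_F`, as a subalgebra of `O_K`. -/
def relativeSubalgebra (hB : ∀ f : F, f ∈ integralClosure ℤ F → algebraMap F K f ∈ B) :
    Subalgebra (𝓞 F) (𝓞 K) where
  carrier := {x | (x : K) ∈ B}
  mul_mem' hx hy := by
    change algebraMap (𝓞 K) K _ ∈ B
    rw [map_mul]; exact mul_mem hx hy
  add_mem' hx hy := by
    change algebraMap (𝓞 K) K _ ∈ B
    rw [map_add]; exact add_mem hx hy
  algebraMap_mem' r := hB r r.2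

omit [NumberField F] [NumberField K] in
lemma mem_relativeSubalgebra_iff
    {hB : ∀ f : F, f ∈ integralClosure ℤ F → algebraMap F K f ∈ B} {x : 𝓞 K} :
    x ∈ relativeSubalgebra B hB ↔ (x : K) ∈ B := Iff.rfl

omit [NumberField F] [NumberField K] in
/-- An order containing `O_F` is stable under conjugation. -/
lemma IsConjugation.map_mem {s : 𝓞 K ≃ₐ[𝓞 F] 𝓞 K} (hs : IsConjugation F K s)
    {C : Subalgebra (𝓞 F) (𝓞 K)} {x : 𝓞 K} (hx : x ∈ C) : s x ∈ C := by
  obtain ⟨r, hr⟩ := hs.2.1 (x + s x) (by rw [map_add, hs.1, add_comm])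
  rw [← add_sub_cancel_left x (s x), ← hr]
  exact sub_mem (C.algebraMap_mem r) hx

omit [NumberField F] [NumberField K] in
lemma span_image_mul_self (hB : ∀ f : F, f ∈ integralClosure ℤ F → algebraMap F K f ∈ B)
    {a : Ideal (𝓞 F)} {ν : 𝓞 F} (hν : a * a = Ideal.span {ν}) :
    Submodule.span B ((fun r : 𝓞 F => algebraMap F K (algebraMap (𝓞 F) F r)) '' a) *
      Submodule.span B ((fun r : 𝓞 F => algebraMap F K (algebraMap (𝓞 F) F r)) '' a) =
        Submodule.span B {algebraMap F K (algebraMap (𝓞 F) F ν)} := by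
  refine le_antisymm ?_ ?_
  · rw [Submodule.span_mul_span, Submodule.span_le]
    rintro _ ⟨_, ⟨r, hr, rfl⟩, _, ⟨r', hr', rfl⟩, rfl⟩
    obtain ⟨c, hc⟩ := Ideal.mem_span_singleton'.1 (hν ▸ Ideal.mul_mem_mul hr hr')
    refine Submodule.mem_span_singleton.2 ⟨⟨algebraMap F K c, hB c c.2⟩, ?_⟩
    change algebraMap F K (algebraMap (𝓞 F) F c) * algebraMap F K (algebraMap (𝓞 F) F ν) =
      algebraMap F K (algebraMap (𝓞 F) F r) * algebraMap F K (algebraMap (𝓞 F) F r')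
    rw [← map_mul, ← map_mul, hc, map_mul, map_mul]
  · rw [Submodule.span_le, Set.singleton_subset_iff]
    suffices key : ∀ x ∈ a * a, algebraMap F K (algebraMap (𝓞 F) F x) ∈
        Submodule.span B ((fun r : 𝓞 F => algebraMap F K (algebraMap (𝓞 F) F r)) '' a) *
          Submodule.span B ((fun r : 𝓞 F => algebraMap F K (algebraMap (𝓞 F) F r)) '' a) from
      key ν (hν ▸ Ideal.mem_span_singleton_self ν)
    intro x hx
    induction hx using Submodule.mul_induction_on' with
    | mem_mul_mem r hr r' hr' =>
      rw [map_mul (algebraMap (𝓞 F) F), map_mul]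
      exact Submodule.mul_mem_mul (Submodule.subset_span ⟨r, hr, rfl⟩)
        (Submodule.subset_span ⟨r', hr', rfl⟩)
    | add x _ y _ hx hy =>
      rw [map_add (algebraMap (𝓞 F) F), map_add]
      exact add_mem hx hy

omit [NumberField F] [NumberField K] in
lemma span_integralClosure_image {a : Ideal (𝓞 F)} {l : 𝓞 K}
    (hl : a.map (algebraMap (𝓞 F) (𝓞 K)) = Ideal.span {l}) :
    Submodule.span (integralClosure ℤ K)
        ((fun r : 𝓞 F => algebraMap F K (algebraMap (𝓞 F) F r)) '' a) =
      Submodule.span (integralClosure ℤ K) {algebraMap (𝓞 K) K l} := by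
  refine le_antisymm ?_ ?_
  · rw [Submodule.span_le]
    rintro _ ⟨r, hr, rfl⟩
    obtain ⟨c, hc⟩ := Ideal.mem_span_singleton'.1 (hl ▸ Ideal.mem_map_of_mem _ hr)
    refine Submodule.mem_span_singleton.2 ⟨c, ?_⟩
    change algebraMap (𝓞 K) K c * algebraMap (𝓞 K) K l =
      algebraMap (𝓞 K) K (algebraMap (𝓞 F) (𝓞 K) r)
    rw [← map_mul, hc]
  · rw [Submodule.span_le, Set.singleton_subset_iff]
    suffices key : ∀ x ∈ a.map (algebraMap (𝓞 F) (𝓞 K)), algebraMap (𝓞 K) K x ∈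
        Submodule.span (integralClosure ℤ K)
          ((fun r : 𝓞 F => algebraMap F K (algebraMap (𝓞 F) F r)) '' a) from
      key l (hl ▸ Ideal.mem_span_singleton_self l)
    intro x hx
    induction hx using Submodule.span_induction with
    | mem x hx =>
      obtain ⟨r, hr, rfl⟩ := hx
      exact Submodule.subset_span ⟨r, hr, rfl⟩
    | zero => rw [map_zero]; exact zero_mem _
    | add x y _ _ hx hy => rw [map_add]; exact add_mem hx hy
    | smul c x _ hx =>
      rw [smul_eq_mul, map_mul]
      exact Submodule.smul_mem _ (c : integralClosure ℤ K) hx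

omit [NumberField K] in
/-- If the kernel of `Pic B → Pic O_K` has odd order, a capitulating ideal of `O_F` generates a
principal `B`-ideal. -/
lemma IsConjugation.exists_span_eq (h : B ≤ integralClosure ℤ K)
    (hB : ∀ f : F, f ∈ integralClosure ℤ F → algebraMap F K f ∈ B)
    (hodd : Odd (Nat.card (picardExtend h).ker)) {s : 𝓞 K ≃ₐ[𝓞 F] 𝓞 K} (hs : IsConjugation F K s)
    {a : Ideal (𝓞 F)} (ha0 : a ≠ ⊥) {l : 𝓞 K}
    (hl : a.map (algebraMap (𝓞 F) (𝓞 K)) = Ideal.span {l}) :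
    ∃ x : K, Submodule.span B ((fun r : 𝓞 F => algebraMap F K (algebraMap (𝓞 F) F r)) '' a) =
      Submodule.span B {x} := by
  obtain ⟨ν, -, hν⟩ := hs.exists_mul_self_eq_span hl
  have hν0 : algebraMap F K (algebraMap (𝓞 F) F ν) ≠ 0 := by
    rw [Ne, FaithfulSMul.algebraMap_eq_zero_iff, FaithfulSMul.algebraMap_eq_zero_iff]
    rintro rfl
    rw [Ideal.span_singleton_zero, Ideal.mul_eq_bot, or_self] at hν
    exact ha0 hν
  have hl0 : algebraMap (𝓞 K) K l ≠ 0 := by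
    rw [Ne, FaithfulSMul.algebraMap_eq_zero_iff]
    rintro rfl
    rw [Ideal.span_singleton_zero,
      Ideal.map_eq_bot_iff_of_injective (FaithfulSMul.algebraMap_injective (𝓞 F) (𝓞 K))] at hl
    exact ha0 hl
  set P := Submodule.span B ((fun r : 𝓞 F => algebraMap F K (algebraMap (𝓞 F) F r)) '' a) with hP
  let v := principalUnit B (Units.mk0 _ hν0)
  have hPP : P * P = v := span_image_mul_self hB hν
  let p : (Submodule B K)ˣ := ⟨P, P * (v⁻¹ : (Submodule B K)ˣ), by
    rw [← mul_assoc, hPP, Units.mul_inv], by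
    rw [mul_right_comm, hPP, Units.mul_inv]⟩
  have hp2 : picCls B p ^ 2 = 1 := by
    rw [← picCls_pow, show p ^ 2 = v from Units.ext (by rw [sq, Units.val_mul]; exact hPP)]
    exact picCls_principalUnit _
  have hpk : picCls B p ∈ (picardExtend h).ker := by
    rw [MonoidHom.mem_ker, picardExtend_picCls, picCls_eq_one_iff]
    refine ⟨l, hl0.isUnit, ?_⟩
    rw [coe_extendUnits]
    exact (extendSubmodule_span h _).trans (span_integralClosure_image hl)
  have hpN : picCls B p ^ Nat.card (picardExtend h).ker = 1 :=
    congrArg Subtype.val (pow_card_eq_one' (x := (⟨_, hpk⟩ : (picardExtend h).ker)))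
  obtain ⟨k, hk⟩ := hodd
  rw [hk, pow_succ, pow_mul, hp2, one_pow, one_mul] at hpN
  obtain ⟨x, -, hx⟩ := picCls_eq_one_iff.1 hpN
  exact ⟨x, hx⟩

omit [NumberField F] [NumberField K] in
/-- A generator of a capitulating ideal that already generates it over an order `B` differs from
its conjugate by elements of `B`. -/
lemma IsConjugation.exists_eq_mul_of_span_eq (h : B ≤ integralClosure ℤ K)
    (hB : ∀ f : F, f ∈ integralClosure ℤ F → algebraMap F K f ∈ B)
    {s : 𝓞 K ≃ₐ[𝓞 F] 𝓞 K} (hs : IsConjugation F K s) {a : Ideal (𝓞 F)} {l : 𝓞 K}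
    (hl : Submodule.span B ((fun r : 𝓞 F => algebraMap F K (algebraMap (𝓞 F) F r)) '' a) =
      Submodule.span B {algebraMap (𝓞 K) K l}) :
    ∃ b ∈ B, algebraMap (𝓞 K) K (s l) = b * algebraMap (𝓞 K) K l := by
  set P := Submodule.span B ((fun r : 𝓞 F => algebraMap F K (algebraMap (𝓞 F) F r)) '' a) with hP
  have key : ∀ x ∈ P, ∃ y : 𝓞 K, algebraMap (𝓞 K) K y = x ∧ algebraMap (𝓞 K) K (s y) ∈ P := by
    intro x hx
    induction hx using Submodule.span_induction with
    | mem x hx =>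
      obtain ⟨r, hr, rfl⟩ := hx
      refine ⟨algebraMap (𝓞 F) (𝓞 K) r, rfl, ?_⟩
      rw [AlgEquiv.commutes]
      exact Submodule.subset_span ⟨r, hr, rfl⟩
    | zero => exact ⟨0, map_zero _, by rw [map_zero, map_zero]; exact zero_mem _⟩
    | add x x' _ _ hx hx' =>
      obtain ⟨y, rfl, hy⟩ := hx
      obtain ⟨y', rfl, hy'⟩ := hx'
      exact ⟨y + y', map_add _ _ _, by rw [map_add, map_add]; exact add_mem hy hy'⟩
    | smul b x _ hx =>
      obtain ⟨y, rfl, hy⟩ := hx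
      let b' : 𝓞 K := ⟨b, h b.2⟩
      have hb : s b' ∈ relativeSubalgebra B hB := hs.map_mem (mem_relativeSubalgebra_iff.2 b.2)
      refine ⟨b' * y, map_mul _ _ _, ?_⟩
      rw [map_mul, map_mul]
      exact Submodule.smul_mem P (⟨_, mem_relativeSubalgebra_iff.1 hb⟩ : B) hy
  obtain ⟨y, hy, hsy⟩ := key _ (hl ▸ Submodule.mem_span_singleton_self _)
  rw [FaithfulSMul.algebraMap_injective (𝓞 K) K hy, hl] at hsy
  obtain ⟨b, hb⟩ := Submodule.mem_span_singleton.1 hsy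
  exact ⟨b, b.2, hb.symm⟩

/-- If the kernel of `Pic B → Pic O_K` has odd order, then `B` contains `B_⋄`. -/
lemma IsConjugation.BDiamond_subset (hK : Module.finrank F K = 2) (h : B ≤ integralClosure ℤ K)
    (hB : ∀ f : F, f ∈ integralClosure ℤ F → algebraMap F K f ∈ B) (hn0 : n ≠ 0)
    (hn : ∀ x ∈ integralClosure ℤ K, n * x ∈ B) {s : 𝓞 K ≃ₐ[𝓞 F] 𝓞 K} (hs : IsConjugation F K s)
    (hcap : ¬ Function.Injective (ClassGroup.extendedHom (𝓞 F) (𝓞 K)))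
    (hodd : Odd (Nat.card (picardExtend h).ker)) : BDiamond F K ⊆ (B : Set K) := by
  obtain ⟨a, ha, ha0, l, hl⟩ : ∃ a : Ideal (𝓞 F), ¬ a.IsPrincipal ∧ a ≠ ⊥ ∧
      ∃ l, a.map (algebraMap (𝓞 F) (𝓞 K)) = Ideal.span {l} := by
    have hcap' := hcap
    rw [injective_iff_map_eq_one] at hcap'
    push Not at hcap'
    obtain ⟨c, hc, hc1⟩ := hcap'
    obtain ⟨a, rfl⟩ := ClassGroup.mk0_surjective c
    rw [ClassGroup.extendedHom_mk0, ClassGroup.mk0_eq_one_iff] at hc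
    obtain ⟨l, hl⟩ := hc
    exact ⟨a, fun ha => hc1 ((ClassGroup.mk0_eq_one_iff a.2).2 ha),
      mem_nonZeroDivisors_iff_ne_zero.1 a.2, l, hl⟩
  obtain ⟨x, hx⟩ := hs.exists_span_eq h hB hodd ha0 hl
  have hxl : Submodule.span (integralClosure ℤ K) {x} =
      Submodule.span (integralClosure ℤ K) {algebraMap (𝓞 K) K l} := by
    rw [← span_integralClosure_image hl, ← extendSubmodule_span h, ← hx, extendSubmodule_span]
  obtain ⟨l', hl'⟩ : ∃ l' : 𝓞 K, algebraMap (𝓞 K) K l' = x := by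
    obtain ⟨c, hc⟩ := Submodule.mem_span_singleton.1 (hxl ▸ Submodule.mem_span_singleton_self x)
    let c' : 𝓞 K := c
    exact ⟨c' * l, (map_mul (algebraMap (𝓞 K) K) c' l).trans hc⟩
  subst hl'
  have hll' : a.map (algebraMap (𝓞 F) (𝓞 K)) = Ideal.span {l'} := by
    have hle : ∀ z z' : 𝓞 K, Submodule.span (integralClosure ℤ K) {algebraMap (𝓞 K) K z} =
        Submodule.span (integralClosure ℤ K) {algebraMap (𝓞 K) K z'} →
        Ideal.span {z} ≤ Ideal.span {z'} := by
      intro z z' hzz'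
      obtain ⟨c, hc⟩ := Submodule.mem_span_singleton.1 (hzz' ▸ Submodule.mem_span_singleton_self _)
      rw [Ideal.span_singleton_le_span_singleton]
      let c' : 𝓞 K := c
      refine ⟨c', FaithfulSMul.algebraMap_injective (𝓞 K) K ?_⟩
      rw [mul_comm]
      exact hc.symm.trans (map_mul (algebraMap (𝓞 K) K) c' z').symm
    rw [hl]
    exact le_antisymm (hle _ _ hxl.symm) (hle _ _ hxl)
  obtain ⟨ζ, hζ⟩ := hs.exists_torsion ha0 hll'
  have hl0 : l' ≠ 0 := by
    rintro rfl
    rw [Ideal.span_singleton_zero,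
      Ideal.map_eq_bot_iff_of_injective (FaithfulSMul.algebraMap_injective (𝓞 F) (𝓞 K))] at hll'
    exact ha0 hll'
  set C := relativeSubalgebra B hB with hC
  have hζC : (((ζ⁻¹ : torsion K) : (𝓞 K)ˣ) : 𝓞 K) ∈ C := by
    obtain ⟨b, hbB, hb⟩ := hs.exists_eq_mul_of_span_eq h hB hx
    let b' : 𝓞 K := ⟨b, h hbB⟩
    have hb' : s l' = b' * l' := FaithfulSMul.algebraMap_injective (𝓞 K) K
      (hb.trans (map_mul (algebraMap (𝓞 K) K) b' l').symm)
    have hζb : ((ζ : (𝓞 K)ˣ) : 𝓞 K) * b' = 1 := by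
      refine mul_right_cancel₀ hl0 ?_
      rw [one_mul, mul_assoc, ← hb', ← hζ]
    have : (((ζ⁻¹ : torsion K) : (𝓞 K)ˣ) : 𝓞 K) = b' := by
      rw [Subgroup.coe_inv]
      exact Units.inv_eq_of_mul_eq_one_right hζb
    rw [this]
    exact mem_relativeSubalgebra_iff.2 hbB
  have hζC' : ((ζ : (𝓞 K)ˣ) : 𝓞 K) ∈ C := by
    have : ζ = ζ⁻¹ ^ (orderOf ζ - 1) := by
      rw [inv_pow, eq_inv_iff_mul_eq_one, ← pow_succ',
        Nat.sub_add_cancel (orderOf_pos ζ), pow_orderOf_eq_one]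
    rw [this, Subgroup.coe_pow, Units.val_pow_eq_pow_val]
    exact pow_mem hζC _
  obtain ⟨m, hm, hpow⟩ := hs.exists_odd_pow ha ha0 hll' hζ
  rintro _ ⟨f, y, hy, rfl⟩
  refine add_mem (hB f f.2) ?_
  have hyC : (y : 𝓞 K) ∈ C := by
    refine hs.map_le_of_forall_pow_mem hK hcap hn0 (N := Nat.card (picardExtend h).ker * m)
      (fun x => ?_) (hodd.mul hm) (fun y y' w hyw => ?_) (f := diamondIdeal F K)
      (fun p hp hp0 hp2 => ?_) hy
    · have := hn (algebraMap (𝓞 K) K x) x.2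
      rw [← map_natCast (algebraMap (𝓞 K) K), ← map_mul] at this
      exact mem_relativeSubalgebra_iff.2 this
    · have hyw' : algebraMap (𝓞 K) K y * algebraMap (𝓞 K) K y' =
          1 + n * algebraMap (𝓞 K) K w := by
        rw [← map_mul, hyw, map_add, map_mul, map_one, map_natCast]
      obtain ⟨e, he, e', he', hee', b, hb, hyb⟩ := exists_pow_card_ker_eq h hn y.2 y'.2 w.2 hyw'
      let ε : (𝓞 K)ˣ := ⟨⟨e, he⟩, ⟨e', he'⟩, Subtype.ext hee',
        Subtype.ext ((mul_comm _ _).trans hee')⟩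
      let b' : 𝓞 K := ⟨b, h hb⟩
      have hyb' : y ^ Nat.card (picardExtend h).ker = (ε : 𝓞 K) * b' := Subtype.ext hyb
      obtain ⟨i, r, hεr⟩ := hpow ε
      rw [pow_mul, hyb', mul_pow, hεr]
      exact mul_mem (mul_mem (pow_mem hζC' _) (C.algebraMap_mem r))
        (pow_mem (mem_relativeSubalgebra_iff.2 hb) _)
    · by_cases hr : IsRamifiedPrime K p
      · obtain ⟨Q, hQ, -, hpQ⟩ := hr
        exact Or.inr ⟨Q, hQ, hpQ⟩
      · exact Or.inl (dvd_diamondIdeal ⟨hp, hp0, hp2⟩ hr)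
  exact mem_relativeSubalgebra_iff.1 hyC

end RelativeOrders

section DiamondOrder

open NumberField

variable {F K : Type*} [Field F] [NumberField F] [Field K] [NumberField K] [Algebra F K]

lemma isRamifiedPrime_of_BDiamond_eq (hK : Module.finrank F K = 2)
    (hD : BDiamond F K = (integralClosure ℤ K : Set K)) {P : Ideal (𝓞 F)}
    (hP : IsDyadicPrime P) : IsRamifiedPrime K P := by
  refine isRamifiedPrime_of_forall_exists_sub_mem hK (fun x => ?_) hP
  have hx : algebraMap (𝓞 K) K x ∈ BDiamond F K := hD ▸ x.2
  obtain ⟨f, y, hy, hxy⟩ := mem_BDiamond_iff.1 hx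
  have : x = algebraMap (𝓞 F) (𝓞 K) f + y := Subtype.ext hxy
  exact ⟨f, by rwa [this, add_sub_cancel_left]⟩

lemma BDiamond_eq_integralClosure (h : ∀ P : Ideal (𝓞 F), IsDyadicPrime P → IsRamifiedPrime K P) :
    BDiamond F K = (integralClosure ℤ K : Set K) := by
  obtain ⟨T, hT, hprod⟩ := exists_diamondIdeal_eq_prod F K
  have hT0 : T = ∅ := Finset.eq_empty_of_forall_notMem fun P hP =>
    ((hT P).1 hP).2 (h P ((hT P).1 hP).1)
  rw [hT0, Finset.prod_empty] at hprod
  ext x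
  rw [mem_BDiamond_iff, hprod, Ideal.one_eq_top, Ideal.map_top]
  constructor
  · rintro ⟨f, y, -, rfl⟩
    exact (algebraMap (𝓞 F) (𝓞 K) f + y).2
  · intro hx
    refine ⟨0, ⟨x, hx⟩, Submodule.mem_top, ?_⟩
    change x = algebraMap F K (algebraMap (𝓞 F) F 0) + x
    rw [map_zero, map_zero, zero_add]

end DiamondOrder

theorem odd_relative_class_number_iff_contains_BDiamond
    {F : Type*} [Field F] [NumberField F] (hF : TotReal F)
    {K : Type*} [Field K] [NumberField K] [Algebra F K]
    (hquad : Module.finrank F K = 2) (hCM : IsEmpty (K →+* ℝ))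
    -- `h(F)` is even and `h(K)/h(F)` is odd
    (hFeven : Even (hPic (integralClosure ℤ F)))
    (hrel : ∃ m : ℕ, Odd m ∧
      hPic (integralClosure ℤ K) = hPic (integralClosure ℤ F) * m) :
    -- an `O_F`-order `B ⊆ O_K` has odd relative class number iff it contains `B_⋄`
    (∀ B : Subalgebra ℤ K, IsZOrder B → B ≤ integralClosure ℤ K →
      (∀ f : F, f ∈ integralClosure ℤ F → algebraMap F K f ∈ B) →
      ((∃ m : ℕ, Odd m ∧ hPic B = hPic (integralClosure ℤ F) * m) ↔
        BDiamond F K ⊆ (B : Set K))) ∧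
    -- `B_⋄ = O_K` iff `F` has a single dyadic prime and it is ramified in `K/F`
    (BDiamond F K = (integralClosure ℤ K : Set K) ↔
      ((∃! P : Ideal ↥(integralClosure ℤ F), IsDyadic P) ∧
        ∀ P : Ideal ↥(integralClosure ℤ F), IsDyadic P → IsRamifiedIn K P)) := by
  obtain ⟨m, hm, hcard⟩ := hrel
  obtain ⟨s, hs⟩ := exists_conj hF hquad hCM
  replace hs : IsConjugation F K s := hs
  have hcard' := hcard
  rw [hPic_integralClosure, hPic_integralClosure] at hcard'
  rw [hPic_integralClosure] at hFeven
  have hcap := exists_capitulation hF hquad hCM hFeven hm hcard'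
  refine ⟨fun B hBo h hB => ?_, fun hD => ⟨?_, ?_⟩, fun hP => BDiamond_eq_integralClosure hP.2⟩
  · obtain ⟨n, hn0, hn⟩ := exists_natCast_mul_mem hBo
    have hcardB := hPic_eq_mul_card_ker h hn0 hn
    refine ⟨fun ⟨m', hm', hcardB'⟩ => hs.BDiamond_subset hquad h hB hn0 hn hcap ?_,
      fun hsub => ⟨_, hm.mul (odd_card_ker_of_BDiamond_subset h hn0 hn hsub), ?_⟩⟩
    · have hpos : 0 < hPic (integralClosure ℤ F) := by
        rw [hPic_integralClosure]; exact Nat.card_pos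
      rw [hcardB', hcard, mul_assoc] at hcardB
      rw [Nat.eq_of_mul_eq_mul_left hpos hcardB] at hm'
      exact (Nat.odd_mul.1 hm').2
    · rw [hcardB, hcard, mul_assoc]
  · obtain ⟨P, hP⟩ := exists_isDyadicPrime F
    refine ⟨P, hP, fun P' hP' => ?_⟩
    obtain ⟨Q, hQ, -, hPQ⟩ := isRamifiedPrime_of_BDiamond_eq hquad hD hP
    obtain ⟨Q', hQ', -, hPQ'⟩ := isRamifiedPrime_of_BDiamond_eq hquad hD hP'
    exact hs.eq_of_ramified hquad hcap hm hcard' hP'.1 hP'.2.1 hP.1 hP.2.1 hQ' hQ hPQ' hPQ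
  · exact fun P hP => isRamifiedPrime_of_BDiamond_eq hquad hD hP

end
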